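/- arXiv:quant-ph/0004036 — 2 statements merged into one kernel-verified Lean document; each statement's English description precedes it below -/
import Mathlib

section
/- Let H₁,…,Hₙ be finite dimensional Hilbert spaces, none of dimension 2, and m a positive quantum multi-measure for them. Then there exists an unentangled frame function f on Σ(H₁,…,Hₙ) such that f(ν₁ ⊗ ⋯ ⊗ νₙ) = m(p₁,…,pₙ) whenever p_j is the rank-one projection onto ℂν_j. -/
open scoped InnerProductSpace

/-- orthogonal projection (self-adjoint idempotent). -/
def IsProjectionOp {H : Type*} [NormedAddCommGroup H] [InnerProductSpace ℂ H]
    [CompleteSpace H] (e : H →L[ℂ] H) : Prop :=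
  IsIdempotentElem e ∧ IsSelfAdjoint e

/-- A positive quantum multi-measure: nonnegative and orthoadditive in each
variable separately on tuples of projections. -/
def IsQuantumMultimeasure {n : ℕ} {H : Fin n → Type*}
    [∀ i, NormedAddCommGroup (H i)] [∀ i, InnerProductSpace ℂ (H i)]
    [∀ i, CompleteSpace (H i)]
    (m : (∀ i, H i →L[ℂ] H i) → ℝ) : Prop :=
  (∀ p : ∀ i, H i →L[ℂ] H i, (∀ i, IsProjectionOp (p i)) → 0 ≤ m p) ∧
  ∀ (p : ∀ i, H i →L[ℂ] H i), (∀ i, IsProjectionOp (p i)) →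
    ∀ (i : Fin n) (q r : H i →L[ℂ] H i),
      IsProjectionOp q → IsProjectionOp r → q * r = 0 → r * q = 0 →
      m (Function.update p i (q + r)) =
        m (Function.update p i q) + m (Function.update p i r)

/-- `t` realizes `E` as the Hilbert tensor product of the `H i`. -/
def IsHilbertTensorMap {n : ℕ} {H : Fin n → Type*}
    [∀ i, NormedAddCommGroup (H i)] [∀ i, InnerProductSpace ℂ (H i)]
    {E : Type*} [NormedAddCommGroup E] [InnerProductSpace ℂ E]
    (t : (∀ i, H i) → E) : Prop :=
  (∀ v w : ∀ i, H i, ⟪t v, t w⟫_ℂ = ∏ i, ⟪v i, w i⟫_ℂ) ∧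
  (∀ (v : ∀ i, H i) (i : Fin n) (a b : H i),
      t (Function.update v i (a + b)) =
        t (Function.update v i a) + t (Function.update v i b)) ∧
  (∀ (v : ∀ i, H i) (i : Fin n) (z : ℂ) (a : H i),
      t (Function.update v i (z • a)) = z • t (Function.update v i a)) ∧
  (Submodule.span ℂ (Set.range t)).topologicalClosure = ⊤

open scoped ComplexConjugate

/-- `G`, written in coordinates of `ℝ³`, is quadratically homogeneous and the sum of its values on
two orthogonal vectors of equal length depends only on their length and on the plane they span. -/
structure CoordPlaneAdditive (G : ℝ → ℝ → ℝ → ℝ) : Prop where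
  homog : ∀ c x y z, G (c * x) (c * y) (c * z) = c ^ 2 * G x y z
  planar : ∀ x y z x' y' z', x ^ 2 + y ^ 2 + z ^ 2 = x' ^ 2 + y' ^ 2 + z' ^ 2 →
    x * x' + y * y' + z * z' = 0 → ∀ a b,
    G (a * x + b * x') (a * y + b * y') (a * z + b * z') +
      G (a * x' - b * x) (a * y' - b * y) (a * z' - b * z) =
      (a ^ 2 + b ^ 2) * (G x y z + G x' y' z')

namespace CoordPlaneAdditive

variable {G : ℝ → ℝ → ℝ → ℝ} {M c ε : ℝ}

theorem map_neg (hG : CoordPlaneAdditive G) (x y z : ℝ) : G (-x) (-y) (-z) = G x y z := by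
  simpa using hG.homog (-1) x y z

theorem map_pole (hG : CoordPlaneAdditive G) (hM : G 0 0 1 = M) (z : ℝ) :
    G 0 0 z = z ^ 2 * M := by
  simpa [hM] using hG.homog z 0 0 1

theorem add {G' : ℝ → ℝ → ℝ → ℝ} (hG : CoordPlaneAdditive G) (hG' : CoordPlaneAdditive G') :
    CoordPlaneAdditive fun x y z => G x y z + G' x y z where
  homog k x y z := by simp only [hG.homog, hG'.homog]; ring
  planar x y z x' y' z' h h' a b := by
    linear_combination hG.planar x y z x' y' z' h h' a b + hG'.planar x y z x' y' z' h h' a b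

theorem neg (hG : CoordPlaneAdditive G) : CoordPlaneAdditive fun x y z => -G x y z where
  homog k x y z := by simp only [hG.homog]; ring
  planar x y z x' y' z' h h' a b := by
    linear_combination -hG.planar x y z x' y' z' h h' a b

theorem sub_diagonal (hG : CoordPlaneAdditive G) (p q r : ℝ) :
    CoordPlaneAdditive fun x y z => G x y z - (p * x ^ 2 + q * y ^ 2 + r * z ^ 2) where
  homog k x y z := by simp only [hG.homog]; ring
  planar x y z x' y' z' h h' a b := by
    linear_combination hG.planar x y z x' y' z' h h' a b

/-- Precomposition with the quarter turn about the third axis. -/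
theorem quarterTurn (hG : CoordPlaneAdditive G) :
    CoordPlaneAdditive fun x y z => G (-y) x z where
  homog k x y z := by
    have := hG.homog k (-y) x z
    rwa [mul_neg] at this
  planar x y z x' y' z' h h' a b := by
    have := hG.planar (-y) x z (-y') x' z' (by linarith) (by linarith) a b
    convert this using 3 <;> ring

/-- Cyclic permutation of the coordinates. -/
theorem cyclic (hG : CoordPlaneAdditive G) : CoordPlaneAdditive fun x y z => G z x y where
  homog k x y z := hG.homog k z x y
  planar x y z x' y' z' h h' a b :=
    hG.planar z x y z' x' y' (by linarith) (by linarith) a b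

/-- The sum of `G` over an orthogonal pair in a meridian plane. -/
theorem meridian (hG : CoordPlaneAdditive G) (hM : G 0 0 1 = M)
    (hc : ∀ x y, G x y 0 = c * (x ^ 2 + y ^ 2)) {x y r : ℝ} (z : ℝ) (hr : 0 < r)
    (hxy : r ^ 2 = x ^ 2 + y ^ 2) :
    G x y z + G (z * x / r) (z * y / r) (-r) = (x ^ 2 + y ^ 2 + z ^ 2) * (M + c) := by
  have h := hG.planar 0 0 r x y 0 (by linarith) (by ring) (z / r) 1
  rw [hG.map_pole hM, hc, ← hxy] at h
  have e1 : z / r * r = z := by field_simp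
  simp only [mul_zero, zero_add, one_mul, add_zero, sub_zero, e1, zero_sub] at h
  rw [show z * x / r = z / r * x by ring, show z * y / r = z / r * y by ring, h]
  field_simp
  rw [hxy]; ring

theorem lower_bound (hG : CoordPlaneAdditive G) (hM : G 0 0 1 = M)
    (hc : ∀ x y, G x y 0 = c * (x ^ 2 + y ^ 2))
    (hub : ∀ x y z, G x y z ≤ (M + ε) * (x ^ 2 + y ^ 2 + z ^ 2)) (x y z : ℝ) :
    (c - ε) * (x ^ 2 + y ^ 2 + z ^ 2) ≤ G x y z := by
  have hcM : c ≤ M + ε := by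
    have := hub 1 0 0
    rw [hc] at this
    linarith
  rcases eq_or_lt_of_le (by positivity : 0 ≤ x ^ 2 + y ^ 2) with h0 | hpos
  · have hx : x = 0 := by nlinarith [sq_nonneg x, sq_nonneg y]
    have hy : y = 0 := by nlinarith [sq_nonneg x, sq_nonneg y]
    subst hx hy
    rw [hG.map_pole hM]
    nlinarith [sq_nonneg z]
  · have hr := Real.sqrt_pos.2 hpos
    have hr2 := Real.sq_sqrt hpos.le
    have h := hG.meridian hM hc z hr hr2
    have h' := hub (z * x / √(x ^ 2 + y ^ 2)) (z * y / √(x ^ 2 + y ^ 2)) (-√(x ^ 2 + y ^ 2))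
    have e : (z * x / √(x ^ 2 + y ^ 2)) ^ 2 + (z * y / √(x ^ 2 + y ^ 2)) ^ 2 +
        (-√(x ^ 2 + y ^ 2)) ^ 2 = x ^ 2 + y ^ 2 + z ^ 2 := by
      rw [div_pow, div_pow, neg_sq, hr2]
      field_simp
      ring
    rw [e] at h'
    linarith

/-- `G`, normalized, in the gnomonic chart of the northern hemisphere. -/
noncomputable def gnomonic (G : ℝ → ℝ → ℝ → ℝ) (P : ℂ) : ℝ :=
  G P.re P.im 1 / (1 + Complex.normSq P)

theorem gnomonic_mul_tilt_le (hG : CoordPlaneAdditive G) (hM : G 0 0 1 = M)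
    (hc : ∀ x y, G x y 0 = c * (x ^ 2 + y ^ 2))
    (hub : ∀ x y z, G x y z ≤ (M + ε) * (x ^ 2 + y ^ 2 + z ^ 2)) (P : ℂ) (τ : ℝ) :
    gnomonic G (P * (1 + τ * Complex.I)) ≤ gnomonic G P + ε := by
  have hε : 0 ≤ ε := by
    have := hub 0 0 1
    rw [hM] at this
    linarith
  obtain ⟨x, y⟩ := P
  have e1 : ((⟨x, y⟩ : ℂ) * (1 + τ * Complex.I)).re = x - τ * y := by simp; ring
  have e2 : ((⟨x, y⟩ : ℂ) * (1 + τ * Complex.I)).im = y + τ * x := by simp; ring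
  simp only [gnomonic, Complex.normSq_apply, e1, e2]
  rcases eq_or_lt_of_le (by positivity : 0 ≤ x ^ 2 + y ^ 2) with h0 | hpos
  · have hx : x = 0 := by nlinarith [sq_nonneg x, sq_nonneg y]
    have hy : y = 0 := by nlinarith [sq_nonneg x, sq_nonneg y]
    subst hx hy
    simpa using hε
  · have hr := Real.sqrt_pos.2 hpos
    have hr2 := Real.sq_sqrt hpos.le
    have hN := Real.sqrt_pos.2 (show 0 < x ^ 2 + y ^ 2 + 1 by positivity)
    have hN2 := Real.sq_sqrt (show 0 ≤ x ^ 2 + y ^ 2 + 1 by positivity)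
    set r := √(x ^ 2 + y ^ 2)
    set N := √(x ^ 2 + y ^ 2 + 1)
    have hNr : (N / r) ^ 2 * (x ^ 2 + y ^ 2) = x ^ 2 + y ^ 2 + 1 := by
      rw [div_pow, ← hr2, hN2]; field_simp; rw [hr2]
    have h := hG.planar x y 1 (-y * (N / r)) (x * (N / r)) 0 (by linear_combination -hNr)
      (by ring) 1 (τ * r / N)
    have h' := hG.lower_bound hM hc hub (1 * (-y * (N / r)) - τ * r / N * x)
      (1 * (x * (N / r)) - τ * r / N * y) (1 * 0 - τ * r / N * 1)
    have hk : τ * r / N * (N / r) = τ := by field_simp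
    have e3 : 1 * x + τ * r / N * (-y * (N / r)) = x - τ * y := by
      linear_combination (-y) * hk
    have e4 : 1 * y + τ * r / N * (x * (N / r)) = y + τ * x := by
      linear_combination x * hk
    have e5 : 1 * 1 + τ * r / N * 0 = (1 : ℝ) := by ring
    rw [e3, e4, e5, hc] at h
    have hk2 : (τ * r / N) ^ 2 * (x ^ 2 + y ^ 2 + 1) = τ ^ 2 * (x ^ 2 + y ^ 2) := by
      rw [div_pow, ← hN2, ← hr2]; field_simp
    have e6 : (1 * (-y * (N / r)) - τ * r / N * x) ^ 2 + (1 * (x * (N / r)) - τ * r / N * y) ^ 2 +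
        (1 * 0 - τ * r / N * 1) ^ 2 = (1 + (τ * r / N) ^ 2) * (x ^ 2 + y ^ 2 + 1) := by
      linear_combination hNr
    have e7 : (-y * (N / r)) ^ 2 + (x * (N / r)) ^ 2 = x ^ 2 + y ^ 2 + 1 := by
      linear_combination hNr
    rw [e7] at h
    rw [e6] at h'
    have e8 : 1 + ((x - τ * y) * (x - τ * y) + (y + τ * x) * (y + τ * x)) =
        (1 + (τ * r / N) ^ 2) * (x ^ 2 + y ^ 2 + 1) := by
      linear_combination -hk2
    have e9 : 1 + (x * x + y * y) = x ^ 2 + y ^ 2 + 1 := by ring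
    rw [e8, e9, div_le_iff₀ (by positivity)]
    have e10 : (G x y 1 / (x ^ 2 + y ^ 2 + 1) + ε) *
        ((1 + (τ * r / N) ^ 2) * (x ^ 2 + y ^ 2 + 1)) =
        (1 + (τ * r / N) ^ 2) * (G x y 1 + ε * (x ^ 2 + y ^ 2 + 1)) := by
      field_simp
    rw [e10]
    linarith

theorem gnomonic_mul_real_le (hG : CoordPlaneAdditive G) (hM : G 0 0 1 = M)
    (hc : ∀ x y, G x y 0 = c * (x ^ 2 + y ^ 2))
    (hub : ∀ x y z, G x y z ≤ (M + ε) * (x ^ 2 + y ^ 2 + z ^ 2)) (P : ℂ) {k : ℝ} (hk : 1 ≤ k) :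
    gnomonic G (P * k) ≤ gnomonic G P + 2 * ε := by
  have h1 := hG.gnomonic_mul_tilt_le hM hc hub P (√(k - 1))
  have h2 := hG.gnomonic_mul_tilt_le hM hc hub (P * (1 + √(k - 1) * Complex.I)) (-√(k - 1))
  have e : P * (1 + √(k - 1) * Complex.I) * (1 + (-√(k - 1) : ℝ) * Complex.I) = P * k := by
    have hs : ((√(k - 1) : ℝ) : ℂ) ^ 2 = k - 1 := by
      rw [← Complex.ofReal_pow, Real.sq_sqrt (by linarith)]; simp
    push_cast
    linear_combination P * hs - P * (√(k - 1) : ℝ) ^ 2 * Complex.I_sq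
  rw [e] at h2
  linarith

theorem gnomonic_radial_le (hG : CoordPlaneAdditive G) (hM : G 0 0 1 = M)
    (hc : ∀ x y, G x y 0 = c * (x ^ 2 + y ^ 2))
    (hub : ∀ x y z, G x y z ≤ (M + ε) * (x ^ 2 + y ^ 2 + z ^ 2)) {P Q : ℝ} (hP : 0 ≤ P)
    (hPQ : P ≤ Q) : gnomonic G Q ≤ gnomonic G P + 2 * ε := by
  rcases hP.eq_or_lt with rfl | hP
  · have hε : 0 ≤ ε := by
      have := hub 0 0 1
      rw [hM] at this
      linarith
    have h := hub Q 0 1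
    have h0 : gnomonic G (0 : ℝ) = M := by simp [gnomonic, hM]
    rw [h0, gnomonic, div_le_iff₀ (by linarith [Complex.normSq_nonneg (Q : ℂ)])]
    simp only [Complex.ofReal_re, Complex.ofReal_im, Complex.normSq_ofReal]
    nlinarith [sq_nonneg Q]
  · have h := hG.gnomonic_mul_real_le hM hc hub P (k := Q / P) ((one_le_div hP).2 hPQ)
    rwa [← Complex.ofReal_mul, mul_div_cancel₀ _ hP.ne'] at h

/-- If the pole is a maximum and `G` is constant on the equator, then `G` decreases along every
multiplier of modulus larger than one in the gnomonic chart. -/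
theorem gnomonic_mul_le (hG : CoordPlaneAdditive G) (hM : G 0 0 1 = M)
    (hc : ∀ x y, G x y 0 = c * (x ^ 2 + y ^ 2))
    (hub : ∀ x y z, G x y z ≤ M * (x ^ 2 + y ^ 2 + z ^ 2)) (P : ℂ) {w : ℂ} (hw : 1 < ‖w‖) :
    gnomonic G (P * w) ≤ gnomonic G P := by
  have hub' : ∀ x y z, G x y z ≤ (M + 0) * (x ^ 2 + y ^ 2 + z ^ 2) := by simpa using hub
  have tilt (P : ℂ) (τ : ℝ) : gnomonic G (P * (1 + τ * Complex.I)) ≤ gnomonic G P := by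
    simpa using hG.gnomonic_mul_tilt_le hM hc hub' P τ
  have real (P : ℂ) {k : ℝ} (hk : 1 ≤ k) : gnomonic G (P * k) ≤ gnomonic G P := by
    simpa using hG.gnomonic_mul_real_le hM hc hub' P hk
  have pow (P : ℂ) (τ : ℝ) (n : ℕ) :
      gnomonic G (P * (1 + τ * Complex.I) ^ n) ≤ gnomonic G P := by
    induction n with
    | zero => simp
    | succ n ih =>
      rw [pow_succ, ← mul_assoc]
      exact (tilt _ _).trans ih
  have half (P : ℂ) {z : ℂ} (hz : 1 ≤ z.re) : gnomonic G (P * z) ≤ gnomonic G P := by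
    have hz0 : (z.re : ℂ) ≠ 0 := by exact_mod_cast (by linarith : z.re ≠ 0)
    have e : P * z = P * z.re * (1 + (z.im / z.re : ℝ) * Complex.I) := by
      push_cast
      conv_lhs => rw [← Complex.re_add_im z]
      field_simp
    rw [e]
    exact (tilt _ _).trans (real _ hz)
  have hw0 : w ≠ 0 := by rintro rfl; norm_num at hw
  have lim : Filter.Tendsto
      (fun n : ℕ => (w / (1 + (w.arg * Complex.I) / n) ^ n).re) Filter.atTop (nhds ‖w‖) := by
    have h1 := Complex.tendsto_one_add_div_pow_exp (w.arg * Complex.I)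
    have h2 := (tendsto_const_nhds (x := w)).div h1 (Complex.exp_ne_zero _)
    have h3 : w / Complex.exp (w.arg * Complex.I) = ‖w‖ := by
      rw [div_eq_iff (Complex.exp_ne_zero _), Complex.norm_mul_exp_arg_mul_I]
    rw [h3] at h2
    have h4 := (Complex.continuous_re.tendsto _).comp h2
    rwa [Complex.ofReal_re] at h4
  obtain ⟨n, hn⟩ := (lim.eventually (lt_mem_nhds hw)).exists
  have hne : (1 + (w.arg * Complex.I) / n) ^ n ≠ 0 := by
    intro h0
    rw [h0] at hn
    norm_num at hn
  have e : P * w = P * (1 + (w.arg / n : ℝ) * Complex.I) ^ n *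
      (w / (1 + (w.arg * Complex.I) / n) ^ n) := by
    have : (1 + ((w.arg / n : ℝ) : ℂ) * Complex.I) = 1 + (w.arg * Complex.I) / n := by
      push_cast; ring
    rw [this]
    field_simp
  rw [e]
  exact (half _ hn.le).trans (pow _ _ _)

/-- On unit vectors, `G` increases with the latitude. -/
theorem le_of_latitude_lt (hG : CoordPlaneAdditive G) (hM : G 0 0 1 = M)
    (hc : ∀ x y, G x y 0 = c * (x ^ 2 + y ^ 2))
    (hub : ∀ x y z, G x y z ≤ M * (x ^ 2 + y ^ 2 + z ^ 2)) {x y z x' y' z' : ℝ}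
    (h : x ^ 2 + y ^ 2 + z ^ 2 = 1) (h' : x' ^ 2 + y' ^ 2 + z' ^ 2 = 1) (hz : z ^ 2 < z' ^ 2) :
    G x y z ≤ G x' y' z' := by
  have hub' : ∀ x y z, G x y z ≤ (M + 0) * (x ^ 2 + y ^ 2 + z ^ 2) := by simpa using hub
  by_cases hz0 : z = 0
  · subst hz0
    have := hG.lower_bound hM hc hub' x' y' z'
    rw [h'] at this
    rw [hc, show x ^ 2 + y ^ 2 = 1 by linarith]
    linarith
  have key {x y z : ℝ} (h : x ^ 2 + y ^ 2 + z ^ 2 = 1) (hz : z ≠ 0) :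
      G x y z = gnomonic G ⟨x / z, y / z⟩ := by
    have h1 := hG.homog z (x / z) (y / z) 1
    have e1 : z * (x / z) = x := by field_simp
    have e2 : z * (y / z) = y := by field_simp
    rw [e1, e2, mul_one] at h1
    simp only [gnomonic, Complex.normSq_mk]
    have e3 : 1 + (x / z * (x / z) + y / z * (y / z)) = 1 / z ^ 2 := by
      field_simp; linarith
    rw [e3, h1]; field_simp
  have hz0' : z' ≠ 0 := by
    rintro rfl
    nlinarith [sq_nonneg z]
  rw [key h hz0, key h' hz0']
  have nsq {x y z : ℝ} (h : x ^ 2 + y ^ 2 + z ^ 2 = 1) (hz : z ≠ 0) :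
      Complex.normSq ⟨x / z, y / z⟩ = 1 / z ^ 2 - 1 := by
    rw [Complex.normSq_mk]; field_simp; linarith
  set P : ℂ := ⟨x / z, y / z⟩
  set P' : ℂ := ⟨x' / z', y' / z'⟩
  have hlt : Complex.normSq P' < Complex.normSq P := by
    rw [nsq h hz0, nsq h' hz0']
    have : 1 / z' ^ 2 < 1 / z ^ 2 := one_div_lt_one_div_of_lt (by positivity) hz
    linarith
  by_cases hP' : P' = 0
  · have hp : gnomonic G P' = M := by rw [hP']; simp [gnomonic, hM]
    rw [hp, ← key h hz0]
    simpa [h] using hub x y z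
  have hw : 1 < ‖P / P'‖ := by
    rw [norm_div, one_lt_div (norm_pos_iff.2 hP')]
    rw [Complex.normSq_eq_norm_sq, Complex.normSq_eq_norm_sq] at hlt
    exact lt_of_pow_lt_pow_left₀ 2 (norm_nonneg _) hlt
  simpa [mul_div_cancel₀ _ hP'] using hG.gnomonic_mul_le hM hc hub P' hw

/-- Splitting of a unit vector into two orthogonal vectors of prescribed latitudes. -/
theorem exists_split (hG : CoordPlaneAdditive G) (hc : ∀ x y, G x y 0 = 0) {x y z a b : ℝ}
    (h : x ^ 2 + y ^ 2 + z ^ 2 = 1) (hab : a ^ 2 + b ^ 2 = 1) :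
    ∃ x₁ y₁ x₂ y₂, x₁ ^ 2 + y₁ ^ 2 + (a * z) ^ 2 = 1 ∧ x₂ ^ 2 + y₂ ^ 2 + (b * z) ^ 2 = 1 ∧
      G x₁ y₁ (a * z) + G x₂ y₂ (b * z) = G x y z := by
  obtain ⟨u, v, huv, hperp⟩ : ∃ u v : ℝ, u ^ 2 + v ^ 2 = 1 ∧ x * u + y * v = 0 := by
    by_cases h0 : x ^ 2 + y ^ 2 = 0
    · have hx : x = 0 := by nlinarith [sq_nonneg x, sq_nonneg y]
      have hy : y = 0 := by nlinarith [sq_nonneg x, sq_nonneg y]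
      exact ⟨1, 0, by norm_num, by simp [hx, hy]⟩
    · have hr2 := Real.sq_sqrt (show 0 ≤ x ^ 2 + y ^ 2 by positivity)
      have hr : √(x ^ 2 + y ^ 2) ≠ 0 := by intro h1; rw [h1] at hr2; simp at hr2; exact h0 hr2.symm
      refine ⟨-y / √(x ^ 2 + y ^ 2), x / √(x ^ 2 + y ^ 2), ?_, by ring⟩
      rw [div_pow, div_pow, hr2]; field_simp; ring
  refine ⟨a * x + b * u, a * y + b * v, -(a * u - b * x), -(a * v - b * y), ?_, ?_, ?_⟩
  · linear_combination a ^ 2 * h + b ^ 2 * huv + 2 * a * b * hperp + hab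
  · linear_combination b ^ 2 * h + a ^ 2 * huv - 2 * a * b * hperp + hab
  · have := hG.planar x y z u v 0 (by linarith) (by linarith) a b
    rw [hab, hc, ← hG.map_neg (a * u - b * x)] at this
    convert this using 2 <;> ring_nf

theorem latitude_mul_le (hG : CoordPlaneAdditive G) (hM : G 0 0 1 = M)
    (hc : ∀ x y, G x y 0 = 0) (hub : ∀ x y z, G x y z ≤ M * (x ^ 2 + y ^ 2 + z ^ 2)) {x y z : ℝ}
    (h : x ^ 2 + y ^ 2 + z ^ 2 = 1) : M * z ^ 2 ≤ G x y z := by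
  have hc' : ∀ x y, G x y 0 = 0 * (x ^ 2 + y ^ 2) := by simpa using hc
  have mono {x y z x' y' z' : ℝ} := hG.le_of_latitude_lt hM hc' hub (x := x) (y := y) (z := z)
    (x' := x') (y' := y') (z' := z')
  have hM0 : 0 ≤ M := by simpa [hc] using hub 1 0 0
  have lower {x y z : ℝ} : 0 ≤ G x y z := by
    simpa using hG.lower_bound hM hc' (ε := 0) (by simpa using hub) x y z
  have dyadic (n : ℕ) : ∃ x y z : ℝ, x ^ 2 + y ^ 2 + z ^ 2 = 1 ∧ z ^ 2 = (1 / 2) ^ n ∧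
      M * (1 / 2) ^ n ≤ G x y z := by
    induction n with
    | zero => exact ⟨0, 0, 1, by norm_num, by norm_num, by simp [hM]⟩
    | succ n ih =>
      obtain ⟨x, y, z, h, hz, hle⟩ := ih
      have hs : √(1 / 2 : ℝ) ^ 2 = 1 / 2 := Real.sq_sqrt (by norm_num)
      obtain ⟨x₁, y₁, x₂, y₂, h₁, h₂, hsum⟩ :=
        hG.exists_split hc h (a := √(1 / 2)) (b := √(1 / 2)) (by rw [hs]; norm_num)
      have hz' : (√(1 / 2) * z) ^ 2 = (1 / 2) ^ (n + 1) := by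
        rw [mul_pow, hs, hz, pow_succ]; ring
      rw [pow_succ]
      rcases le_total (G x₁ y₁ (√(1 / 2) * z)) (G x₂ y₂ (√(1 / 2) * z)) with hle' | hle'
      · exact ⟨x₂, y₂, _, h₂, by rw [hz', pow_succ], by linarith⟩
      · exact ⟨x₁, y₁, _, h₁, by rw [hz', pow_succ], by linarith⟩
  have multiples (n k : ℕ) {x y z : ℝ} (h : x ^ 2 + y ^ 2 + z ^ 2 = 1)
      (hz : k * (1 / 2) ^ n < z ^ 2) : M * (k * (1 / 2) ^ n) ≤ G x y z := by
    induction k generalizing x y z with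
    | zero => simpa using lower
    | succ k ih =>
      push_cast at hz ⊢
      have hq : (0 : ℝ) < (1 / 2) ^ n := by positivity
      set q : ℝ := (1 / 2) ^ n with hqdef
      have hz2 : 0 < z ^ 2 := lt_of_le_of_lt (by positivity) hz
      have hsub : 0 < z ^ 2 - (k + 1) * q := by linarith
      set d := (z ^ 2 - (k + 1) * q) / 2
      have hd : 0 < d := by positivity
      have ha : √((k * q + d) / z ^ 2) ^ 2 = (k * q + d) / z ^ 2 := Real.sq_sqrt (by positivity)
      have hb : √((q + d) / z ^ 2) ^ 2 = (q + d) / z ^ 2 := Real.sq_sqrt (by positivity)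
      obtain ⟨x₁, y₁, x₂, y₂, h₁, h₂, hsum⟩ := hG.exists_split hc h
        (a := √((k * q + d) / z ^ 2)) (b := √((q + d) / z ^ 2)) (by
          rw [ha, hb, ← add_div, div_eq_one_iff_eq hz2.ne']
          simp only [d]; ring)
      have i₁ := ih h₁ (by rw [mul_pow, ha, div_mul_cancel₀ _ hz2.ne']; linarith)
      obtain ⟨x₃, y₃, z₃, h₃, hz₃, hle⟩ := dyadic n
      have i₂ := mono h₃ h₂ (by rw [mul_pow, hb, div_mul_cancel₀ _ hz2.ne', hz₃]; linarith)
      linarith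
  have approx (n : ℕ) : M * (z ^ 2 - 2 * (1 / 2) ^ n) ≤ G x y z := by
    have hq : (0 : ℝ) < (1 / 2) ^ n := by positivity
    by_cases hz : z ^ 2 ≤ (1 / 2) ^ n
    · exact le_trans (mul_nonpos_of_nonneg_of_nonpos hM0 (by linarith)) lower
    · push Not at hz
      have hfl := Nat.floor_le (show 0 ≤ z ^ 2 / (1 / 2) ^ n - 1 by
        rw [sub_nonneg, one_le_div hq]; exact hz.le)
      have hfl' := Nat.lt_floor_add_one (z ^ 2 / (1 / 2) ^ n - 1)
      set k := ⌊z ^ 2 / (1 / 2) ^ n - 1⌋₊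
      have e : z ^ 2 / (1 / 2) ^ n * (1 / 2) ^ n = z ^ 2 := div_mul_cancel₀ _ hq.ne'
      refine le_trans ?_ (multiples n k h ?_)
      · exact mul_le_mul_of_nonneg_left (by nlinarith) hM0
      · nlinarith
  have lim : Filter.Tendsto (fun n : ℕ => M * (z ^ 2 - 2 * (1 / 2 : ℝ) ^ n)) Filter.atTop
      (nhds (M * (z ^ 2 - 2 * 0))) :=
    ((tendsto_pow_atTop_nhds_zero_of_lt_one (by norm_num) (by norm_num)).const_mul 2
      |>.const_sub _).const_mul _
  simpa using le_of_tendsto' lim approx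

/-- If the pole is a maximum and `G` is constant on the equator, then `G` is the quadratic form with
these values. -/
theorem eq_of_pole_of_equator (hG : CoordPlaneAdditive G) (hM : G 0 0 1 = M)
    (hc : ∀ x y, G x y 0 = c * (x ^ 2 + y ^ 2))
    (hub : ∀ x y z, G x y z ≤ M * (x ^ 2 + y ^ 2 + z ^ 2)) (x y z : ℝ) :
    G x y z = c * (x ^ 2 + y ^ 2) + M * z ^ 2 := by
  have hG' := hG.sub_diagonal c c c
  have hM' : G 0 0 1 - (c * 0 ^ 2 + c * 0 ^ 2 + c * 1 ^ 2) = M - c := by rw [hM]; ring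
  have lowerUnit {x y z : ℝ} (h : x ^ 2 + y ^ 2 + z ^ 2 = 1) :
      c * (x ^ 2 + y ^ 2) + M * z ^ 2 ≤ G x y z := by
    have := hG'.latitude_mul_le hM' (fun x y => by rw [hc]; ring)
      (fun x y z => by linarith [hub x y z]) h
    linarith
  have lower (x y z : ℝ) : c * (x ^ 2 + y ^ 2) + M * z ^ 2 ≤ G x y z := by
    by_cases h0 : x ^ 2 + y ^ 2 + z ^ 2 = 0
    · have hx : x = 0 := by nlinarith [sq_nonneg x, sq_nonneg y, sq_nonneg z]
      have hy : y = 0 := by nlinarith [sq_nonneg x, sq_nonneg y, sq_nonneg z]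
      have hz : z = 0 := by nlinarith [sq_nonneg x, sq_nonneg y, sq_nonneg z]
      subst hx hy hz
      rw [hc]; simp
    · have hr2 := Real.sq_sqrt (show 0 ≤ x ^ 2 + y ^ 2 + z ^ 2 by positivity)
      have hr : √(x ^ 2 + y ^ 2 + z ^ 2) ≠ 0 := by
        intro h1; rw [h1] at hr2; simp at hr2; exact h0 hr2.symm
      set r := √(x ^ 2 + y ^ 2 + z ^ 2)
      have h := lowerUnit (x := x / r) (y := y / r) (z := z / r) (by
        rw [div_pow, div_pow, div_pow, ← add_div, ← add_div, ← hr2, div_self (pow_ne_zero 2 hr)])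
      have e := hG.homog r (x / r) (y / r) (z / r)
      rw [mul_div_cancel₀ _ hr, mul_div_cancel₀ _ hr, mul_div_cancel₀ _ hr] at e
      rw [e]
      have := mul_le_mul_of_nonneg_left h (sq_nonneg r)
      have e' : c * (x ^ 2 + y ^ 2) + M * z ^ 2 =
          r ^ 2 * (c * ((x / r) ^ 2 + (y / r) ^ 2) + M * (z / r) ^ 2) := by
        clear_value r
        field_simp
      rwa [e']
  refine le_antisymm ?_ (lower x y z)
  rcases eq_or_lt_of_le (by positivity : 0 ≤ x ^ 2 + y ^ 2) with h0 | hpos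
  · have hx : x = 0 := by nlinarith [sq_nonneg x, sq_nonneg y]
    have hy : y = 0 := by nlinarith [sq_nonneg x, sq_nonneg y]
    subst hx hy
    rw [hG.map_pole hM]
    linarith
  · have hr := Real.sqrt_pos.2 hpos
    have hr2 := Real.sq_sqrt hpos.le
    have h := hG.meridian hM hc z hr hr2
    have h' := lower (z * x / √(x ^ 2 + y ^ 2)) (z * y / √(x ^ 2 + y ^ 2)) (-√(x ^ 2 + y ^ 2))
    have e : (z * x / √(x ^ 2 + y ^ 2)) ^ 2 + (z * y / √(x ^ 2 + y ^ 2)) ^ 2 = z ^ 2 := by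
      rw [div_pow, div_pow, hr2]
      field_simp
    rw [e, neg_sq, hr2] at h'
    linarith

end CoordPlaneAdditive

/-- `F` is quadratically homogeneous and the sum of its values on two orthogonal vectors of equal
length depends only on their length and on the real plane they span. -/
structure PlaneAdditive {V : Type*} [NormedAddCommGroup V] [InnerProductSpace ℝ V]
    (F : V → ℝ) : Prop where
  homog : ∀ (c : ℝ) x, F (c • x) = c ^ 2 * F x
  planar : ∀ x y, ‖x‖ = ‖y‖ → ⟪x, y⟫_ℝ = 0 → ∀ a b : ℝ,
    F (a • x + b • y) + F (a • y - b • x) = (a ^ 2 + b ^ 2) * (F x + F y)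

section

variable {V : Type*} [NormedAddCommGroup V] [InnerProductSpace ℝ V] {F : V → ℝ}

theorem Orthonormal.inner_coord {e : Fin 3 → V} (he : Orthonormal ℝ e) (x y z x' y' z' : ℝ) :
    ⟪x • e 0 + y • e 1 + z • e 2, x' • e 0 + y' • e 1 + z' • e 2⟫_ℝ =
      x * x' + y * y' + z * z' := by
  have h := orthonormal_iff_ite.1 he
  simp [inner_add_left, inner_add_right, inner_smul_left, inner_smul_right, h,
    -inner_self_eq_norm_sq_to_K]
  ring

theorem Orthonormal.norm_sq_coord {e : Fin 3 → V} (he : Orthonormal ℝ e) (x y z : ℝ) :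
    ‖x • e 0 + y • e 1 + z • e 2‖ ^ 2 = x ^ 2 + y ^ 2 + z ^ 2 := by
  rw [← real_inner_self_eq_norm_sq, he.inner_coord]
  ring

theorem PlaneAdditive.coord (hF : PlaneAdditive F) {e : Fin 3 → V} (he : Orthonormal ℝ e) :
    CoordPlaneAdditive fun x y z => F (x • e 0 + y • e 1 + z • e 2) where
  homog c x y z := by
    rw [← hF.homog]
    simp only [smul_add, smul_smul]
  planar x y z x' y' z' h h' a b := by
    rw [← hF.planar _ _ _ (by rw [he.inner_coord, h']) a b]
    · congr 2
      · module
      · module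
    · rw [← sq_eq_sq₀ (norm_nonneg _) (norm_nonneg _), he.norm_sq_coord, he.norm_sq_coord, h]

theorem CoordPlaneAdditive.planeAdditive {G : ℝ → ℝ → ℝ → ℝ} (hG : CoordPlaneAdditive G) :
    PlaneAdditive fun v : EuclideanSpace ℝ (Fin 3) => G (v 0) (v 1) (v 2) where
  homog c x := hG.homog c _ _ _
  planar x y hn ho a b := by
    refine hG.planar (x 0) (x 1) (x 2) (y 0) (y 1) (y 2) ?_ ?_ a b
    · have : ‖x‖ ^ 2 = ‖y‖ ^ 2 := by rw [hn]
      simpa [EuclideanSpace.norm_sq_eq, Fin.sum_univ_three] using this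
    · simp only [PiLp.inner_apply, Fin.sum_univ_three, RCLike.inner_apply, conj_trivial] at ho
      linarith

theorem exists_frame (hV : Module.finrank ℝ V = 3) {p q : V} (hp : ‖p‖ = 1) :
    ∃ b : OrthonormalBasis (Fin 3) ℝ V, b 2 = p ∧
      ∃ x z : ℝ, 0 ≤ x ∧ q = x • b 0 + z • b 2 := by
  have : FiniteDimensional ℝ V := Module.finite_of_finrank_pos (by omega)
  have extend {e : V} (he : ‖e‖ = 1) (hpe : ⟪p, e⟫_ℝ = 0) :
      ∃ b : OrthonormalBasis (Fin 3) ℝ V, b 2 = p ∧ b 0 = e := by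
    obtain ⟨b, hb⟩ := Orthonormal.exists_orthonormalBasis_extension_of_card_eq
      (𝕜 := ℝ) (E := V) (ι := Fin 3) (by simpa using hV) (v := ![e, 0, p]) (s := {0, 2}) (by
        rw [orthonormal_iff_ite]
        rintro ⟨i, rfl | rfl⟩ ⟨j, rfl | rfl⟩ <;>
          simp [he, hp, hpe, real_inner_comm, Subtype.ext_iff])
    exact ⟨b, by simpa using hb 2 (by simp), by simpa using hb 0 (by simp)⟩
  have hort : ⟪p, q - ⟪p, q⟫_ℝ • p⟫_ℝ = 0 := by
    simp [inner_sub_right, inner_smul_right, hp]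
  by_cases h0 : q - ⟪p, q⟫_ℝ • p = 0
  · obtain ⟨b', hb'⟩ := Orthonormal.exists_orthonormalBasis_extension_of_card_eq
      (𝕜 := ℝ) (E := V) (ι := Fin 3) (by simpa using hV) (v := fun _ => p) (s := {2}) (by
        rw [orthonormal_iff_ite]
        rintro ⟨i, rfl⟩ ⟨j, rfl⟩
        simp [hp])
    refine ⟨b', by simpa using hb' 2 (by simp), 0, ⟪p, q⟫_ℝ, le_rfl, ?_⟩
    rw [hb' 2 (by simp), zero_smul, zero_add]
    exact sub_eq_zero.1 h0
  · have hn := norm_pos_iff.2 h0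
    obtain ⟨b, hb2, hb0⟩ := extend (e := ‖q - ⟪p, q⟫_ℝ • p‖⁻¹ • (q - ⟪p, q⟫_ℝ • p))
      (norm_smul_inv_norm h0) (by rw [inner_smul_right, hort, mul_zero])
    refine ⟨b, hb2, ‖q - ⟪p, q⟫_ℝ • p‖, ⟪p, q⟫_ℝ, hn.le, ?_⟩
    rw [hb0, hb2, smul_inv_smul₀ hn.ne']
    simp

/-- A bounded plane additive function attains its maximum on the unit sphere. -/
theorem PlaneAdditive.exists_isMax (hV : Module.finrank ℝ V = 3) (hF : PlaneAdditive F) {C : ℝ}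
    (hC : ∀ x, |F x| ≤ C * ‖x‖ ^ 2) :
    ∃ p, ‖p‖ = 1 ∧ ∀ x, F x ≤ F p * ‖x‖ ^ 2 := by
  have : FiniteDimensional ℝ V := Module.finite_of_finrank_pos (by omega)
  have : Nontrivial V := Module.nontrivial_of_finrank_pos (R := ℝ) (by omega)
  set S := F '' Metric.sphere 0 1
  have hSne : S.Nonempty := ((NormedSpace.sphere_nonempty (E := V)).2 zero_le_one).image _
  have hSb : BddAbove S := by
    refine ⟨C, ?_⟩
    rintro _ ⟨x, hx, rfl⟩
    have := (abs_le.1 (hC x)).2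
    rwa [mem_sphere_zero_iff_norm.1 hx, one_pow, mul_one] at this
  set M := sSup S
  have hM (x : V) : F x ≤ M * ‖x‖ ^ 2 := by
    by_cases hx : x = 0
    · subst hx
      have := hF.homog 0 (0 : V)
      simp at this
      simp [this]
    · have h1 : F (‖x‖⁻¹ • x) ≤ M :=
        le_csSup hSb ⟨_, mem_sphere_zero_iff_norm.2 (norm_smul_inv_norm hx), rfl⟩
      have hn := norm_pos_iff.2 hx
      rw [hF.homog] at h1
      calc F x = (‖x‖⁻¹ ^ 2 * F x) * ‖x‖ ^ 2 := by field_simp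
        _ ≤ M * ‖x‖ ^ 2 := by gcongr
  obtain ⟨u, -, hu, huS⟩ := exists_seq_tendsto_sSup hSne hSb
  choose q hq hqu using huS
  have hqn (n : ℕ) : ‖q n‖ = 1 := mem_sphere_zero_iff_norm.1 (hq n)
  let 𝓤 : Ultrafilter ℕ := Filter.hyperfilter ℕ
  have hat : (𝓤 : Filter ℕ) ≤ Filter.atTop := Nat.hyperfilter_le_atTop
  have hFq : Filter.Tendsto (fun n => F (q n)) 𝓤 (nhds M) := by
    simp only [hqu]; exact hu.mono_left hat
  obtain ⟨p, hp, hqp⟩ : ∃ p ∈ Metric.sphere (0 : V) 1, Filter.Tendsto q 𝓤 (nhds p) :=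
    (isCompact_sphere (0 : V) 1).ultrafilter_le_nhds (𝓤.map q)
      (Filter.le_principal_iff.2 (Filter.mem_map.2 (Filter.Eventually.of_forall hq)))
  have hpn : ‖p‖ = 1 := mem_sphere_zero_iff_norm.1 hp
  refine ⟨p, hpn, fun x => (hM x).trans ?_⟩
  gcongr
  choose b hb2 xc zc hxc hpc using fun n => exists_frame hV (q := p) (hqn n)
  let G (n : ℕ) (x y z : ℝ) : ℝ :=
    F (x • b n 0 + y • b n 1 + z • b n 2) + F ((-y) • b n 0 + x • b n 1 + z • b n 2)
  have hG (n : ℕ) : CoordPlaneAdditive (G n) :=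
    (hF.coord (b n).orthonormal).add (hF.coord (b n).orthonormal).quarterTurn
  have hpole (n : ℕ) : G n 0 0 1 = 2 * F (q n) := by
    simp only [G, neg_zero, zero_smul, zero_add, one_smul, hb2]; ring
  have hequ (n : ℕ) (x y : ℝ) : G n x y 0 = (F (b n 0) + F (b n 1)) * (x ^ 2 + y ^ 2) := by
    have := hF.planar (b n 0) (b n 1) (by simp) (by simp) x y
    simp only [G, zero_smul, add_zero]
    rw [mul_comm, ← this]
    congr 2
    module
  have hubG (n : ℕ) (x y z : ℝ) :
      G n x y z ≤ (2 * F (q n) + (2 * M - 2 * F (q n))) * (x ^ 2 + y ^ 2 + z ^ 2) := by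
    have h1 := hM (x • b n 0 + y • b n 1 + z • b n 2)
    have h2 := hM ((-y) • b n 0 + x • b n 1 + z • b n 2)
    rw [(b n).orthonormal.norm_sq_coord] at h1 h2
    simp only [G]
    linarith
  have hlim (x y z : ℝ) : ∃ L, Filter.Tendsto (fun n => G n x y z) 𝓤 (nhds L) := by
    obtain ⟨L, -, hL⟩ := (isCompact_Icc (a := -(2 * C * (x ^ 2 + y ^ 2 + z ^ 2)))
      (b := 2 * C * (x ^ 2 + y ^ 2 + z ^ 2))).ultrafilter_le_nhds (𝓤.map fun n => G n x y z) (by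
        refine Filter.le_principal_iff.2 (Filter.mem_map.2 (Filter.Eventually.of_forall fun n => ?_))
        have h1 := abs_le.1 (hC (x • b n 0 + y • b n 1 + z • b n 2))
        have h2 := abs_le.1 (hC ((-y) • b n 0 + x • b n 1 + z • b n 2))
        rw [(b n).orthonormal.norm_sq_coord] at h1 h2
        constructor <;> simp only [G] <;> linarith)
    exact ⟨L, hL⟩
  choose L hL using hlim
  have hLadd : CoordPlaneAdditive L := by
    constructor
    · intro c x y z
      refine tendsto_nhds_unique (hL _ _ _) (((hL x y z).const_mul (c ^ 2)).congr fun n => ?_)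
      rw [(hG n).homog]
    · intro x y z x' y' z' h h' a b
      refine tendsto_nhds_unique ((hL _ _ _).add (hL _ _ _))
        ((((hL x y z).add (hL x' y' z')).const_mul (a ^ 2 + b ^ 2)).congr fun n => ?_)
      rw [(hG n).planar x y z x' y' z' h h' a b]
  have hLpole : L 0 0 1 = 2 * M :=
    tendsto_nhds_unique (hL 0 0 1) ((hFq.const_mul 2).congr fun n => (hpole n).symm)
  have hLequ (x y : ℝ) : L x y 0 = L 1 0 0 * (x ^ 2 + y ^ 2) := by
    refine tendsto_nhds_unique (hL x y 0) (((hL 1 0 0).mul_const _).congr fun n => ?_)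
    rw [hequ, hequ]; ring
  have hLub (x y z : ℝ) : L x y z ≤ 2 * M * (x ^ 2 + y ^ 2 + z ^ 2) := by
    refine le_of_tendsto' (hL x y z) fun n => (hubG n x y z).trans_eq (by ring)
  have hLeq := hLadd.eq_of_pole_of_equator hLpole hLequ hLub
  have hunit (n : ℕ) : xc n ^ 2 + zc n ^ 2 = 1 := by
    have h := (b n).orthonormal.norm_sq_coord (xc n) 0 (zc n)
    rw [zero_smul, add_zero, ← hpc, hpn] at h
    linarith
  have hzc : Filter.Tendsto zc 𝓤 (nhds 1) := by
    have h1 : Filter.Tendsto (fun n => ⟪q n, p⟫_ℝ) 𝓤 (nhds ⟪p, p⟫_ℝ) :=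
      hqp.inner tendsto_const_nhds
    rw [real_inner_self_eq_norm_sq, hpn, one_pow] at h1
    refine h1.congr fun n => ?_
    have h := (b n).orthonormal.inner_coord 0 0 1 (xc n) 0 (zc n)
    simp only [zero_smul, one_smul, zero_add, add_zero] at h
    rw [← hpc, hb2] at h
    simpa using h
  have hbound {Q : ℝ} (hQ : 0 < Q) :
      (L 1 0 0 * Q ^ 2 + 2 * M) / (1 + Q ^ 2) ≤ F p + M := by
    have hε : Filter.Tendsto (fun n => F p + M + 2 * (2 * M - 2 * F (q n))) 𝓤
        (nhds (F p + M + 2 * (2 * M - 2 * M))) :=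
      (((hFq.const_mul 2).const_sub _).const_mul 2).const_add _
    have hl : Filter.Tendsto (fun n => G n Q 0 1 / (1 + Q ^ 2)) 𝓤
        (nhds ((L 1 0 0 * Q ^ 2 + 2 * M) / (1 + Q ^ 2))) := by
      have := (hL Q 0 1).div_const (1 + Q ^ 2)
      rwa [hLeq, show L 1 0 0 * (Q ^ 2 + 0 ^ 2) + 2 * M * 1 ^ 2 = L 1 0 0 * Q ^ 2 + 2 * M by
        ring] at this
    rw [show F p + M = F p + M + 2 * (2 * M - 2 * M) by ring]
    refine le_of_tendsto_of_tendsto hl hε ?_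
    have hpos : ∀ᶠ n in 𝓤, 0 < zc n := hzc.eventually (lt_mem_nhds zero_lt_one)
    have hsmall : ∀ᶠ n in 𝓤, 0 < (Q ^ 2 + 1) * zc n ^ 2 - 1 := by
      have : Filter.Tendsto (fun n => (Q ^ 2 + 1) * zc n ^ 2 - 1) 𝓤
        (nhds ((Q ^ 2 + 1) * 1 ^ 2 - 1)) := ((hzc.pow 2).const_mul _).sub_const _
      exact this.eventually (lt_mem_nhds (by ring_nf; positivity))
    filter_upwards [hpos, hsmall] with n hz hs
    have hle : xc n / zc n ≤ Q := by
      rw [div_le_iff₀ hz]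
      refine le_of_sq_le_sq ?_ (by positivity)
      nlinarith [hunit n]
    have h := (hG n).gnomonic_radial_le (hpole n) (hequ n) (hubG n)
      (div_nonneg (hxc n) hz.le) hle
    have e : CoordPlaneAdditive.gnomonic (G n) (xc n / zc n : ℝ) = G n (xc n) 0 (zc n) := by
      have h1 := (hG n).homog (zc n) (xc n / zc n) 0 1
      rw [mul_div_cancel₀ _ hz.ne', mul_zero, mul_one] at h1
      rw [h1, CoordPlaneAdditive.gnomonic]
      simp only [Complex.ofReal_re, Complex.ofReal_im, Complex.normSq_ofReal]
      rw [show 1 + xc n / zc n * (xc n / zc n) = 1 / zc n ^ 2 by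
        field_simp; linarith [hunit n]]
      field_simp
    have e' : G n (xc n) 0 (zc n) ≤ F p + M := by
      have h1 := hM ((-0 : ℝ) • b n 0 + xc n • b n 1 + zc n • b n 2)
      rw [(b n).orthonormal.norm_sq_coord, neg_zero,
        show (0 : ℝ) ^ 2 + xc n ^ 2 + zc n ^ 2 = 1 by linarith [hunit n], mul_one] at h1
      simp only [G, neg_zero]
      rw [zero_smul ℝ (b n 1), add_zero, ← hpc]
      linarith
    rw [e] at h
    have e2 : CoordPlaneAdditive.gnomonic (G n) Q = G n Q 0 1 / (1 + Q ^ 2) := by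
      simp [CoordPlaneAdditive.gnomonic, pow_two, Complex.normSq_ofReal]
    rw [e2] at h
    linarith
  have hcont : Filter.Tendsto (fun Q : ℝ => (L 1 0 0 * Q ^ 2 + 2 * M) / (1 + Q ^ 2))
      (nhdsWithin 0 (Set.Ioi 0)) (nhds ((L 1 0 0 * 0 ^ 2 + 2 * M) / (1 + 0 ^ 2))) := by
    have : Continuous fun Q : ℝ => (L 1 0 0 * Q ^ 2 + 2 * M) / (1 + Q ^ 2) :=
      Continuous.div (by fun_prop) (by fun_prop) fun Q => by positivity
    exact (this.tendsto 0).mono_left nhdsWithin_le_nhds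
  have := le_of_tendsto hcont (Filter.eventually_of_mem self_mem_nhdsWithin fun Q hQ => hbound hQ)
  norm_num at this
  linarith

end

namespace CoordPlaneAdditive

variable {G : ℝ → ℝ → ℝ → ℝ} {C : ℝ}

/-- Near a maximum on the unit sphere a plane additive function stays above a quadratic form. -/
theorem _root_.PlaneAdditive.lower_bound_of_isMax {V : Type*} [NormedAddCommGroup V]
    [InnerProductSpace ℝ V] (hV : Module.finrank ℝ V = 3) {F : V → ℝ} (hF : PlaneAdditive F)
    {p : V} (hp : ‖p‖ = 1) (hmax : ∀ x, F x ≤ F p * ‖x‖ ^ 2)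
    (hmin : ∀ x, -(F p * ‖x‖ ^ 2) ≤ F x) (v : V) :
    F p * (4 * ⟪p, v⟫_ℝ ^ 2 - 3 * ‖v‖ ^ 2) ≤ F v := by
  obtain ⟨b, hb, x, z, -, hv⟩ := exists_frame hV (q := v) hp
  have hG := hF.coord b.orthonormal
  have hG2 := hG.add hG.quarterTurn
  have h := hG2.eq_of_pole_of_equator (M := 2 * F p) (c := F (b 0) + F (b 1))
    (by simp only [neg_zero, zero_smul, zero_add, one_smul, hb]; ring)
    (fun x y => by
      have := hF.planar (b 0) (b 1) (by simp) (by simp) x y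
      simp only [zero_smul, add_zero]
      rw [mul_comm, ← this]
      congr 2
      module)
    (fun x y z => by
      have h1 := hmax (x • b 0 + y • b 1 + z • b 2)
      have h2 := hmax ((-y) • b 0 + x • b 1 + z • b 2)
      rw [b.orthonormal.norm_sq_coord] at h1 h2
      linarith) x 0 z
  have h1 := hmax ((-0 : ℝ) • b 0 + x • b 1 + z • b 2)
  rw [b.orthonormal.norm_sq_coord] at h1
  have e : x • b 0 + (0 : ℝ) • b 1 + z • b 2 = v := by rw [hv]; module
  have hn := b.orthonormal.norm_sq_coord x 0 z
  have hi := b.orthonormal.inner_coord 0 0 1 x 0 z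
  rw [e] at hn hi h
  simp only [zero_smul, zero_add, one_smul, hb] at hi
  have h2 := hmin (b 0)
  have h3 := hmin (b 1)
  simp only [b.norm_eq_one] at h2 h3
  rw [hi, hn]
  nlinarith [sq_nonneg x, sq_nonneg z]

/-- Every unit vector is close to one of the six planes `x = ±y`, `y = ±z`, `x = ±z`. -/
theorem _root_.false_of_far_from_diagonals {a b c : ℝ} (h : a ^ 2 + b ^ 2 + c ^ 2 = 1)
    (h1 : 1 / 2 ≤ (a - b) ^ 2) (h2 : 1 / 2 ≤ (a + b) ^ 2)
    (h3 : 1 / 2 ≤ (b - c) ^ 2) (h4 : 1 / 2 ≤ (b + c) ^ 2)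
    (h5 : 1 / 2 ≤ (a - c) ^ 2) (h6 : 1 / 2 ≤ (a + c) ^ 2) : False := by
  have gap {s t : ℝ} (h1 : 1 / 2 ≤ (s - t) ^ 2) (h2 : 1 / 2 ≤ (s + t) ^ 2) :
      7 / 10 ≤ |(|s| - |t|)| := by
    refine le_of_sq_le_sq ?_ (abs_nonneg _)
    rw [sq_abs]
    rcases abs_cases s with ⟨hs, -⟩ | ⟨hs, -⟩ <;> rcases abs_cases t with ⟨ht, -⟩ | ⟨ht, -⟩ <;>
      rw [hs, ht] <;> nlinarith
  have g1 := gap h1 h2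
  have g2 := gap h3 h4
  have g3 := gap h5 h6
  have bound (s : ℝ) (hs : s ^ 2 ≤ 1) : |s| ≤ 1 := (sq_le_one_iff_abs_le_one s).1 hs
  have b0 := bound a (by nlinarith)
  have b1 := bound b (by nlinarith)
  have b2 := bound c (by nlinarith)
  have a0 := abs_nonneg a
  have a1 := abs_nonneg b
  have a2 := abs_nonneg c
  rcases le_abs.1 g1 with g1 | g1 <;> rcases le_abs.1 g2 with g2 | g2 <;>
    rcases le_abs.1 g3 with g3 | g3 <;> linarith

theorem nonpos_of_antisymm (hG : CoordPlaneAdditive G)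
    (hz : ∀ x y z, G (-y) x z = -G x y z) (hx : ∀ x y z, G x (-z) y = -G x y z) {M a b c : ℝ}
    (hlow : ∀ x y z, M * (4 * (a * x + b * y + c * z) ^ 2 - 3 * (x ^ 2 + y ^ 2 + z ^ 2)) ≤ G x y z)
    (hpn : a ^ 2 + b ^ 2 + c ^ 2 = 1) : M ≤ 0 := by
  by_contra! hM
  have hxx (x y z : ℝ) : G x (-y) (-z) = G x y z := by rw [hx, hx, neg_neg]
  have zero_xy (x z : ℝ) : G x x z = 0 := by
    have h1 := hz x x z
    have h2 := hxx (-x) x z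
    linarith [hG.map_neg x x z]
  have zero_xy' (x z : ℝ) : G x (-x) z = 0 := by
    have h := hz (-x) (-x) z
    rw [neg_neg] at h
    linarith [zero_xy (-x) z]
  have zero_yz (x y : ℝ) : G x y y = 0 := by
    have h1 := hx x y y
    have h2 : G (-x) y y = G x (-y) y := by
      have a := hz y x y
      have b := hz x (-y) y
      rw [neg_neg] at b
      linarith
    have h3 := hG.map_neg x (-y) (-y)
    have h4 := hxx x y y
    rw [neg_neg] at h3
    linarith
  have zero_yz' (x y : ℝ) : G x (-y) y = 0 := by rw [hx, zero_yz, neg_zero]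
  have zero_xz (x y : ℝ) : G x y x = 0 := by
    have h := hz y (-x) x
    rw [neg_neg] at h
    linarith [zero_yz' y x]
  have zero_xz' (x y : ℝ) : G (-x) y x = 0 := by
    rw [hz, zero_yz, neg_zero]
  have far {x y z : ℝ} (h0 : G x y z = 0)
      (hi : a * x + b * y + c * z = x ^ 2 + y ^ 2 + z ^ 2) :
      x ^ 2 + y ^ 2 + z ^ 2 ≤ 3 / 4 := by
    have := hlow x y z
    rw [h0, hi] at this
    by_contra! hlt
    have : 0 < M * (4 * (x ^ 2 + y ^ 2 + z ^ 2) ^ 2 - 3 * (x ^ 2 + y ^ 2 + z ^ 2)) :=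
      mul_pos hM (by nlinarith)
    linarith
  have d1 := far (zero_xy ((a + b) / 2) c) (by ring)
  have d2 := far (zero_xy' ((a - b) / 2) c) (by ring)
  have d3 := far (zero_yz a ((b + c) / 2)) (by ring)
  have d4 := far (zero_yz' a ((c - b) / 2)) (by ring)
  have d5 := far (zero_xz ((a + c) / 2) b) (by ring)
  have d6 := far (zero_xz' ((c - a) / 2) b) (by ring)
  exact false_of_far_from_diagonals hpn (by nlinarith) (by nlinarith) (by nlinarith)
    (by nlinarith) (by nlinarith) (by nlinarith)

theorem eq_zero_of_antisymm (hG : CoordPlaneAdditive G)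
    (hC : ∀ x y z, |G x y z| ≤ C * (x ^ 2 + y ^ 2 + z ^ 2))
    (hz : ∀ x y z, G (-y) x z = -G x y z) (hx : ∀ x y z, G x (-z) y = -G x y z) (x y z : ℝ) :
    G x y z = 0 := by
  have hF := hG.planeAdditive
  have hV : Module.finrank ℝ (EuclideanSpace ℝ (Fin 3)) = 3 := by simp
  obtain ⟨p, hp, hmax⟩ := hF.exists_isMax hV (C := C) (fun v => by
    simpa [EuclideanSpace.norm_sq_eq, Fin.sum_univ_three] using hC (v 0) (v 1) (v 2))
  have hn (x y z : ℝ) : ‖(!₂[x, y, z] : EuclideanSpace ℝ (Fin 3))‖ ^ 2 = x ^ 2 + y ^ 2 + z ^ 2 := by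
    simp [EuclideanSpace.norm_sq_eq, Fin.sum_univ_three]
  have hub (x y z : ℝ) : G x y z ≤ G (p 0) (p 1) (p 2) * (x ^ 2 + y ^ 2 + z ^ 2) := by
    have := hmax !₂[x, y, z]
    rw [hn] at this
    simpa using this
  have hlb (x y z : ℝ) : -(G (p 0) (p 1) (p 2) * (x ^ 2 + y ^ 2 + z ^ 2)) ≤ G x y z := by
    have := hub (-y) x z
    rw [hz] at this
    linarith
  have hM : G (p 0) (p 1) (p 2) ≤ 0 := by
    refine hG.nonpos_of_antisymm hz hx (a := p 0) (b := p 1) (c := p 2) (fun x y z => ?_) ?_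
    · have := hF.lower_bound_of_isMax hV hp hmax (fun v => by
        simpa [EuclideanSpace.norm_sq_eq, Fin.sum_univ_three] using hlb (v 0) (v 1) (v 2))
        !₂[x, y, z]
      have hi : ⟪p, (!₂[x, y, z] : EuclideanSpace ℝ (Fin 3))⟫_ℝ = p 0 * x + p 1 * y + p 2 * z := by
        simp [PiLp.inner_apply, Fin.sum_univ_three, mul_comm]
      rw [hn, hi] at this
      simpa using this
    · have : ‖p‖ ^ 2 = 1 := by rw [hp, one_pow]
      simpa [EuclideanSpace.norm_sq_eq, Fin.sum_univ_three] using this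
  have hq : 0 ≤ x ^ 2 + y ^ 2 + z ^ 2 := by positivity
  exact le_antisymm ((hub x y z).trans (mul_nonpos_of_nonpos_of_nonneg hM hq))
    (le_trans (by nlinarith) (hlb x y z))

/-- A bounded plane additive function is diagonal in the coordinates of a frame which starts at a
minimum and ends at a maximum. -/
theorem eq_diagonal (hG : CoordPlaneAdditive G)
    (hC : ∀ x y z, |G x y z| ≤ C * (x ^ 2 + y ^ 2 + z ^ 2))
    (hmax : ∀ x y z, G x y z ≤ G 0 0 1 * (x ^ 2 + y ^ 2 + z ^ 2))
    (hmin : ∀ x y z, G 1 0 0 * (x ^ 2 + y ^ 2 + z ^ 2) ≤ G x y z) (x y z : ℝ) :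
    G x y z = G 1 0 0 * x ^ 2 + G 0 1 0 * y ^ 2 + G 0 0 1 * z ^ 2 := by
  have hZ := (hG.add hG.quarterTurn).eq_of_pole_of_equator (M := 2 * G 0 0 1)
    (c := G 1 0 0 + G 0 1 0) (by simp only [neg_zero]; ring)
    (fun x y => by
      have := hG.planar 1 0 0 0 1 0 (by norm_num) (by norm_num) x y
      simp only [mul_one, mul_zero, add_zero, zero_add, zero_sub, sub_zero] at this
      rw [this]; ring)
    (fun x y z => by linarith [hmax x y z, hmax (-y) x z])
  have hX := (hG.cyclic.add hG.cyclic.quarterTurn).neg.eq_of_pole_of_equator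
    (M := -(2 * G 1 0 0)) (c := -(G 0 1 0 + G 0 0 1)) (by simp only [neg_zero]; ring)
    (fun y z => by
      have := hG.planar 0 1 0 0 0 1 (by norm_num) (by norm_num) y z
      simp only [mul_one, mul_zero, add_zero, zero_add, zero_sub, sub_zero] at this
      rw [this]; ring)
    (fun x y z => by linarith [hmin z x y, hmin z (-y) x])
  have := (hG.sub_diagonal (G 1 0 0) (G 0 1 0) (G 0 0 1)).eq_zero_of_antisymm
    (C := C + |G 1 0 0| + |G 0 1 0| + |G 0 0 1|)
    (fun x y z => by
      have h := abs_le.1 (hC x y z)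
      have h1 := abs_le.1 (le_refl |G 1 0 0|)
      have h2 := abs_le.1 (le_refl |G 0 1 0|)
      have h3 := abs_le.1 (le_refl |G 0 0 1|)
      have hx := sq_nonneg x
      have hy := sq_nonneg y
      have hz := sq_nonneg z
      have a1 := abs_nonneg (G 1 0 0)
      have a2 := abs_nonneg (G 0 1 0)
      have a3 := abs_nonneg (G 0 0 1)
      rw [abs_le]
      constructor <;> nlinarith)
    (fun x y z => by linarith [hZ x y z])
    (fun x y z => by linarith [hX y z x]) x y z
  linarith

end CoordPlaneAdditive

/-- A bounded plane additive function on a three-dimensional real space is quadratic on planes. -/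
theorem PlaneAdditive.exists_quadratic {V : Type*} [NormedAddCommGroup V] [InnerProductSpace ℝ V]
    (hV : Module.finrank ℝ V = 3) {F : V → ℝ} (hF : PlaneAdditive F) {C : ℝ}
    (hC : ∀ x, |F x| ≤ C * ‖x‖ ^ 2) (u v : V) :
    ∃ B : ℝ, ∀ x y : ℝ, F (x • u + y • v) = x ^ 2 * F u + y ^ 2 * F v + x * y * B := by
  obtain ⟨p, hp, hmax⟩ := hF.exists_isMax hV hC
  have hFneg : PlaneAdditive fun x => -F x :=
    ⟨fun c x => by rw [hF.homog]; ring, fun x y h h' a b => by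
      linear_combination -hF.planar x y h h' a b⟩
  obtain ⟨r, hr, hmin⟩ := hFneg.exists_isMax hV (C := C) (by simpa using hC)
  obtain ⟨b, hb, x, z, -, hrxz⟩ := exists_frame hV (q := r) hp
  have hxz : x ^ 2 + z ^ 2 = 1 := by
    have h := b.orthonormal.norm_sq_coord x 0 z
    rw [zero_smul, add_zero, ← hrxz, hr] at h
    linarith
  have hpl := hF.planar (b 0) (b 2) (by simp) (by simp) x z
  rw [← hrxz, hxz, one_mul, hb] at hpl
  have hmin0 (v : V) : F (b 0) * ‖v‖ ^ 2 ≤ F v := by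
    have h1 := hmax (x • p - z • b 0)
    have hn : ‖x • p - z • b 0‖ ^ 2 = 1 := by
      have h := b.orthonormal.norm_sq_coord (-z) 0 x
      rw [hb, show (-z) • b 0 + (0 : ℝ) • b 1 + x • p = x • p - z • b 0 by module] at h
      rw [h]; linarith
    rw [hn] at h1
    have h2 : F (b 0) ≤ F r := by linarith
    have := hmin v
    nlinarith [sq_nonneg ‖v‖]
  have hd := (hF.coord b.orthonormal).eq_diagonal (C := C)
    (fun x y z => by
      have := hC (x • b 0 + y • b 1 + z • b 2)
      rwa [b.orthonormal.norm_sq_coord] at this)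
    (fun x y z => by
      have := hmax (x • b 0 + y • b 1 + z • b 2)
      rw [b.orthonormal.norm_sq_coord, ← hb] at this
      simpa using this)
    (fun x y z => by
      have := hmin0 (x • b 0 + y • b 1 + z • b 2)
      rw [b.orthonormal.norm_sq_coord] at this
      simpa using this)
  simp only [one_smul, zero_smul, add_zero, zero_add] at hd
  have hdiag (w : V) : F w = F (b 0) * ⟪b 0, w⟫_ℝ ^ 2 + F (b 1) * ⟪b 1, w⟫_ℝ ^ 2 +
      F (b 2) * ⟪b 2, w⟫_ℝ ^ 2 := by
    rw [← hd]
    congr 1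
    conv_lhs => rw [← b.sum_repr' w]
    rw [Fin.sum_univ_three]
  refine ⟨2 * (F (b 0) * (⟪b 0, u⟫_ℝ * ⟪b 0, v⟫_ℝ) + F (b 1) * (⟪b 1, u⟫_ℝ * ⟪b 1, v⟫_ℝ) +
    F (b 2) * (⟪b 2, u⟫_ℝ * ⟪b 2, v⟫_ℝ)), fun x y => ?_⟩
  rw [hdiag (x • u + y • v), hdiag u, hdiag v]
  simp only [inner_add_right, inner_smul_right]
  ring

/-- `F` is bounded on the unit sphere, invariant under phases, quadratically homogeneous, and the
sum of its values on two orthogonal vectors of equal length depends only on their length and on the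
real plane they span. -/
structure ComplexPlaneAdditive {H : Type*} [NormedAddCommGroup H] [InnerProductSpace ℂ H]
    (F : H → ℝ) : Prop where
  homog : ∀ (c : ℂ) x, F (c • x) = ‖c‖ ^ 2 * F x
  planar : ∀ x y, ‖x‖ = ‖y‖ → ⟪x, y⟫_ℂ = 0 → ∀ a b : ℝ,
    F ((a : ℂ) • x + (b : ℂ) • y) + F ((a : ℂ) • y - (b : ℂ) • x) = (a ^ 2 + b ^ 2) * (F x + F y)
  bounded : ∃ C, ∀ x, |F x| ≤ C * ‖x‖ ^ 2

section

variable {H : Type*} [NormedAddCommGroup H] [InnerProductSpace ℂ H]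

theorem exists_orthonormal_triple [FiniteDimensional ℂ H] (hdim : 3 ≤ Module.finrank ℂ H)
    {u v : H} (hu : ‖u‖ = 1) (hv : ‖v‖ = 1) (huv : ⟪u, v⟫_ℂ = 0) :
    ∃ w, Orthonormal ℂ ![u, v, w] := by
  have hlt : Module.finrank ℂ (Submodule.span ℂ {u, v}) < Module.finrank ℂ H := by
    classical
    have := finrank_span_le_card (R := ℂ) ({u, v} : Set H)
    have h2 : ({u, v} : Set H).toFinset.card ≤ 2 := by
      simpa using Finset.card_le_two (a := u) (b := v)
    omega
  have hne : (Submodule.span ℂ {u, v})ᗮ ≠ ⊥ := by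
    intro h
    rw [Submodule.orthogonal_eq_bot_iff] at h
    rw [h, finrank_top] at hlt
    exact lt_irrefl _ hlt
  obtain ⟨w, hw, hw0⟩ := Submodule.exists_mem_ne_zero_of_ne_bot hne
  rw [Submodule.mem_orthogonal] at hw
  have h1 := hw u (Submodule.subset_span (by simp))
  have h2 := hw v (Submodule.subset_span (by simp))
  refine ⟨((‖w‖ : ℂ)⁻¹) • w, ?_⟩
  have hn : ‖(‖w‖ : ℂ)⁻¹ • w‖ = 1 := by
    rw [norm_smul, norm_inv, Complex.norm_real, norm_norm, inv_mul_cancel₀ (by simpa using hw0)]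
  have h3 : ⟪v, u⟫_ℂ = 0 := inner_eq_zero_symm.1 huv
  have h4 : ⟪w, u⟫_ℂ = 0 := inner_eq_zero_symm.1 h1
  have h5 : ⟪w, v⟫_ℂ = 0 := inner_eq_zero_symm.1 h2
  refine ⟨fun i => ?_, fun i j hij => ?_⟩
  · fin_cases i
    exacts [hu, hv, hn]
  · fin_cases i <;> fin_cases j <;>
      simp_all [inner_smul_left, inner_smul_right]

theorem Orthonormal.norm_sq_complex_coord {e : Fin 3 → H} (he : Orthonormal ℂ e) (x y z : ℝ) :
    ‖(x : ℂ) • e 0 + (y : ℂ) • e 1 + (z : ℂ) • e 2‖ ^ 2 = x ^ 2 + y ^ 2 + z ^ 2 := by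
  have h := orthonormal_iff_ite.1 he
  have := inner_self_eq_norm_sq_to_K (𝕜 := ℂ) ((x : ℂ) • e 0 + (y : ℂ) • e 1 + (z : ℂ) • e 2)
  simp only [inner_add_left, inner_add_right, inner_smul_left, inner_smul_right, h] at this
  simp [-Complex.coe_smul] at this
  apply Complex.ofReal_injective
  push_cast
  rw [← this]
  ring

theorem Orthonormal.inner_complex_coord {e : Fin 3 → H} (he : Orthonormal ℂ e)
    (x y z x' y' z' : ℝ) :
    ⟪(x : ℂ) • e 0 + (y : ℂ) • e 1 + (z : ℂ) • e 2,
      (x' : ℂ) • e 0 + (y' : ℂ) • e 1 + (z' : ℂ) • e 2⟫_ℂ = (x * x' + y * y' + z * z' : ℝ) := by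
  have h := orthonormal_iff_ite.1 he
  simp only [inner_add_left, inner_add_right, inner_smul_left, inner_smul_right, h]
  simp
  ring

namespace ComplexPlaneAdditive

variable {F : H → ℝ}

theorem map_zero (hF : ComplexPlaneAdditive F) : F 0 = 0 := by
  simpa using hF.homog 0 0

theorem map_neg (hF : ComplexPlaneAdditive F) (x : H) : F (-x) = F x := by
  simpa using hF.homog (-1) x

theorem real_triple (hF : ComplexPlaneAdditive F) {e : Fin 3 → H} (he : Orthonormal ℂ e) :
    PlaneAdditive fun v : EuclideanSpace ℝ (Fin 3) =>
      F ((v 0 : ℂ) • e 0 + (v 1 : ℂ) • e 1 + (v 2 : ℂ) • e 2) where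
  homog c v := by
    have := hF.homog c ((v 0 : ℂ) • e 0 + (v 1 : ℂ) • e 1 + (v 2 : ℂ) • e 2)
    rw [Complex.norm_real, Real.norm_eq_abs, sq_abs] at this
    rw [← this]
    simp [smul_smul, -Complex.coe_smul]
  planar v w hvw h0 a b := by
    have hi : v 0 * w 0 + v 1 * w 1 + v 2 * w 2 = 0 := by
      simp [PiLp.inner_apply, Fin.sum_univ_three] at h0
      linarith
    have hn : v 0 ^ 2 + v 1 ^ 2 + v 2 ^ 2 = w 0 ^ 2 + w 1 ^ 2 + w 2 ^ 2 := by
      have := congrArg (· ^ 2) hvw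
      simpa [EuclideanSpace.norm_sq_eq, Fin.sum_univ_three] using this
    rw [← hF.planar _ _ _ (by rw [he.inner_complex_coord, hi, Complex.ofReal_zero]) a b]
    · congr 2
      · simp; module
      · simp; module
    · rw [← sq_eq_sq₀ (norm_nonneg _) (norm_nonneg _), he.norm_sq_complex_coord,
        he.norm_sq_complex_coord, hn]

variable [FiniteDimensional ℂ H]

theorem exists_quadratic (hF : ComplexPlaneAdditive F) (hdim : 3 ≤ Module.finrank ℂ H) {u v : H}
    (huv : ⟪u, v⟫_ℂ = 0) :
    ∃ B : ℝ, ∀ r : ℝ, F (u + (r : ℂ) • v) = F u + r ^ 2 * F v + r * B := by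
  by_cases hu : u = 0
  · refine ⟨0, fun r => ?_⟩
    rw [hu, zero_add, hF.map_zero, hF.homog, Complex.norm_real, Real.norm_eq_abs, sq_abs]
    ring
  by_cases hv : v = 0
  · exact ⟨0, fun r => by rw [hv, smul_zero, hF.map_zero, add_zero]; ring⟩
  have hun : ‖u‖ ≠ 0 := by simpa using hu
  have hvn : ‖v‖ ≠ 0 := by simpa using hv
  obtain ⟨w, he⟩ := exists_orthonormal_triple hdim (u := (‖u‖ : ℂ)⁻¹ • u) (v := (‖v‖ : ℂ)⁻¹ • v)
    (by rw [norm_smul, norm_inv, Complex.norm_real, norm_norm, inv_mul_cancel₀ hun])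
    (by rw [norm_smul, norm_inv, Complex.norm_real, norm_norm, inv_mul_cancel₀ hvn])
    (by simp [huv])
  obtain ⟨C, hC⟩ := hF.bounded
  obtain ⟨B, hB⟩ := (hF.real_triple he).exists_quadratic (by simp) (C := C)
    (fun v => by
      refine (hC _).trans_eq ?_
      rw [he.norm_sq_complex_coord, EuclideanSpace.norm_sq_eq, Fin.sum_univ_three]
      simp) !₂[‖u‖, 0, 0] !₂[0, ‖v‖, 0]
  refine ⟨B, fun r => ?_⟩
  have := hB 1 r
  simp [smul_smul, hun, hvn] at this
  rw [Complex.coe_smul]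
  linarith

/-- On the span of two orthogonal vectors, `F` is determined up to a real homogeneous
interference term. -/
theorem exists_interference (hF : ComplexPlaneAdditive F) (hdim : 3 ≤ Module.finrank ℂ H) {u v : H}
    (huv : ⟪u, v⟫_ℂ = 0) :
    ∃ T : ℂ → ℝ, (∀ (r : ℝ) ζ, T (r * ζ) = r * T ζ) ∧
      ∀ a b : ℂ, F (a • u + b • v) = ‖a‖ ^ 2 * F u + ‖b‖ ^ 2 * F v + T (conj a * b) := by
  have hT (r : ℝ) (ζ : ℂ) : F (u + (r * ζ : ℂ) • v) - F u - ‖(r * ζ : ℂ)‖ ^ 2 * F v =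
      r * (F (u + ζ • v) - F u - ‖ζ‖ ^ 2 * F v) := by
    obtain ⟨B, hB⟩ := hF.exists_quadratic hdim (u := u) (v := ζ • v)
      (by rw [inner_smul_right, huv, mul_zero])
    have h1 := hB 1
    rw [Complex.ofReal_one, one_smul] at h1
    rw [mul_smul, hB, h1, hF.homog, norm_mul, mul_pow, Complex.norm_real, Real.norm_eq_abs, sq_abs]
    ring
  refine ⟨fun ζ => F (u + ζ • v) - F u - ‖ζ‖ ^ 2 * F v, hT, fun a b => ?_⟩
  by_cases ha : a = 0
  · simp [ha, hF.homog]
  have h := hT (‖a‖ ^ 2) (b / a)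
  have e : ((‖a‖ ^ 2 : ℝ) : ℂ) * (b / a) = conj a * b := by
    push_cast
    rw [← Complex.conj_mul']
    field_simp
  rw [e] at h
  have h2 := hF.homog a (u + (b / a) • v)
  rw [smul_add, smul_smul, mul_div_cancel₀ _ ha] at h2
  have hn : ‖a‖ ≠ 0 := by simpa using ha
  rw [norm_div] at h
  simp only [h, h2]
  field_simp
  ring

end ComplexPlaneAdditive

/-- Any two vectors arise from two orthogonal ones through coefficients with orthogonal columns. -/
theorem exists_orthogonal_mix (x y : H) :
    ∃ (u v : H) (a b c d : ℂ), ⟪u, v⟫_ℂ = 0 ∧ x = a • u + b • v ∧ y = c • u + d • v ∧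
      conj a * b + conj c * d = 0 := by
  obtain ⟨c, hc, hk⟩ := Complex.exists_norm_eq_mul_self ⟪x, y⟫_ℂ
  set k := ‖⟪x, y⟫_ℂ‖
  obtain ⟨s, hs⟩ : ∃ s : ℝ, s * (‖y‖ ^ 2 - ‖x‖ ^ 2) + (1 - s ^ 2) * k = 0 := by
    by_cases hk0 : k = 0
    · exact ⟨0, by simp [hk0]⟩
    set d := ‖y‖ ^ 2 - ‖x‖ ^ 2
    refine ⟨(d + √(d ^ 2 + 4 * k ^ 2)) / (2 * k), ?_⟩
    have := Real.sq_sqrt (show 0 ≤ d ^ 2 + 4 * k ^ 2 by positivity)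
    field_simp
    linear_combination -this
  have hD : (1 + (s : ℂ) ^ 2) ≠ 0 := by
    have : (1 + s ^ 2 : ℝ) ≠ 0 := by positivity
    exact_mod_cast this
  have hcc : conj c * c = 1 := by rw [Complex.conj_mul', hc]; norm_num
  have hyx : ⟪y, x⟫_ℂ = c * k := by
    have : ⟪x, y⟫_ℂ = conj c * k := by rw [hk, ← mul_assoc, hcc, one_mul]
    rw [← inner_conj_symm, this, map_mul, Complex.conj_conj, Complex.conj_ofReal]
  refine ⟨x + (s * c) • y, c • y - (s : ℂ) • x, (1 + (s : ℂ) ^ 2)⁻¹, -(s * (1 + (s : ℂ) ^ 2)⁻¹),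
    conj c * s * (1 + (s : ℂ) ^ 2)⁻¹, conj c * (1 + (s : ℂ) ^ 2)⁻¹, ?_, ?_, ?_, ?_⟩
  · simp only [inner_add_left, inner_sub_right, inner_smul_left, inner_smul_right, hyx,
      inner_self_eq_norm_sq_to_K, map_mul, Complex.conj_ofReal]
    have hs' : (s : ℂ) * ((‖y‖ : ℂ) ^ 2 - (‖x‖ : ℂ) ^ 2) + (1 - (s : ℂ) ^ 2) * k = 0 := by
      exact_mod_cast hs
    simp only [Complex.coe_algebraMap]
    linear_combination hs' + (s * (‖y‖ : ℂ) ^ 2 - (s : ℂ) ^ 2 * k) * hcc - hk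
  · have : x = ((1 + (s : ℂ) ^ 2)⁻¹ * (1 + (s : ℂ) ^ 2)) • x := by rw [inv_mul_cancel₀ hD, one_smul]
    conv_lhs => rw [this]
    module
  · have : y = ((1 + (s : ℂ) ^ 2)⁻¹ * (1 + (s : ℂ) ^ 2) * (conj c * c)) • y := by
      rw [inv_mul_cancel₀ hD, hcc, one_mul, one_smul]
    conv_lhs => rw [this]
    module
  · have hr : conj (1 + (s : ℂ) ^ 2)⁻¹ = (1 + (s : ℂ) ^ 2)⁻¹ := by simp
    simp only [map_mul, Complex.conj_conj, Complex.conj_ofReal, hr]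
    linear_combination (s * ((1 + (s : ℂ) ^ 2)⁻¹) ^ 2) * hcc

theorem ComplexPlaneAdditive.parallelogram [FiniteDimensional ℂ H] {F : H → ℝ}
    (hF : ComplexPlaneAdditive F) (hdim : Module.finrank ℂ H ≠ 2) (x y : H) :
    F (x + y) + F (x - y) = 2 * (F x + F y) := by
  have key (a c : ℂ) : ‖a + c‖ ^ 2 + ‖a - c‖ ^ 2 = 2 * (‖a‖ ^ 2 + ‖c‖ ^ 2) := by
    have := parallelogram_law_with_norm ℝ a c
    linarith
  rcases Nat.lt_or_ge (Module.finrank ℂ H) 2 with h | h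
  · obtain ⟨e, he⟩ := finrank_le_one_iff.1 (Nat.le_of_lt_succ h)
    obtain ⟨a, rfl⟩ := he x
    obtain ⟨c, rfl⟩ := he y
    rw [← add_smul, ← sub_smul]
    simp only [hF.homog]
    linear_combination F e * key a c
  · obtain ⟨u, v, a, b, c, d, huv, rfl, rfl, h0⟩ := exists_orthogonal_mix x y
    obtain ⟨T, hT, hF'⟩ := hF.exists_interference (by omega) huv
    have hneg (ζ : ℂ) : T (-ζ) = -T ζ := by simpa using hT (-1) ζ
    have e1 : a • u + b • v + (c • u + d • v) = (a + c) • u + (b + d) • v := by module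
    have e2 : a • u + b • v - (c • u + d • v) = (a - c) • u + (b - d) • v := by module
    have e3 : conj (a - c) * (b - d) = -(conj (a + c) * (b + d)) := by
      simp only [map_add, map_sub]
      linear_combination 2 * h0
    have e4 : conj c * d = -(conj a * b) := by linear_combination h0
    rw [e1, e2, hF', hF', hF', hF', e3, e4, hneg, hneg]
    linear_combination F u * key a c + F v * key b d

end

/-- An additive function on the reals which is bounded on the unit interval is linear. -/
theorem eq_mul_of_additive_of_bounded {g : ℝ → ℝ} (hg : ∀ r s, g (r + s) = g r + g s) {A : ℝ}
    (hA : ∀ r, 0 ≤ r → r < 1 → |g r| ≤ A) (r : ℝ) : g r = r * g 1 := by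
  let φ : ℝ →+ ℝ := AddMonoidHom.mk' g hg
  have hφ (r : ℝ) : φ r = g r := rfl
  have key (n : ℕ) : n • |g r - r * g 1| ≤ A + |g 1| := by
    have h1 := hA _ (Int.fract_nonneg (n * r)) (Int.fract_lt_one _)
    have h2 : g (Int.fract (n * r)) = n * g r - ⌊n * r⌋ * g 1 := by
      rw [← hφ, Int.fract, map_sub, ← nsmul_eq_mul, map_nsmul, ← zsmul_one, map_zsmul, hφ, hφ]
      simp
    have h3 : n * (g r - r * g 1) = g (Int.fract (n * r)) - Int.fract (n * r) * g 1 := by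
      rw [h2, Int.fract]; ring
    rw [nsmul_eq_mul, ← abs_of_nonneg (Nat.cast_nonneg (α := ℝ) n), ← abs_mul, h3]
    refine (abs_sub _ _).trans (add_le_add h1 ?_)
    rw [abs_mul, abs_of_nonneg (Int.fract_nonneg _)]
    exact mul_le_of_le_one_left (abs_nonneg _) (Int.fract_lt_one _).le
  by_contra hne
  obtain ⟨n, hn⟩ := exists_lt_nsmul (abs_pos.2 (sub_ne_zero.2 hne)) (A + |g 1|)
  exact absurd (key n) (not_le.2 hn)

section

variable {H : Type*} [NormedAddCommGroup H] [InnerProductSpace ℂ H]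

/-- The vectors on which a sesquilinear form is sampled by the polarization identity. -/
noncomputable def polarVector {κ : Type*} [Fintype κ] (e : OrthonormalBasis κ ℂ H)
    (a : κ × κ × Fin 4) : H :=
  e a.1 + Complex.I ^ (a.2.2 : ℕ) • e a.2.1

/-- The coefficients of the expansion of a Hermitian form in its values on `polarVector`. -/
noncomputable def polarCoeff {κ : Type*} [Fintype κ] (e : OrthonormalBasis κ ℂ H)
    (a : κ × κ × Fin 4) (x : H) : ℂ :=
  Complex.I ^ (a.2.2 : ℕ) / 4 * (⟪e a.1, x⟫_ℂ * ⟪x, e a.2.1⟫_ℂ)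

namespace ComplexPlaneAdditive

variable [FiniteDimensional ℂ H] {F : H → ℝ}

theorem polar_add (hF : ComplexPlaneAdditive F) (hdim : Module.finrank ℂ H ≠ 2) (x x' y : H) :
    F (x + x' + y) - F (x + x' - y) = (F (x + y) - F (x - y)) + (F (x' + y) - F (x' - y)) := by
  have half (a b : H) : F (a + y) - F (a - y) + (F (b + y) - F (b - y)) =
      (F (a + b + (2 : ℂ) • y) - F (a + b - (2 : ℂ) • y)) / 2 := by
    have h1 := hF.parallelogram hdim (a + y) (b + y)
    have h2 := hF.parallelogram hdim (a - y) (b - y)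
    rw [show a + y + (b + y) = a + b + (2 : ℂ) • y by module,
      show a + y - (b + y) = a - b by module] at h1
    rw [show a - y + (b - y) = a + b - (2 : ℂ) • y by module,
      show a - y - (b - y) = a - b by module] at h2
    linarith
  have h1 := half x x'
  have h2 := half (x + x') 0
  rw [zero_add, zero_sub, hF.map_neg, add_zero] at h2
  linarith

theorem polar_real_smul (hF : ComplexPlaneAdditive F) (hdim : Module.finrank ℂ H ≠ 2) (r : ℝ)
    (x y : H) :
    F ((r : ℂ) • x + y) - F ((r : ℂ) • x - y) = r * (F (x + y) - F (x - y)) := by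
  obtain ⟨C, hC⟩ := hF.bounded
  have := eq_mul_of_additive_of_bounded
    (g := fun r : ℝ => F ((r : ℂ) • x + y) - F ((r : ℂ) • x - y))
    (A := |C| * (2 * ‖x‖ ^ 2 + 2 * ‖y‖ ^ 2))
    (fun r s => by
      rw [← hF.polar_add hdim, Complex.ofReal_add, add_smul])
    (fun r hr hr' => by
      have h1 := hC ((r : ℂ) • x + y)
      have h2 := hC ((r : ℂ) • x - y)
      have h3 := parallelogram_law_with_norm ℂ ((r : ℂ) • x) y
      rw [norm_smul, Complex.norm_real, Real.norm_of_nonneg hr] at h3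
      have h4 : C * (‖(r : ℂ) • x + y‖ ^ 2 + ‖(r : ℂ) • x - y‖ ^ 2) ≤
          |C| * (‖(r : ℂ) • x + y‖ ^ 2 + ‖(r : ℂ) • x - y‖ ^ 2) :=
        mul_le_mul_of_nonneg_right (le_abs_self C) (by positivity)
      have h5 : (r * ‖x‖) ^ 2 ≤ ‖x‖ ^ 2 := by
        rw [mul_pow]
        exact mul_le_of_le_one_left (sq_nonneg _) (by nlinarith)
      have h6 : |C| * (‖(r : ℂ) • x + y‖ ^ 2 + ‖(r : ℂ) • x - y‖ ^ 2) ≤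
          |C| * (2 * ‖x‖ ^ 2 + 2 * ‖y‖ ^ 2) :=
        mul_le_mul_of_nonneg_left (by nlinarith) (abs_nonneg C)
      have h7 := abs_sub (F ((r : ℂ) • x + y)) (F ((r : ℂ) • x - y))
      linarith) r
  simpa [-Complex.coe_smul] using this

/-- The sesquilinear form attached to `F`, as a linear functional of its first argument. -/
theorem exists_sesquilinear (hF : ComplexPlaneAdditive F) (hdim : Module.finrank ℂ H ≠ 2) :
    ∃ h : H → H →ₗ[ℂ] ℂ, (∀ x y, h y x = conj (h x y)) ∧ (∀ x, h x x = F x) ∧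
      ∀ x y, h y x = ∑ s : Fin 4, Complex.I ^ (s : ℕ) / 4 * F (x + Complex.I ^ (s : ℕ) • y) := by
  let S (x y : H) : ℝ := F (x + y) - F (x - y)
  have hadd (x x' y : H) : S (x + x') y = S x y + S x' y := hF.polar_add hdim x x' y
  have hsmul (r : ℝ) (x y : H) : S ((r : ℂ) • x) y = r * S x y := hF.polar_real_smul hdim r x y
  have hsymm (x y : H) : S x y = S y x := by
    simp only [S]
    rw [add_comm, ← neg_sub y x, hF.map_neg]
  have hrot (x y : H) : S (Complex.I • x) (Complex.I • y) = S x y := by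
    simp only [S]
    rw [← smul_add, ← smul_sub, hF.homog, hF.homog]
    simp
  have hneg (x y : H) : S (-x) y = -S x y := by simpa using hsmul (-1) x y
  have hI (x y : H) : S (Complex.I • x) y = -S x (Complex.I • y) := by
    rw [← hrot, smul_smul, Complex.I_mul_I, neg_one_smul, hneg]
  let g (y x : H) : ℂ := (S x y + Complex.I * S x (Complex.I • y)) / 4
  have gadd (y x x' : H) : g y (x + x') = g y x + g y x' := by
    simp only [g, hadd]
    push_cast
    ring
  have greal (y : H) (r : ℝ) (x : H) : g y ((r : ℂ) • x) = r * g y x := by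
    simp only [g, hsmul]
    push_cast
    ring
  have gI (y x : H) : g y (Complex.I • x) = Complex.I * g y x := by
    simp only [g, hrot, hI]
    push_cast
    linear_combination -(S x (Complex.I • y) / 4) * Complex.I_sq
  refine ⟨fun y => ⟨⟨g y, gadd y⟩, fun c x => ?_⟩, fun x y => ?_, fun x => ?_, fun x y => ?_⟩
  · change g y (c • x) = c * g y x
    conv_lhs => rw [← Complex.re_add_im c, add_smul, mul_smul, gadd, greal, greal, gI]
    conv_rhs => rw [← Complex.re_add_im c]
    ring
  · change g y x = conj (g x y)
    have h := hI x y
    rw [hsymm (Complex.I • x) y] at h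
    simp only [g, h, hsymm y x]
    simp [map_ofNat]
  · change g x x = F x
    have h1 : S x (Complex.I • x) = 0 := by
      have h := hI x x
      rw [hsymm (Complex.I • x) x] at h
      linarith
    have h2 : S x x = 4 * F x := by
      have := hF.homog 2 x
      simp only [S, sub_self, hF.map_zero, ← two_smul ℂ x, this]
      norm_num
    simp only [g, h1, h2]
    push_cast
    ring
  · change g y x = _
    simp only [g, S, Fin.sum_univ_four]
    have h3 : Complex.I ^ 3 = -Complex.I := by
      rw [pow_succ, Complex.I_sq, neg_one_mul]
    simp [h3, sub_eq_add_neg]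
    ring

theorem interpolation (hF : ComplexPlaneAdditive F) (hdim : Module.finrank ℂ H ≠ 2)
    {κ : Type*} [Fintype κ] (e : OrthonormalBasis κ ℂ H) (x : H) :
    (F x : ℂ) = ∑ a, polarCoeff e a x * F (polarVector e a) := by
  obtain ⟨h, hconj, hdiag, hpol⟩ := hF.exists_sesquilinear hdim
  have expand (y x : H) : h y x = ∑ k, ⟪e k, x⟫_ℂ * h y (e k) := by
    conv_lhs => rw [← e.sum_repr' x]
    simp
  rw [← hdiag, expand, Fintype.sum_prod_type]
  refine Finset.sum_congr rfl fun k _ => ?_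
  rw [hconj, expand, map_sum, Finset.mul_sum, Fintype.sum_prod_type]
  refine Finset.sum_congr rfl fun l _ => ?_
  rw [map_mul, ← hconj, hpol, inner_conj_symm, Finset.mul_sum, Finset.mul_sum]
  refine Finset.sum_congr rfl fun s _ => ?_
  simp only [polarCoeff, polarVector]
  ring

end ComplexPlaneAdditive

end

section

variable {H : Type*} [NormedAddCommGroup H] [InnerProductSpace ℂ H]

theorem starProjection_add_rotate {x y : H} (hn : ‖x‖ = ‖y‖) (hxy : ⟪x, y⟫_ℂ = 0) {a b : ℝ}
    (hab : a ^ 2 + b ^ 2 ≠ 0) :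
    (ℂ ∙ ((a : ℂ) • x + (b : ℂ) • y)).starProjection +
      (ℂ ∙ ((a : ℂ) • y - (b : ℂ) • x)).starProjection =
      (ℂ ∙ x).starProjection + (ℂ ∙ y).starProjection := by
  have hyx : ⟪y, x⟫_ℂ = 0 := inner_eq_zero_symm.1 hxy
  by_cases hx : x = 0
  · have hy : y = 0 := by simpa [hx, eq_comm] using hn
    simp [hx, hy]
  have hx' : (‖x‖ : ℂ) ≠ 0 := by simpa using hx
  have hab' : (a : ℂ) ^ 2 + (b : ℂ) ^ 2 ≠ 0 := by exact_mod_cast hab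
  have n1 : ‖(a : ℂ) • x + (b : ℂ) • y‖ ^ 2 = (a ^ 2 + b ^ 2) * ‖x‖ ^ 2 := by
    have := norm_add_pow_two (𝕜 := ℂ) ((a : ℂ) • x) ((b : ℂ) • y)
    rw [this, inner_smul_left, inner_smul_right, hxy, norm_smul, norm_smul, ← hn]
    simp [mul_pow]
    ring
  have n2 : ‖(a : ℂ) • y - (b : ℂ) • x‖ ^ 2 = (a ^ 2 + b ^ 2) * ‖x‖ ^ 2 := by
    have := norm_sub_pow_two (𝕜 := ℂ) ((a : ℂ) • y) ((b : ℂ) • x)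
    rw [this, inner_smul_left, inner_smul_right, hyx, norm_smul, norm_smul, ← hn]
    simp [mul_pow]
    ring
  ext v
  simp only [add_apply, Submodule.starProjection_singleton, n1, n2, ← hn,
    inner_add_left, inner_sub_left, inner_smul_left, Complex.conj_ofReal]
  simp only [Complex.coe_algebraMap]
  push_cast
  match_scalars <;> field_simp <;> ring

theorem starProjection_mul_of_inner_eq_zero {x y : H} (hxy : ⟪x, y⟫_ℂ = 0) :
    (ℂ ∙ x).starProjection * (ℂ ∙ y).starProjection = 0 :=
  Submodule.IsOrtho.starProjection_comp_starProjection
    (by rw [Submodule.isOrtho_span]; simpa using hxy)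

variable [CompleteSpace H]

theorem isProjectionOp_starProjection (x : H) :
    IsProjectionOp (ℂ ∙ x).starProjection :=
  ⟨(ℂ ∙ x).isIdempotentElem_starProjection, isSelfAdjoint_starProjection _⟩

theorem IsProjectionOp.one_sub {p : H →L[ℂ] H} (hp : IsProjectionOp p) : IsProjectionOp (1 - p) :=
  ⟨hp.1.one_sub, (IsSelfAdjoint.one _).sub hp.2⟩

/-- The quadratic extension of a measure on projections to all vectors. -/
theorem complexPlaneAdditive_of_measure {μ : (H →L[ℂ] H) → ℝ}
    (hμ0 : ∀ p, IsProjectionOp p → 0 ≤ μ p)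
    (hμ : ∀ p q, IsProjectionOp p → IsProjectionOp q → p * q = 0 → q * p = 0 →
      μ (p + q) = μ p + μ q) :
    ComplexPlaneAdditive fun x => ‖x‖ ^ 2 * μ (ℂ ∙ x).starProjection where
  homog c x := by
    by_cases hc : c = 0
    · simp [hc]
    · simp only [Submodule.span_singleton_smul_eq (IsUnit.mk0 c hc), norm_smul]
      ring
  planar x y hn hxy a b := by
    by_cases hab : a ^ 2 + b ^ 2 = 0
    · have ha : a = 0 := by nlinarith
      have hb : b = 0 := by nlinarith
      simp [ha, hb]
    have hyx : ⟪y, x⟫_ℂ = 0 := inner_eq_zero_symm.1 hxy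
    have h0 : ⟪(a : ℂ) • x + (b : ℂ) • y, (a : ℂ) • y - (b : ℂ) • x⟫_ℂ = 0 := by
      simp only [inner_add_left, inner_sub_right, inner_smul_left, inner_smul_right, hxy, hyx,
        inner_self_eq_norm_sq_to_K, hn, Complex.conj_ofReal]
      ring
    have n1 : ‖(a : ℂ) • x + (b : ℂ) • y‖ ^ 2 = (a ^ 2 + b ^ 2) * ‖x‖ ^ 2 := by
      have := norm_add_pow_two (𝕜 := ℂ) ((a : ℂ) • x) ((b : ℂ) • y)
      rw [this, inner_smul_left, inner_smul_right, hxy, norm_smul, norm_smul, ← hn]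
      simp [mul_pow]
      ring
    have n2 : ‖(a : ℂ) • y - (b : ℂ) • x‖ ^ 2 = (a ^ 2 + b ^ 2) * ‖x‖ ^ 2 := by
      have := norm_sub_pow_two (𝕜 := ℂ) ((a : ℂ) • y) ((b : ℂ) • x)
      rw [this, inner_smul_left, inner_smul_right, hyx, norm_smul, norm_smul, ← hn]
      simp [mul_pow]
      ring
    rw [n1, n2, ← mul_add, ← hμ _ _ (isProjectionOp_starProjection _)
      (isProjectionOp_starProjection _) (starProjection_mul_of_inner_eq_zero h0)
      (starProjection_mul_of_inner_eq_zero (inner_eq_zero_symm.1 h0)),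
      starProjection_add_rotate hn hxy hab, hμ _ _ (isProjectionOp_starProjection _)
      (isProjectionOp_starProjection _) (starProjection_mul_of_inner_eq_zero hxy)
      (starProjection_mul_of_inner_eq_zero hyx), ← hn]
    ring
  bounded := by
    refine ⟨μ 1, fun x => ?_⟩
    have hp := isProjectionOp_starProjection x
    have h := hμ _ _ hp hp.one_sub hp.1.mul_one_sub_self hp.1.one_sub_mul_self
    rw [add_sub_cancel] at h
    have h1 := hμ0 _ hp
    have h2 := hμ0 _ hp.one_sub
    rw [abs_of_nonneg (by positivity), mul_comm]
    exact mul_le_mul_of_nonneg_right (by linarith) (by positivity)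

end

section

variable {n : ℕ} {H : Fin n → Type*} [∀ i, NormedAddCommGroup (H i)]
  [∀ i, InnerProductSpace ℂ (H i)] {E : Type*} [NormedAddCommGroup E] [InnerProductSpace ℂ E]
  {κ : Fin n → Type*} [∀ j, Fintype (κ j)]

/-- Functions obeying the polarization expansion in every variable have a constant sum over the
orthonormal bases of simple tensors. -/
theorem exists_weight_of_interpolation {t : (∀ i, H i) → E} (ht : IsHilbertTensorMap t)
    (e : ∀ j, OrthonormalBasis (κ j) ℂ (H j)) {R : (∀ j, H j) → ℂ}
    (hR : ∀ j ν, R ν = ∑ a, polarCoeff (e j) a (ν j) *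
      R (Function.update ν j (polarVector (e j) a))) (S : Finset (Fin n))
    (a : ∀ j, κ j × κ j × Fin 4) :
    ∃ w : ℂ, ∀ (ι : Type) (_ : Fintype ι) (b : OrthonormalBasis ι ℂ E) (ν : ι → ∀ j, H j),
      (∀ i, b i = t (ν i)) →
      ∑ i, (∏ j ∈ S, polarCoeff (e j) (a j) (ν i j)) *
        R (S.piecewise (fun j => polarVector (e j) (a j)) (ν i)) = w := by
  induction hc : Sᶜ.card generalizing S a with
  | zero =>
    obtain rfl : S = Finset.univ := by simpa using hc
    refine ⟨(∏ j, Complex.I ^ ((a j).2.2 : ℕ) / 4) *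
      ⟪t fun j => e j (a j).1, t fun j => e j (a j).2.1⟫_ℂ *
      R (fun j => polarVector (e j) (a j)), fun ι _ b ν hb => ?_⟩
    rw [← b.sum_inner_mul_inner, Finset.mul_sum, Finset.sum_mul]
    refine Finset.sum_congr rfl fun i _ => ?_
    rw [hb, ht.1, ht.1, ← Finset.prod_mul_distrib, ← Finset.prod_mul_distrib,
      Finset.piecewise_univ]
    rfl
  | succ k ih =>
    obtain ⟨j, hj⟩ : ∃ j, j ∉ S := by
      have : Sᶜ.Nonempty := Finset.card_pos.1 (by omega)
      simpa [Finset.Nonempty] using this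
    choose w hw using fun α => ih (insert j S) (Function.update a j α) (by
      rw [Finset.compl_insert, Finset.card_erase_of_mem (Finset.mem_compl.2 hj), hc]; rfl)
    refine ⟨∑ α, w α, fun ι _ b ν hb => ?_⟩
    simp only [← hw _ ι _ b ν hb]
    rw [Finset.sum_comm]
    refine Finset.sum_congr rfl fun i _ => ?_
    rw [hR j, Finset.mul_sum]
    refine Finset.sum_congr rfl fun α _ => ?_
    have hprod : ∏ l ∈ S, polarCoeff (e l) (Function.update a j α l) (ν i l) =
        ∏ l ∈ S, polarCoeff (e l) (a l) (ν i l) :=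
      Finset.prod_congr rfl fun l hl => by
        rw [Function.update_of_ne (ne_of_mem_of_not_mem hl hj)]
    have hpw : (insert j S).piecewise (fun l => polarVector (e l) (Function.update a j α l)) (ν i)
        = Function.update (S.piecewise (fun l => polarVector (e l) (a l)) (ν i)) j
          (polarVector (e j) α) := by
      rw [Finset.piecewise_insert, Function.update_self]
      congr 1
      exact Finset.piecewise_congr _ (fun l hl => by
        rw [Function.update_of_ne (ne_of_mem_of_not_mem hl hj)]) fun _ _ => rfl
    rw [Finset.prod_insert hj, Function.update_self, hprod, hpw,
      Finset.piecewise_eq_of_notMem _ _ _ hj]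
    ring

variable [∀ i, FiniteDimensional ℂ (H i)]

theorem multimeasure_interpolation (hdim : ∀ i, Module.finrank ℂ (H i) ≠ 2)
    {m : (∀ i, H i →L[ℂ] H i) → ℝ} (hm : IsQuantumMultimeasure m)
    (e : ∀ j, OrthonormalBasis (κ j) ℂ (H j)) (j : Fin n) (ν : ∀ j, H j) :
    (((∏ i, ‖ν i‖ ^ 2) * m fun i => (ℂ ∙ ν i).starProjection : ℝ) : ℂ) =
      ∑ a, polarCoeff (e j) a (ν j) *
        ((∏ i, ‖Function.update ν j (polarVector (e j) a) i‖ ^ 2) *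
          m fun i => (ℂ ∙ Function.update ν j (polarVector (e j) a) i).starProjection : ℝ) := by
  set p : ∀ i, H i →L[ℂ] H i := fun i => (ℂ ∙ ν i).starProjection with hp
  have hproj (i : Fin n) : IsProjectionOp (p i) := isProjectionOp_starProjection _
  have hupd (q : H j →L[ℂ] H j) (hq : IsProjectionOp q) (i : Fin n) :
      IsProjectionOp (Function.update p j q i) := by
    by_cases h : i = j
    · subst h; simpa using hq
    · simpa [h] using hproj i
  have hF := complexPlaneAdditive_of_measure (H := H j)
    (μ := fun q => (∏ i ∈ Finset.univ.erase j, ‖ν i‖ ^ 2) * m (Function.update p j q))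
    (fun q hq => mul_nonneg (Finset.prod_nonneg fun i _ => sq_nonneg _) (hm.1 _ (hupd q hq)))
    (fun q r hq hr hqr hrq => by rw [hm.2 p hproj j q r hq hr hqr hrq, mul_add])
  have hval (x : H j) : (∏ i, ‖Function.update ν j x i‖ ^ 2) *
      m (fun i => (ℂ ∙ Function.update ν j x i).starProjection) =
      ‖x‖ ^ 2 * ((∏ i ∈ Finset.univ.erase j, ‖ν i‖ ^ 2) *
        m (Function.update p j (ℂ ∙ x).starProjection)) := by
    rw [← Finset.mul_prod_erase _ _ (Finset.mem_univ j), Function.update_self, mul_assoc]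
    congr 2
    · exact Finset.prod_congr rfl fun i hi => by
        rw [Function.update_of_ne (Finset.ne_of_mem_erase hi)]
    · congr 1
      funext i
      by_cases h : i = j
      · subst h; simp
      · simp [h, hp]
  have h := hF.interpolation (hdim j) (e j) (ν j)
  simp only [← hval] at h
  rw [Function.update_eq_self] at h
  exact h

end

/-- Unit vectors with the same tensor product span the same lines. -/
theorem IsHilbertTensorMap.span_singleton_eq {n : ℕ} {H : Fin n → Type*}
    [∀ i, NormedAddCommGroup (H i)] [∀ i, InnerProductSpace ℂ (H i)]
    {E : Type*} [NormedAddCommGroup E] [InnerProductSpace ℂ E]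
    {t : (∀ i, H i) → E} (ht : IsHilbertTensorMap t) {ν ν' : ∀ j, H j} (hν : ∀ j, ‖ν j‖ = 1)
    (hν' : ∀ j, ‖ν' j‖ = 1) (h : t ν = t ν') (j : Fin n) : ℂ ∙ ν j = ℂ ∙ ν' j := by
  have hle (i : Fin n) : ‖⟪ν i, ν' i⟫_ℂ‖ ≤ 1 := by
    simpa [hν, hν'] using norm_inner_le_norm (𝕜 := ℂ) (ν i) (ν' i)
  have hprod : ∏ i, ‖⟪ν i, ν' i⟫_ℂ‖ = 1 := by
    rw [← norm_prod, ← ht.1, ← h, ht.1, norm_prod]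
    simp [hν]
  have hone : ‖⟪ν j, ν' j⟫_ℂ‖ = 1 := by
    refine le_antisymm (hle j) ?_
    rw [← hprod, ← Finset.mul_prod_erase _ _ (Finset.mem_univ j)]
    exact mul_le_of_le_one_right (norm_nonneg _)
      (Finset.prod_le_one (fun i _ => norm_nonneg _) fun i _ => hle i)
  have h0 (x : H j) (hx : ‖x‖ = 1) : x ≠ 0 := by
    rintro rfl
    simp at hx
  obtain ⟨r, hr, hr'⟩ := (norm_inner_eq_norm_iff (𝕜 := ℂ) (h0 _ (hν j)) (h0 _ (hν' j))).1
    (by rw [hone, hν, hν', one_mul])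
  rw [hr', Submodule.span_singleton_smul_eq (IsUnit.mk0 r hr)]

/-- Every positive quantum multi-measure on finite dimensional Hilbert spaces,
none of dimension 2, arises from an unentangled frame function `f` on the unit
simple tensors: `f (ν₁ ⊗ ⋯ ⊗ νₙ) = m (p₁, …, pₙ)` for the rank-one projections
`p j` onto `ℂ ν j`. -/
theorem multimeasure_gives_unentangled_frameFunction
    {n : ℕ} {H : Fin n → Type*}
    [∀ i, NormedAddCommGroup (H i)] [∀ i, InnerProductSpace ℂ (H i)]
    [∀ i, FiniteDimensional ℂ (H i)]
    (hdim : ∀ i, Module.finrank ℂ (H i) ≠ 2)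
    {E : Type*} [NormedAddCommGroup E] [InnerProductSpace ℂ E]
    [FiniteDimensional ℂ E]
    (t : (∀ i, H i) → E) (ht : IsHilbertTensorMap t)
    (m : (∀ i, H i →L[ℂ] H i) → ℝ) (hm : IsQuantumMultimeasure m) :
    ∃ (f : E → ℝ) (w : ℝ),
      -- `f` is an unentangled frame function of weight `w`
      (∀ x, 0 ≤ f x) ∧
      (∀ (ι : Type) (_ : Fintype ι) (b : OrthonormalBasis ι ℂ E),
        (∀ i, ∃ ν : ∀ j, H j, (∀ j, ‖ν j‖ = 1) ∧ b i = t ν) →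
        ∑ i, f (b i) = w) ∧
      -- `f` recovers the multi-measure on rank-one projections
      (∀ ν : ∀ j, H j, (∀ j, ‖ν j‖ = 1) →
        ∀ p : ∀ j, H j →L[ℂ] H j,
          (∀ j, ∀ v : H j, p j v = ⟪ν j, v⟫_ℂ • ν j) →
          f (t ν) = m p) := by
  classical
  have hspan {ν ν' : ∀ j, H j} (hν : ∀ j, ‖ν j‖ = 1) (hν' : ∀ j, ‖ν' j‖ = 1) (h : t ν = t ν') :
      (fun j => (ℂ ∙ ν j).starProjection) = fun j => (ℂ ∙ ν' j).starProjection := by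
    funext j
    simp only [ht.span_singleton_eq hν hν' h j]
  let f (x : E) : ℝ := if h : ∃ ν : ∀ j, H j, (∀ j, ‖ν j‖ = 1) ∧ x = t ν then
    m fun j => (ℂ ∙ h.choose j).starProjection else 0
  have hf (ν : ∀ j, H j) (hν : ∀ j, ‖ν j‖ = 1) :
      f (t ν) = m fun j => (ℂ ∙ ν j).starProjection := by
    have h : ∃ ν' : ∀ j, H j, (∀ j, ‖ν' j‖ = 1) ∧ t ν = t ν' := ⟨ν, hν, rfl⟩
    simp only [f, dif_pos h]
    rw [hspan hν h.choose_spec.1 h.choose_spec.2]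
  obtain ⟨w, hw⟩ : ∃ w : ℂ, ∀ (ι : Type) (_ : Fintype ι) (b : OrthonormalBasis ι ℂ E)
      (ν : ι → ∀ j, H j), (∀ i, b i = t (ν i)) →
      ∑ i, (((∏ j, ‖ν i j‖ ^ 2) * m fun j => (ℂ ∙ ν i j).starProjection : ℝ) : ℂ) = w := by
    by_cases hpos : ∀ j, 0 < Module.finrank ℂ (H j)
    · obtain ⟨w, hw⟩ := exists_weight_of_interpolation ht
        (fun j => stdOrthonormalBasis ℂ (H j))
        (R := fun ν => (((∏ j, ‖ν j‖ ^ 2) * m fun j => (ℂ ∙ ν j).starProjection : ℝ) : ℂ))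
        (multimeasure_interpolation hdim hm _) ∅ (fun j => (⟨0, hpos j⟩, ⟨0, hpos j⟩, 0))
      exact ⟨w, by simpa using hw⟩
    · push Not at hpos
      obtain ⟨j, hj⟩ := hpos
      have hsub : Subsingleton (H j) := Module.finrank_zero_iff.1 (Nat.le_zero.1 hj)
      refine ⟨0, fun ι _ b ν hb => Finset.sum_eq_zero fun i _ => ?_⟩
      rw [Finset.prod_eq_zero (Finset.mem_univ j) (by simp [Subsingleton.elim (ν i j) 0])]
      simp
  refine ⟨f, w.re, fun x => ?_, fun ι _ b hb => ?_, fun ν hν p hp => ?_⟩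
  · simp only [f]
    split_ifs
    · exact hm.1 _ fun j => isProjectionOp_starProjection _
    · exact le_rfl
  · choose ν hν hb using hb
    have := hw ι _ b ν hb
    rw [← this, ← Complex.ofReal_sum, Complex.ofReal_re]
    refine Finset.sum_congr rfl fun i _ => ?_
    rw [hb, hf _ (hν i)]
    simp [hν i]
  · rw [hf ν hν]
    congr 1
    funext j
    ext v
    rw [hp, Submodule.starProjection_unit_singleton ℂ (hν j)]
end

section
/- (Wallach's unentangled Gleason theorem) Let H₁,…,Hₙ be finite dimensional Hilbert spaces, each of dimension at least 3, and let f : Σ(H₁,…,Hₙ) → ℝ≥0 be an unentangled frame function. Then there exists a self-adjoint operator T on H₁ ⊗ ⋯ ⊗ Hₙ such that f(ν₁ ⊗ ⋯ ⊗ νₙ) = Tr((p₁ ⊗ ⋯ ⊗ pₙ) T) for all unit simple tensors, where p_j is the rank-one projection onto ℂν_j. -/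
open scoped InnerProductSpace

section Gleason

open Filter Topology

/-- Real Euclidean three-space. -/
abbrev R3 : Type := EuclideanSpace ℝ (Fin 3)

/-- `f` is invariant under nonzero scalings and sums to `w` over nonzero orthogonal triples. -/
structure IsRealFrame (f : R3 → ℝ) (w : ℝ) : Prop where
  smul : ∀ c : ℝ, c ≠ 0 → ∀ x, f (c • x) = f x
  sum : ∀ a b c : R3, a ≠ 0 → b ≠ 0 → c ≠ 0 → ⟪a, b⟫_ℝ = 0 → ⟪a, c⟫_ℝ = 0 → ⟪b, c⟫_ℝ = 0 →
    f a + f b + f c = w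

/-- `f` oscillates by at most `δ` on some neighbourhood of `x`. -/
def OscLE (f : R3 → ℝ) (δ : ℝ) (x : R3) : Prop :=
  ∃ U ∈ 𝓝 x, ∀ y ∈ U, ∀ z ∈ U, |f y - f z| ≤ δ

lemma R3.inner_eq (x y : R3) : ⟪x, y⟫_ℝ = x 0 * y 0 + x 1 * y 1 + x 2 * y 2 := by
  simp [PiLp.inner_apply, Fin.sum_univ_three, mul_comm]

lemma R3.exists_perp (x y : R3) : ∃ n : R3, n ≠ 0 ∧ ⟪n, x⟫_ℝ = 0 ∧ ⟪n, y⟫_ℝ = 0 := by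
  have hlt : Submodule.span ℝ {x, y} ≠ ⊤ := by
    intro h
    have h1 : Module.finrank ℝ (Submodule.span ℝ ((({x, y} : Finset R3) : Set R3))) ≤ 2 :=
      (finrank_span_finset_le_card _).trans Finset.card_le_two
    rw [Finset.coe_pair, h, finrank_top] at h1
    simp at h1
  have hne : (Submodule.span ℝ {x, y})ᗮ ≠ ⊥ := by
    rwa [Ne, Submodule.orthogonal_eq_bot_iff]
  obtain ⟨n, hn, hn0⟩ := Submodule.exists_mem_ne_zero_of_ne_bot hne
  rw [Submodule.mem_orthogonal'] at hn
  exact ⟨n, hn0, hn x (Submodule.subset_span (by simp)), hn y (Submodule.subset_span (by simp))⟩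

namespace IsRealFrame

variable {f : R3 → ℝ} {w : ℝ}

lemma plane (hf : IsRealFrame f w) {n a b c d : R3} (hn : n ≠ 0) (ha : a ≠ 0) (hb : b ≠ 0)
    (hc : c ≠ 0) (hd : d ≠ 0) (hna : ⟪n, a⟫_ℝ = 0) (hnb : ⟪n, b⟫_ℝ = 0) (hnc : ⟪n, c⟫_ℝ = 0)
    (hnd : ⟪n, d⟫_ℝ = 0) (hab : ⟪a, b⟫_ℝ = 0) (hcd : ⟪c, d⟫_ℝ = 0) :
    f a + f b = f c + f d := by
  have h1 := hf.sum n a b hn ha hb hna hnb hab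
  have h2 := hf.sum n c d hn hc hd hnc hnd hcd
  linarith

lemma comp (hf : IsRealFrame f w) (e : R3 ≃ₗᵢ[ℝ] R3) : IsRealFrame (fun x => f (e x)) w where
  smul c hc x := by simp [hf.smul c hc]
  sum a b c ha hb hc hab hac hbc :=
    hf.sum _ _ _ (by simpa) (by simpa) (by simpa) (by simpa) (by simpa) (by simpa)

lemma oscLE_perp (hf : IsRealFrame f w) {δ : ℝ} {x y : R3} (hx : x ≠ 0) (hy : y ≠ 0)
    (hxy : ⟪x, y⟫_ℝ = 0) (h : OscLE f δ x) : OscLE f (2 * δ) y := by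
  obtain ⟨U, hU, hosc⟩ := h
  obtain ⟨N, hNU, hNo, hxN⟩ := mem_nhds_iff.1 hU
  have hx2 : ⟪x, x⟫_ℝ ≠ 0 := inner_self_ne_zero.2 hx
  have hy2 : ⟪y, y⟫_ℝ ≠ 0 := inner_self_ne_zero.2 hy
  have hyx : ⟪y, x⟫_ℝ = 0 := by rw [real_inner_comm]; exact hxy
  set k : ℝ := ⟪x, x⟫_ℝ / ⟪y, y⟫_ℝ with hk
  have ht : Tendsto (fun c : ℝ => x - (c * k) • y) (𝓝 0) (𝓝 x) := by
    have : Continuous (fun c : ℝ => x - (c * k) • y) := by fun_prop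
    simpa using this.tendsto 0
  have hev : ∀ᶠ c in 𝓝 (0 : ℝ), x - (c * k) • y ∈ N ∧ x - (c * k) • y ≠ 0 :=
    (ht.eventually (hNo.mem_nhds hxN)).and (ht.eventually_ne hx)
  obtain ⟨c, ⟨hcN, hc0'⟩, hc0⟩ :=
    ((hev.filter_mono (nhdsWithin_le_nhds (s := {0}ᶜ))).and self_mem_nhdsWithin).exists
  have hc : c ≠ 0 := hc0
  set z := x - (c * k) • y with hz
  set v := y + c • x with hv
  have hvv : ⟪v, v⟫_ℝ = ⟪y, y⟫_ℝ + c ^ 2 * ⟪x, x⟫_ℝ := by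
    simp only [hv, inner_add_left, inner_add_right, inner_smul_left, inner_smul_right, hxy, hyx]
    simp; ring
  have hvpos : 0 < ⟪v, v⟫_ℝ := by
    have h1 := real_inner_self_nonneg (x := x)
    have h2 := lt_of_le_of_ne (real_inner_self_nonneg (x := y)) (Ne.symm hy2)
    rw [hvv]; positivity
  have hv0 : v ≠ 0 := by rintro h; rw [h] at hvpos; simp at hvpos
  have hyv : ⟪y, v⟫_ℝ = ⟪y, y⟫_ℝ := by
    simp [hv, inner_add_right, inner_smul_right, hyx]
  let Z : R3 → R3 := fun u => c⁻¹ • (v - (⟪v, u⟫_ℝ / ⟪u, u⟫_ℝ) • u)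
  let Z' : R3 → R3 := fun u =>
    (-(⟪v, v⟫_ℝ / (c * ⟪y, y⟫_ℝ))) • (u - (⟪u, v⟫_ℝ / ⟪v, v⟫_ℝ) • v)
  have hZy : Z y = x := by
    simp only [Z, real_inner_comm y v, hyv, div_self hy2, one_smul]
    simp [hv, smul_smul, hc]
  have hZ'y : Z' y = z := by
    simp only [Z', hyv]
    rw [smul_sub, smul_smul, hz, hv, smul_add, smul_smul, sub_add_eq_sub_sub, ← sub_smul]
    have e1 : -(⟪v, v⟫_ℝ / (c * ⟪y, y⟫_ℝ)) * (⟪y, y⟫_ℝ / ⟪v, v⟫_ℝ) * c = -1 := by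
      field_simp
    have e2 : -(⟪v, v⟫_ℝ / (c * ⟪y, y⟫_ℝ)) -
        -(⟪v, v⟫_ℝ / (c * ⟪y, y⟫_ℝ)) * (⟪y, y⟫_ℝ / ⟪v, v⟫_ℝ) = - (c * k) := by
      rw [hk]
      field_simp
      rw [hvv]; ring
    rw [e1, e2]
    simp [sub_eq_add_neg, add_comm]
  have hZc : ContinuousAt Z y := by
    have : ContinuousAt (fun u => ⟪v, u⟫_ℝ / ⟪u, u⟫_ℝ) y :=
      ContinuousAt.div (by fun_prop) (by fun_prop) hy2
    fun_prop
  have hZ'c : ContinuousAt Z' y := by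
    have : Continuous Z' := by fun_prop
    exact this.continuousAt
  have E : ∀ᶠ u in 𝓝 y, |f u - f v| ≤ δ := by
    have a1 := hZc.eventually (hNo.mem_nhds (hZy.symm ▸ hxN))
    have a2 := hZ'c.eventually (hNo.mem_nhds (hZ'y.symm ▸ hcN))
    have a3 := hZc.eventually_ne (hZy.symm ▸ hx)
    have a4 := hZ'c.eventually_ne (hZ'y.symm ▸ hc0')
    filter_upwards [a1, a2, a3, a4, eventually_ne_nhds hy] with u b1 b2 b3 b4 b5
    have hu2 : ⟪u, u⟫_ℝ ≠ 0 := inner_self_ne_zero.2 b5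
    obtain ⟨n, hn, hnu, hnv⟩ := R3.exists_perp u v
    have := hf.plane hn b5 b3 hv0 b4 hnu
      (by simp [Z, inner_sub_right, inner_smul_right, hnu, hnv]) hnv
      (by simp [Z', inner_sub_right, inner_smul_right, hnu, hnv])
      (by simp only [Z, inner_sub_right, inner_smul_right, real_inner_comm u v]; field_simp; simp)
      (by simp only [Z', inner_sub_right, inner_smul_right, real_inner_comm u v]; field_simp; simp)
    have h3 := hosc _ (hNU b2) _ (hNU b1)
    have : f u - f v = f (Z' u) - f (Z u) := by linarith
    rwa [this]
  refine ⟨_, E, fun a ha b hb => ?_⟩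
  have h1 : |f a - f v| ≤ δ := ha
  have h2 : |f b - f v| ≤ δ := hb
  rw [abs_le] at *
  constructor <;> linarith

lemma oscLE_of_oscLE (hf : IsRealFrame f w) {δ : ℝ} {x y : R3} (hx : x ≠ 0) (hy : y ≠ 0)
    (h : OscLE f δ x) : OscLE f (4 * δ) y := by
  obtain ⟨n, hn, hnx, hny⟩ := R3.exists_perp x y
  have h1 := hf.oscLE_perp hx hn (by rw [real_inner_comm]; exact hnx) h
  have h2 := hf.oscLE_perp hn hy hny h1
  convert h2 using 1; ring

end IsRealFrame

/-- Rotation of three-space by the angle `θ` about the third axis. -/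
noncomputable def R3.rot (θ : ℝ) : R3 ≃ₗᵢ[ℝ] R3 where
  toFun x := !₂[Real.cos θ * x 0 - Real.sin θ * x 1, Real.sin θ * x 0 + Real.cos θ * x 1, x 2]
  invFun x := !₂[Real.cos θ * x 0 + Real.sin θ * x 1, -Real.sin θ * x 0 + Real.cos θ * x 1, x 2]
  map_add' x y := by ext i; fin_cases i <;> simp <;> ring
  map_smul' c x := by ext i; fin_cases i <;> simp <;> ring
  left_inv x := by
    have h := Real.sin_sq_add_cos_sq θ
    ext i; fin_cases i <;> simp
    · linear_combination x 0 * h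
    · linear_combination x 1 * h
  right_inv x := by
    have h := Real.sin_sq_add_cos_sq θ
    ext i; fin_cases i <;> simp
    · linear_combination x 0 * h
    · linear_combination x 1 * h
  norm_map' x := by
    have h := Real.sin_sq_add_cos_sq θ
    simp only [EuclideanSpace.norm_eq, Fin.sum_univ_three]
    congr 1
    simp
    linear_combination (x 0 ^ 2 + x 1 ^ 2) * h

lemma R3.rot_apply (θ : ℝ) (x : R3) : R3.rot θ x =
    !₂[Real.cos θ * x 0 - Real.sin θ * x 1, Real.sin θ * x 0 + Real.cos θ * x 1, x 2] := rfl

lemma R3.rot_pi_div_two (x : R3) : R3.rot (Real.pi / 2) x = !₂[-x 1, x 0, x 2] := by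
  simp [R3.rot_apply]

lemma R3.ne_zero_of_apply {x : R3} (i : Fin 3) (h : x i ≠ 0) : x ≠ 0 := by
  rintro rfl; simp at h

lemma R3.ne_zero_of_sq_add_sq {a b : ℝ} (d : ℝ) (h : 0 < a ^ 2 + b ^ 2) :
    (!₂[a, b, d] : R3) ≠ 0 := by
  rintro h'
  have e0 : a = 0 := congrArg (fun x : R3 => x 0) h'
  have e1 : b = 0 := congrArg (fun x : R3 => x 1) h'
  simp [e0, e1] at h

namespace IsRealFrame

variable {f : R3 → ℝ} {w : ℝ}

lemma add {g : R3 → ℝ} {w' : ℝ} (hf : IsRealFrame f w) (hg : IsRealFrame g w') :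
    IsRealFrame (fun x => f x + g x) (w + w') where
  smul c hc x := by simp [hf.smul c hc, hg.smul c hc]
  sum a b c ha hb hc hab hac hbc := by
    have h1 := hf.sum a b c ha hb hc hab hac hbc
    have h2 := hg.sum a b c ha hb hc hab hac hbc
    linarith

/-- If a nonnegative frame function is constant, equal to `c`, on the equator and takes the
value `m` at the pole, then moving away from the pole along a great circle perpendicular to the
meridian decreases it by at most `m`. -/
lemma le_add_of_descent (hf : IsRealFrame f w) (h0 : ∀ x, 0 ≤ f x) {c : ℝ}
    (he : ∀ a b : ℝ, 0 < a ^ 2 + b ^ 2 → f !₂[a, b, 0] = c) (u v τ : ℝ) :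
    f !₂[u, v, 1] ≤ f !₂[u - τ * v, v + τ * u, 1] + f !₂[0, 0, 1] := by
  by_cases huv : u ^ 2 + v ^ 2 = 0
  · obtain rfl : u = 0 := by nlinarith [sq_nonneg u, sq_nonneg v]
    obtain rfl : v = 0 := by nlinarith [sq_nonneg v]
    simpa using h0 _
  have hr : 0 < u ^ 2 + v ^ 2 := lt_of_le_of_ne (by positivity) (Ne.symm huv)
  have key : ∀ a b d : ℝ, 0 < a ^ 2 + b ^ 2 → f !₂[a, b, d] ≤ f !₂[0, 0, 1] + c := by
    intro a b d hab
    have hn : (!₂[-b, a, 0] : R3) ≠ 0 := R3.ne_zero_of_sq_add_sq 0 (by nlinarith)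
    have ha := R3.ne_zero_of_sq_add_sq d hab
    have he0 := R3.ne_zero_of_sq_add_sq 0 hab
    have := hf.plane (n := !₂[-b, a, 0]) (a := !₂[a, b, d])
      (b := !₂[-(a * d), -(b * d), a ^ 2 + b ^ 2]) (c := !₂[0, 0, 1]) (d := !₂[a, b, 0])
      hn ha (R3.ne_zero_of_apply 2 (by simpa using hab.ne')) (R3.ne_zero_of_apply 2 (by simp)) he0
      (by simp [R3.inner_eq]; ring) (by simp [R3.inner_eq]; ring) (by simp [R3.inner_eq])
      (by simp [R3.inner_eq]; ring) (by simp [R3.inner_eq]; ring) (by simp [R3.inner_eq])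
    have h1 := h0 !₂[-(a * d), -(b * d), a ^ 2 + b ^ 2]
    have h2 := he a b hab
    linarith
  set r := u ^ 2 + v ^ 2 with hrdef
  have he0 : (!₂[-v, u, 0] : R3) ≠ 0 := R3.ne_zero_of_sq_add_sq 0 (by nlinarith)
  have hs : 0 < (-(τ * r) * u - (r + 1) * v) ^ 2 + (-(τ * r) * v + (r + 1) * u) ^ 2 := by
    have : (-(τ * r) * u - (r + 1) * v) ^ 2 + (-(τ * r) * v + (r + 1) * u) ^ 2
      = (τ * r) ^ 2 * r + (r + 1) ^ 2 * r := by rw [hrdef]; ring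
    rw [this]; positivity
  have hs0 := R3.ne_zero_of_sq_add_sq (-(τ * r)) hs
  have := hf.plane (n := !₂[-u, -v, r]) (a := !₂[u, v, 1]) (b := !₂[-v, u, 0])
    (c := !₂[u - τ * v, v + τ * u, 1])
    (d := !₂[-(τ * r) * u - (r + 1) * v, -(τ * r) * v + (r + 1) * u, -(τ * r)])
    (R3.ne_zero_of_apply 2 (by simpa using hr.ne')) (R3.ne_zero_of_apply 2 (by simp)) he0
    (R3.ne_zero_of_apply 2 (by simp)) hs0
    (by simp [R3.inner_eq, hrdef]; ring) (by simp [R3.inner_eq, hrdef]; ring)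
    (by simp [R3.inner_eq, hrdef]; ring) (by simp [R3.inner_eq, hrdef]; ring)
    (by simp [R3.inner_eq]; ring) (by simp [R3.inner_eq, hrdef]; ring)
  have h1 := key _ _ (-(τ * r)) hs
  have h2 := he (-v) u (by nlinarith)
  linarith

lemma oscLE_of_descent {m : ℝ} {ε : ℝ} (hf : IsRealFrame f w) (h0 : ∀ x, 0 ≤ f x)
    (hε : 0 < ε)
    (hd : ∀ u v τ : ℝ, f !₂[u, v, 1] ≤ f !₂[u - τ * v, v + τ * u, 1] + m) :
    ∃ x : R3, x ≠ 0 ∧ OscLE f (2 * m + ε) x := by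
  have two : ∀ u v a b : ℝ, 0 < u ^ 2 + v ^ 2 → u ^ 2 + v ^ 2 ≤ u * a + v * b →
      f !₂[u, v, 1] ≤ f !₂[a, b, 1] + 2 * m := by
    intro u v a b hr hab
    set r := u ^ 2 + v ^ 2 with hrdef
    set X := (u * a + v * b) / r with hX
    set Y := (u * b - v * a) / r with hY
    have hX1 : 1 ≤ X := by rwa [hX, le_div_iff₀ hr, one_mul]
    have hD : 0 ≤ Y ^ 2 - 4 * (1 - X) := by nlinarith [sq_nonneg Y]
    set q := Real.sqrt (Y ^ 2 - 4 * (1 - X)) with hq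
    have hq2 : q ^ 2 = Y ^ 2 - 4 * (1 - X) := Real.sq_sqrt hD
    have h1 := hd u v ((Y + q) / 2)
    have h2 := hd (u - (Y + q) / 2 * v) (v + (Y + q) / 2 * u) ((Y - q) / 2)
    have hXr : X * r = u * a + v * b := by rw [hX]; field_simp
    have hYr : Y * r = u * b - v * a := by rw [hY]; field_simp
    have ea : u - (Y + q) / 2 * v - (Y - q) / 2 * (v + (Y + q) / 2 * u) = a := by
      have : u * X - v * Y = a := by
        apply mul_right_cancel₀ hr.ne'
        linear_combination u * hXr - v * hYr - a * hrdef
      linear_combination this + u / 4 * hq2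
    have eb : v + (Y + q) / 2 * u + (Y - q) / 2 * (u - (Y + q) / 2 * v) = b := by
      have : v * X + u * Y = b := by
        apply mul_right_cancel₀ hr.ne'
        linear_combination v * hXr + u * hYr - b * hrdef
      linear_combination this + v / 4 * hq2
    rw [ea, eb] at h2
    linarith
  let S : Set ℝ := {y | ∃ a b : ℝ, 0 < a ^ 2 + b ^ 2 ∧ f !₂[a, b, 1] = y}
  have hSne : S.Nonempty := ⟨_, 1, 0, by norm_num, rfl⟩
  have hSb : BddBelow S := ⟨0, by rintro y ⟨a, b, -, rfl⟩; exact h0 _⟩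
  obtain ⟨_, ⟨a, b, hab, rfl⟩, hlt⟩ := exists_lt_of_csInf_lt hSne (lt_add_of_pos_right (sInf S) hε)
  have hxp : ∀ x : R3, 0 < x 2 → f x = f !₂[x 0 / x 2, x 1 / x 2, 1] := by
    intro x hx
    rw [← hf.smul (x 2)⁻¹ (by positivity) x]
    congr 1
    ext i; fin_cases i <;> simp [div_eq_inv_mul, hx.ne']
  let U : Set R3 := {x | 0 < x 2} ∩ {x | x 0 ^ 2 + x 1 ^ 2 < (x 0 * a + x 1 * b) * x 2}
  have hUo : IsOpen U :=
    (isOpen_lt (by fun_prop) (by fun_prop)).inter (isOpen_lt (by fun_prop) (by fun_prop))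
  have hU : ∀ x ∈ U, sInf S ≤ f x ∧ f x ≤ sInf S + ε + 2 * m := by
    rintro x ⟨hx2, hx⟩
    simp only [Set.mem_ofPred_eq] at hx2 hx
    have hpos : 0 < x 0 ^ 2 + x 1 ^ 2 := by
      rcases (by positivity : 0 ≤ x 0 ^ 2 + x 1 ^ 2).lt_or_eq with h | h
      · exact h
      · have e0 : x 0 = 0 := by nlinarith [sq_nonneg (x 0), sq_nonneg (x 1)]
        have e1 : x 1 = 0 := by nlinarith [sq_nonneg (x 0), sq_nonneg (x 1)]
        simp [e0, e1] at hx
    have hp : 0 < (x 0 / x 2) ^ 2 + (x 1 / x 2) ^ 2 := by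
      rw [div_pow, div_pow, ← add_div]; positivity
    rw [hxp x hx2]
    refine ⟨csInf_le hSb ⟨_, _, hp, rfl⟩, ?_⟩
    have := two (x 0 / x 2) (x 1 / x 2) a b hp (by
      rw [div_pow, div_pow, ← add_div, div_le_iff₀ (by positivity)]
      refine hx.le.trans (le_of_eq ?_)
      field_simp)
    linarith
  refine ⟨!₂[a / 2, b / 2, 1], R3.ne_zero_of_apply 2 (by simp), U, hUo.mem_nhds ?_, ?_⟩
  · simp [U]; nlinarith
  · intro y hy z hz
    have h1 := hU y hy
    have h2 := hU z hz
    rw [abs_le]; constructor <;> linarith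

lemma oscLE_pole {ε : ℝ} (hf : IsRealFrame f w) (h0 : ∀ x, 0 ≤ f x) (hε : 0 < ε)
    (hp : f !₂[0, 0, 1] ≤ ε) : OscLE f (22 * ε) !₂[0, 0, 1] := by
  set p : R3 := !₂[0, 0, 1] with hpdef
  have hp0 : p ≠ 0 := R3.ne_zero_of_apply 2 (by simp [hpdef])
  set g : R3 → ℝ := fun x => f x + f (R3.rot (Real.pi / 2) x) with hg
  have hgf : IsRealFrame g (w + w) := hf.add (hf.comp _)
  have hg0 : ∀ x, 0 ≤ g x := fun x => add_nonneg (h0 _) (h0 _)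
  have hgp : g p = 2 * f p := by
    simp only [hg, R3.rot_pi_div_two, hpdef]; simp; ring
  have hge : ∀ a b : ℝ, 0 < a ^ 2 + b ^ 2 → g !₂[a, b, 0] = w - f p := by
    intro a b hab
    have ha := R3.ne_zero_of_sq_add_sq 0 hab
    have := hf.sum !₂[a, b, 0] (R3.rot (Real.pi / 2) !₂[a, b, 0]) p ha (by simpa using ha) hp0
      (by simp [R3.rot_pi_div_two, R3.inner_eq]; ring) (by simp [hpdef, R3.inner_eq])
      (by simp [R3.rot_pi_div_two, hpdef, R3.inner_eq])
    simp only [hg]; linarith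
  obtain ⟨x, hx, hox⟩ := hgf.oscLE_of_descent hg0 hε (hgf.le_add_of_descent hg0 hge)
  obtain ⟨U, hU, hUosc⟩ := hgf.oscLE_of_oscLE hx hp0 hox
  have hle : ∀ y ∈ U, f y ≤ 22 * ε := by
    intro y hy
    have h1 := hUosc y hy p (mem_of_mem_nhds hU)
    rw [abs_le] at h1
    have h2 := h0 (R3.rot (Real.pi / 2) y)
    have h3 : g y = f y + f (R3.rot (Real.pi / 2) y) := rfl
    rw [← hpdef, hgp] at h1
    linarith [h1.2]
  refine ⟨U, hU, fun y hy z hz => ?_⟩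
  have := hle y hy
  have := hle z hz
  have := h0 y
  have := h0 z
  rw [abs_le]; constructor <;> linarith

end IsRealFrame

lemma R3.exists_isometry {p : R3} (hp : ‖p‖ = 1) : ∃ e : R3 ≃ₗᵢ[ℝ] R3, e !₂[0, 0, 1] = p := by
  have hon : Orthonormal ℝ (({2} : Set (Fin 3)).domRestrict fun _ => p) := by
    constructor
    · intro i; exact hp
    · rintro ⟨i, hi⟩ ⟨j, hj⟩ hij
      simp only [Set.mem_singleton_iff] at hi hj
      subst hi; subst hj; exact absurd rfl hij
  obtain ⟨b, hb⟩ := hon.exists_orthonormalBasis_extension_of_card_eq (by simp)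
  refine ⟨b.repr.symm, ?_⟩
  have : (!₂[0, 0, 1] : R3) = EuclideanSpace.single 2 1 := by
    ext i; fin_cases i <;> simp
  rw [this, OrthonormalBasis.repr_symm_single, hb 2 rfl]

namespace IsRealFrame

variable {f : R3 → ℝ} {w : ℝ}

lemma continuousAt (hf : IsRealFrame f w) (h0 : ∀ x, 0 ≤ f x) {x : R3} (hx : x ≠ 0) :
    ContinuousAt f x := by
  rw [Metric.continuousAt_iff']
  intro ε hε
  set S : Set ℝ := f '' {x | x ≠ 0} with hS
  have hSne : S.Nonempty := ⟨_, x, hx, rfl⟩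
  have hSb : BddBelow S := ⟨0, by rintro _ ⟨y, -, rfl⟩; exact h0 _⟩
  obtain ⟨_, ⟨q, hq : q ≠ 0, rfl⟩, hqlt⟩ := exists_lt_of_csInf_lt hSne
    (lt_add_of_pos_right (sInf S) (by positivity : 0 < ε / 100))
  obtain ⟨e, he⟩ := R3.exists_isometry (p := ‖q‖⁻¹ • q) (by simp [norm_smul, hq])
  have hle : ∀ y, y ≠ 0 → sInf S ≤ f y := fun y hy => csInf_le hSb ⟨y, hy, rfl⟩
  let g : R3 → ℝ := fun y => max (f y - sInf S) 0
  have hgy : ∀ y, y ≠ 0 → g y = f y - sInf S := fun y hy =>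
    max_eq_left (by linarith [hle y hy])
  have hg : IsRealFrame g (w - 3 * sInf S) :=
    { smul := fun c hc y => by simp [g, hf.smul c hc]
      sum := fun a b c ha hb hc hab hac hbc => by
        rw [hgy a ha, hgy b hb, hgy c hc]
        linarith [hf.sum a b c ha hb hc hab hac hbc] }
  have hosc := (hg.comp e).oscLE_pole (ε := ε / 100) (fun _ => le_max_right _ _) (by positivity)
    (by
      rw [he, hg.smul _ (by simpa using hq), hgy q hq]; linarith)
  have hosc2 := (hg.comp e).oscLE_of_oscLE (y := e.symm x) (R3.ne_zero_of_apply 2 (by simp))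
    (by simpa using hx) hosc
  obtain ⟨U, hU, hUosc⟩ := hosc2
  have hpre : ∀ᶠ y in 𝓝 x, e.symm y ∈ U :=
    e.symm.continuous.continuousAt.eventually hU
  filter_upwards [hpre, eventually_ne_nhds hx] with y hy hy0
  have := hUosc _ hy _ (mem_of_mem_nhds hU)
  simp only [LinearIsometryEquiv.apply_symm_apply, hgy y hy0, hgy x hx, sub_sub_sub_cancel_right]
    at this
  rw [Real.dist_eq]
  linarith

end IsRealFrame

lemma eq_zero_of_additive_of_bounded {d : ℝ → ℝ} {B : ℝ} (hB : ∀ t ∈ Set.Icc (0 : ℝ) 1, |d t| ≤ B)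
    (hadd : ∀ a b : ℝ, 0 ≤ a → 0 ≤ b → a + b ≤ 1 → d (a + b) = d a + d b) (h1 : d 1 = 0)
    {t : ℝ} (ht : t ∈ Set.Icc (0 : ℝ) 1) : d t = 0 := by
  have key : ∀ n : ℕ, ∀ t ∈ Set.Icc (0 : ℝ) 1, |d t| ≤ B * (1 / 2) ^ n := by
    intro n
    induction n with
    | zero => simpa using hB
    | succ n ih =>
      have half : ∀ t : ℝ, 0 ≤ t → t ≤ 1 / 2 → |d t| ≤ B * (1 / 2) ^ (n + 1) := by
        intro t ht0 ht1
        have h2 := hadd t t ht0 ht0 (by linarith)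
        have h3 := ih (t + t) ⟨by linarith, by linarith⟩
        rw [h2, ← two_mul, abs_mul, abs_two] at h3
        rw [pow_succ]; linarith
      rintro t ⟨ht0, ht1⟩
      rcases le_total t (1 / 2) with h | h
      · exact half t ht0 h
      · have h2 := hadd t (1 - t) ht0 (by linarith) (by linarith)
        rw [add_sub_cancel, h1] at h2
        rw [show d t = - d (1 - t) by linarith, abs_neg]
        exact half _ (by linarith) (by linarith)
  have hlim : Tendsto (fun n : ℕ => B * (1 / 2 : ℝ) ^ n) atTop (𝓝 0) := by
    simpa using (tendsto_pow_atTop_nhds_zero_of_lt_one (by norm_num : (0 : ℝ) ≤ 1 / 2)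
      (by norm_num)).const_mul B
  have := ge_of_tendsto' hlim (fun n => key n t ht)
  exact abs_nonpos_iff.1 this

namespace IsRealFrame

variable {f : R3 → ℝ} {w : ℝ}

lemma le_weight (hf : IsRealFrame f w) (h0 : ∀ x, 0 ≤ f x) {x : R3} (hx : x ≠ 0) : f x ≤ w := by
  obtain ⟨n, hn, hnx, -⟩ := R3.exists_perp x x
  obtain ⟨m, hm, hmx, hmn⟩ := R3.exists_perp x n
  have := hf.sum x n m hx hn hm (by rw [real_inner_comm]; exact hnx)
    (by rw [real_inner_comm]; exact hmx) (by rw [real_inner_comm]; exact hmn)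
  linarith [h0 n, h0 m]

lemma normSq_mul_le (hf : IsRealFrame f w) (h0 : ∀ x, 0 ≤ f x) (x : R3) :
    ‖x‖ ^ 2 * f x ≤ w * ‖x‖ ^ 2 := by
  by_cases hx : x = 0
  · simp [hx]
  · have := hf.le_weight h0 hx
    nlinarith [sq_nonneg ‖x‖]

lemma continuous_normSq_mul (hf : IsRealFrame f w) (h0 : ∀ x, 0 ≤ f x) :
    Continuous fun x => ‖x‖ ^ 2 * f x := by
  rw [continuous_iff_continuousAt]
  intro x
  by_cases hx : x = 0
  · subst hx
    unfold ContinuousAt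
    have h1 : Tendsto (fun x : R3 => w * ‖x‖ ^ 2) (𝓝 0) (𝓝 0) := by
      have : Continuous fun x : R3 => w * ‖x‖ ^ 2 := by fun_prop
      simpa using this.tendsto 0
    have := tendsto_of_tendsto_of_tendsto_of_le_of_le tendsto_const_nhds h1
      (fun x => mul_nonneg (sq_nonneg ‖x‖) (h0 x)) (hf.normSq_mul_le h0)
    simpa using this
  · exact ContinuousAt.mul (by fun_prop) (hf.continuousAt h0 hx)

lemma normSq_mul_smul (hf : IsRealFrame f w) (c : ℝ) (x : R3) :
    ‖c • x‖ ^ 2 * f (c • x) = c ^ 2 * (‖x‖ ^ 2 * f x) := by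
  by_cases hc : c = 0
  · simp [hc]
  · rw [hf.smul c hc, norm_smul, mul_pow, Real.norm_eq_abs, sq_abs, mul_assoc]

lemma normSq_mul_sum (hf : IsRealFrame f w) {a b c : R3} (ha : ‖a‖ = 1) (hb : ‖b‖ = 1)
    (hc : ‖c‖ = 1) (hab : ⟪a, b⟫_ℝ = 0) (hac : ⟪a, c⟫_ℝ = 0) (hbc : ⟪b, c⟫_ℝ = 0) :
    ‖a‖ ^ 2 * f a + ‖b‖ ^ 2 * f b + ‖c‖ ^ 2 * f c = w := by
  have := hf.sum a b c (norm_ne_zero_iff.1 (by simp [ha])) (norm_ne_zero_iff.1 (by simp [hb]))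
    (norm_ne_zero_iff.1 (by simp [hc])) hab hac hbc
  simpa [ha, hb, hc] using this

end IsRealFrame

lemma R3.rot_rot (θ φ : ℝ) (x : R3) : R3.rot θ (R3.rot φ x) = R3.rot (θ + φ) x := by
  ext i; fin_cases i <;> simp [R3.rot_apply, Real.cos_add, Real.sin_add] <;> ring

lemma R3.continuous_rot : Continuous fun z : ℝ × R3 => R3.rot z.1 z.2 := by
  simp only [R3.rot_apply]
  fun_prop

lemma R3.normSq_eq (x : R3) : ‖x‖ ^ 2 = x 0 ^ 2 + x 1 ^ 2 + x 2 ^ 2 := by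
  simp [EuclideanSpace.norm_sq_eq, Fin.sum_univ_three]

/-- The integral of `f` over the rotations about the third axis. -/
noncomputable def rotAverage (F : R3 → ℝ) (x : R3) : ℝ :=
  ∫ θ in (0 : ℝ)..(2 * Real.pi), F (R3.rot θ x)

lemma rotAverage_rot (F : R3 → ℝ) (φ : ℝ) (x : R3) :
    rotAverage F (R3.rot φ x) = rotAverage F x := by
  have hp : Function.Periodic (fun θ => F (R3.rot θ x)) (2 * Real.pi) := by
    intro θ; simp [R3.rot_apply]
  simp only [rotAverage, R3.rot_rot]
  rw [intervalIntegral.integral_comp_add_right (fun θ => F (R3.rot θ x))]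
  have := hp.intervalIntegral_add_eq φ 0
  rw [zero_add, add_comm] 
  simpa [add_comm] using this

lemma rotAverage_smul {F : R3 → ℝ} (hF : ∀ (c : ℝ) x, F (c • x) = c ^ 2 * F x) (c : ℝ) (x : R3) :
    rotAverage F (c • x) = c ^ 2 * rotAverage F x := by
  simp [rotAverage, hF]

/-- On the unit sphere, the average over rotations depends only on the squared height. -/
lemma rotAverage_eq_of_norm_eq_one {F : R3 → ℝ} (hF : ∀ (c : ℝ) x, F (c • x) = c ^ 2 * F x)
    {x : R3} (hx : ‖x‖ = 1) :
    rotAverage F x = rotAverage F !₂[√(1 - x 2 ^ 2), 0, √(x 2 ^ 2)] := by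
  have hsq : x 0 ^ 2 + x 1 ^ 2 = 1 - x 2 ^ 2 := by
    have := R3.normSq_eq x
    rw [hx] at this; linarith
  set z : ℂ := ⟨x 0, x 1⟩ with hz
  have hzn : ‖z‖ = √(1 - x 2 ^ 2) := by
    rw [Complex.norm_eq_sqrt_sq_add_sq, hz, hsq]
  have hxe : x = R3.rot z.arg !₂[√(1 - x 2 ^ 2), 0, x 2] := by
    have h0 := Complex.norm_mul_cos_arg z
    have h1 := Complex.norm_mul_sin_arg z
    rw [hzn] at h0 h1
    rw [R3.rot_apply]
    ext i; fin_cases i <;> simp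
    · rw [mul_comm, h0]
    · rw [mul_comm, h1]
  rw [hxe, rotAverage_rot, ← hxe, Real.sqrt_sq_eq_abs]
  rcases le_total 0 (x 2) with h | h
  · rw [abs_of_nonneg h]
  · have : (!₂[√(1 - x 2 ^ 2), 0, x 2] : R3) =
        (-1 : ℝ) • R3.rot Real.pi !₂[√(1 - x 2 ^ 2), 0, |x 2|] := by
      rw [R3.rot_apply, abs_of_nonpos h]
      ext i; fin_cases i <;> simp
    rw [this, rotAverage_smul hF, rotAverage_rot]; norm_num

namespace IsRealFrame

variable {f : R3 → ℝ} {w : ℝ}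

lemma rotAverage_eq (hf : IsRealFrame f w) (h0 : ∀ x, 0 ≤ f x) (x : R3) :
    rotAverage (fun x => ‖x‖ ^ 2 * f x) x = 2 * Real.pi *
      (w / 3 * ‖x‖ ^ 2 + (f !₂[0, 0, 1] - w / 3) / 2 * (3 * x 2 ^ 2 - ‖x‖ ^ 2)) := by
  set F : R3 → ℝ := fun x => ‖x‖ ^ 2 * f x with hF
  have hFs : ∀ (c : ℝ) x, F (c • x) = c ^ 2 * F x := hf.normSq_mul_smul
  have hFc : Continuous F := hf.continuous_normSq_mul h0
  have hintegrable : ∀ y, IntervalIntegrable (fun θ => F (R3.rot θ y)) MeasureTheory.volume 0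
      (2 * Real.pi) := fun y =>
    (hFc.comp (R3.continuous_rot.comp (by fun_prop : Continuous fun θ : ℝ => (θ, y)))
      ).intervalIntegrable _ _
  have hframe : ∀ a b c : R3, ‖a‖ = 1 → ‖b‖ = 1 → ‖c‖ = 1 → ⟪a, b⟫_ℝ = 0 → ⟪a, c⟫_ℝ = 0 →
      ⟪b, c⟫_ℝ = 0 → rotAverage F a + rotAverage F b + rotAverage F c = 2 * Real.pi * w := by
    intro a b c ha hb hc hab hac hbc
    simp only [rotAverage]
    rw [← intervalIntegral.integral_add (hintegrable a) (hintegrable b),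
      ← intervalIntegral.integral_add ((hintegrable a).add (hintegrable b)) (hintegrable c)]
    rw [intervalIntegral.integral_congr (g := fun _ => w)]
    · simp
    · intro θ _
      exact hf.normSq_mul_sum (by simpa) (by simpa) (by simpa) (by simpa) (by simpa) (by simpa)
  set h : ℝ → ℝ := fun t => rotAverage F !₂[√(1 - t), 0, √t] with hh
  have hunit : ∀ x : R3, ‖x‖ = 1 → rotAverage F x = h (x 2 ^ 2) := fun x hx =>
    rotAverage_eq_of_norm_eq_one hFs hx
  have hsum : ∀ a b c : ℝ, 0 ≤ a → 0 ≤ b → 0 ≤ c → a + b + c = 1 →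
      h a + h b + h c = 2 * Real.pi * w := by
    intro a b c ha hb hc habc
    obtain ⟨e, he⟩ := R3.exists_isometry (p := !₂[√a, √b, √c]) (by
      rw [← sq_eq_sq₀ (norm_nonneg _) zero_le_one, R3.normSq_eq]
      simp [Real.sq_sqrt, *])
    have hcoord : ∀ v : R3, (e.symm v) 2 = ⟪(!₂[√a, √b, √c] : R3), v⟫_ℝ := by
      intro v
      rw [← he, ← e.apply_symm_apply v, e.inner_map_map, e.apply_symm_apply]
      simp [R3.inner_eq]
    have n0 : ‖(!₂[1, 0, 0] : R3)‖ = 1 := by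
      rw [← sq_eq_sq₀ (norm_nonneg _) zero_le_one, R3.normSq_eq]; simp
    have n1 : ‖(!₂[0, 1, 0] : R3)‖ = 1 := by
      rw [← sq_eq_sq₀ (norm_nonneg _) zero_le_one, R3.normSq_eq]; simp
    have n2 : ‖(!₂[0, 0, 1] : R3)‖ = 1 := by
      rw [← sq_eq_sq₀ (norm_nonneg _) zero_le_one, R3.normSq_eq]; simp
    have key := hframe (e.symm !₂[1, 0, 0]) (e.symm !₂[0, 1, 0]) (e.symm !₂[0, 0, 1])
      (by simpa) (by simpa) (by simpa) (by simp [R3.inner_eq]) (by simp [R3.inner_eq])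
      (by simp [R3.inner_eq])
    rw [hunit _ (by simpa), hunit _ (by simpa), hunit _ (by simpa), hcoord, hcoord, hcoord] at key
    simpa [R3.inner_eq, Real.sq_sqrt, ha, hb, hc] using key
  have hbound : ∀ t ∈ Set.Icc (0 : ℝ) 1, |h t| ≤ 2 * Real.pi * w := by
    intro t ht
    have hpos : ∀ t, 0 ≤ h t := fun t =>
      intervalIntegral.integral_nonneg (by positivity)
        (fun θ _ => mul_nonneg (sq_nonneg _) (h0 _))
    rw [abs_of_nonneg (hpos t)]
    have := hsum t 0 (1 - t) ht.1 le_rfl (by linarith [ht.2]) (by ring)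
    linarith [hpos 0, hpos (1 - t)]
  have h1 : h 1 = 2 * Real.pi * f !₂[0, 0, 1] := by
    have : ∀ θ, R3.rot θ !₂[0, 0, 1] = !₂[0, 0, 1] := by
      intro θ; simp [R3.rot_apply]
    simp only [hh, rotAverage, sub_self, Real.sqrt_zero, Real.sqrt_one, this]
    simp [hF, R3.normSq_eq]
  have h10 := hsum 1 0 0 zero_le_one le_rfl le_rfl (by ring)
  have hlin : ∀ t ∈ Set.Icc (0 : ℝ) 1, h t - h 0 - t * (h 1 - h 0) = 0 := by
    intro t ht
    refine eq_zero_of_additive_of_bounded (d := fun t => h t - h 0 - t * (h 1 - h 0))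
      (B := 2 * Real.pi * w + |h 0| + |h 1 - h 0|) ?_ ?_ (by ring) ht
    · intro t ht
      refine (abs_sub _ _).trans (add_le_add ((abs_sub _ _).trans ?_) ?_)
      · linarith [hbound t ht]
      · rw [abs_mul, abs_of_nonneg ht.1]
        exact mul_le_of_le_one_left (abs_nonneg _) ht.2
    · intro a b ha hb hab
      have e1 := hsum a b (1 - (a + b)) ha hb (by linarith) (by ring)
      have e2 := hsum (a + b) 0 (1 - (a + b)) (by linarith) le_rfl (by linarith) (by ring)
      linear_combination e2 - e1
  have hone : ∀ x : R3, ‖x‖ = 1 → rotAverage F x = 2 * Real.pi *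
      (w / 3 + (f !₂[0, 0, 1] - w / 3) / 2 * (3 * x 2 ^ 2 - 1)) := by
    intro x hx
    have hx2 := R3.normSq_eq x
    rw [hx] at hx2
    have := hlin (x 2 ^ 2) ⟨by positivity, by nlinarith [sq_nonneg (x 0), sq_nonneg (x 1)]⟩
    rw [hunit x hx]
    linear_combination this + (1 / 2 - x 2 ^ 2 / 2) * h10 + (3 / 2 * x 2 ^ 2 - 1 / 2) * h1
  by_cases hx : x = 0
  · subst hx
    simp [rotAverage, hF]
  · have hxn : ‖x‖ ≠ 0 := norm_ne_zero_iff.2 hx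
    have e : x = ‖x‖ • (‖x‖⁻¹ • x) := by rw [smul_smul, mul_inv_cancel₀ hxn, one_smul]
    rw [e, rotAverage_smul hFs, hone _ (by simp [norm_smul, hx]), ← e]
    simp
    field_simp

end IsRealFrame

open MeasureTheory in
lemma R3.setIntegral_closedBall_comp (e : R3 ≃ₗᵢ[ℝ] R3) (φ : R3 → ℝ) :
    ∫ x in Metric.closedBall (0 : R3) 1, φ (e x) = ∫ x in Metric.closedBall (0 : R3) 1, φ x := by
  have := e.measurePreserving.setIntegral_preimage_emb
    e.toHomeomorph.measurableEmbedding φ (Metric.closedBall (0 : R3) 1)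
  rwa [LinearIsometryEquiv.preimage_closedBall, map_zero] at this

/-- The zonal kernel, proportional to the second Legendre polynomial of the angle. -/
noncomputable def zonal (p x : R3) : ℝ := 3 * ⟪p, x⟫_ℝ ^ 2 - ‖p‖ ^ 2 * ‖x‖ ^ 2

lemma zonal_map (e : R3 ≃ₗᵢ[ℝ] R3) (p x : R3) : zonal (e p) (e x) = zonal p x := by
  simp [zonal]

lemma continuous_zonal (p : R3) : Continuous (zonal p) := by
  unfold zonal; fun_prop

open MeasureTheory in
lemma setIntegral_zonal_sq_pos :
    0 < ∫ x in Metric.closedBall (0 : R3) 1, zonal !₂[0, 0, 1] x ^ 2 := by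
  have hc : Continuous fun x => zonal !₂[0, 0, 1] x ^ 2 := (continuous_zonal _).pow 2
  rw [setIntegral_pos_iff_support_of_nonneg_ae (ae_of_all _ fun x => sq_nonneg _)
    (hc.continuousOn.integrableOn_compact (isCompact_closedBall _ _))]
  have hsub : (Function.support fun x => zonal !₂[0, 0, 1] x ^ 2) ∩ Metric.ball 0 1 ⊆
      (Function.support fun x => zonal !₂[0, 0, 1] x ^ 2) ∩ Metric.closedBall 0 1 :=
    Set.inter_subset_inter_right _ Metric.ball_subset_closedBall
  refine lt_of_lt_of_le (IsOpen.measure_pos _ (hc.isOpen_support.inter Metric.isOpen_ball) ?_)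
    (measure_mono hsub)
  refine ⟨!₂[0, 0, 1 / 2], ?_, ?_⟩
  · simp [zonal, R3.inner_eq, R3.normSq_eq]; norm_num
  · rw [mem_ball_zero_iff, ← sq_lt_sq₀ (norm_nonneg _) zero_le_one, R3.normSq_eq]
    simp; norm_num

namespace IsRealFrame

variable {f : R3 → ℝ} {w : ℝ}

open MeasureTheory in
lemma setIntegral_zonal_pole (hf : IsRealFrame f w) (h0 : ∀ x, 0 ≤ f x) :
    ∫ x in Metric.closedBall (0 : R3) 1, zonal !₂[0, 0, 1] x * (‖x‖ ^ 2 * f x) =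
      w / 3 * (∫ x in Metric.closedBall (0 : R3) 1, zonal !₂[0, 0, 1] x * ‖x‖ ^ 2) +
      (f !₂[0, 0, 1] - w / 3) / 2 *
        ∫ x in Metric.closedBall (0 : R3) 1, zonal !₂[0, 0, 1] x ^ 2 := by
  set p : R3 := !₂[0, 0, 1] with hp
  set F : R3 → ℝ := fun x => ‖x‖ ^ 2 * f x with hF
  have hFc : Continuous F := hf.continuous_normSq_mul h0
  have hrot : ∀ θ, R3.rot θ p = p := by intro θ; simp [R3.rot_apply, hp]
  have hinv : ∀ θ, ∫ x in Metric.closedBall (0 : R3) 1, zonal p x * F (R3.rot θ x) =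
      ∫ x in Metric.closedBall (0 : R3) 1, zonal p x * F x := by
    intro θ
    rw [← R3.setIntegral_closedBall_comp (R3.rot θ) (fun x => zonal p x * F x)]
    refine setIntegral_congr_fun measurableSet_closedBall fun x _ => ?_
    have := zonal_map (R3.rot θ) p x
    rw [hrot] at this
    simp only [this]
  have hswap : ∫ θ in (0 : ℝ)..(2 * Real.pi), ∫ x in Metric.closedBall (0 : R3) 1,
        zonal p x * F (R3.rot θ x) =
      ∫ x in Metric.closedBall (0 : R3) 1, ∫ θ in (0 : ℝ)..(2 * Real.pi),
        zonal p x * F (R3.rot θ x) := by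
    simp only [intervalIntegral.integral_of_le (by positivity : (0 : ℝ) ≤ 2 * Real.pi)]
    refine integral_integral_swap ?_
    rw [Measure.prod_restrict]
    have hcont : Continuous (Function.uncurry fun (θ : ℝ) (x : R3) =>
        zonal p x * F (R3.rot θ x)) :=
      ((continuous_zonal p).comp continuous_snd).mul (hFc.comp R3.continuous_rot)
    exact (hcont.continuousOn.integrableOn_compact
      (isCompact_Icc.prod (isCompact_closedBall _ _))).mono_set
        (Set.prod_mono Set.Ioc_subset_Icc_self subset_rfl)
  have hz : ∀ x, zonal p x = 3 * x 2 ^ 2 - ‖x‖ ^ 2 := by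
    intro x; simp [zonal, hp, R3.inner_eq, R3.normSq_eq]
  have hinner : ∀ x, ∫ θ in (0 : ℝ)..(2 * Real.pi), zonal p x * F (R3.rot θ x) =
      2 * Real.pi * (w / 3 * (zonal p x * ‖x‖ ^ 2) + (f p - w / 3) / 2 * zonal p x ^ 2) := by
    intro x
    rw [intervalIntegral.integral_const_mul]
    have := hf.rotAverage_eq h0 x
    rw [rotAverage, ← hz] at this
    rw [this]; ring
  simp only [hinv, hinner] at hswap
  rw [intervalIntegral.integral_const, integral_const_mul, sub_zero, smul_eq_mul] at hswap
  have h2pi : (2 * Real.pi) ≠ 0 := by positivity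
  rw [mul_right_injective₀ h2pi hswap, integral_add, integral_const_mul, integral_const_mul]
  · have : Continuous fun x => w / 3 * (zonal p x * ‖x‖ ^ 2) :=
      continuous_const.mul ((continuous_zonal p).mul (by fun_prop))
    exact this.continuousOn.integrableOn_compact (isCompact_closedBall _ _)
  · have : Continuous fun x => (f p - w / 3) / 2 * zonal p x ^ 2 :=
      continuous_const.mul ((continuous_zonal p).pow 2)
    exact this.continuousOn.integrableOn_compact (isCompact_closedBall _ _)

/-- A nonnegative frame function on three-space is, up to a multiple of the squared norm, its
own integral against the zonal kernel. -/
lemma exists_eq_setIntegral_zonal (hf : IsRealFrame f w) (h0 : ∀ x, 0 ≤ f x) :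
    ∃ α β : ℝ, ∀ p : R3, ‖p‖ ^ 2 * f p = α *
      (∫ x in Metric.closedBall (0 : R3) 1, zonal p x * (‖x‖ ^ 2 * f x)) + β * ‖p‖ ^ 2 := by
  set A := ∫ x in Metric.closedBall (0 : R3) 1, zonal !₂[0, 0, 1] x ^ 2 with hA
  set B := ∫ x in Metric.closedBall (0 : R3) 1, zonal !₂[0, 0, 1] x * ‖x‖ ^ 2 with hB
  have hApos : 0 < A := setIntegral_zonal_sq_pos
  refine ⟨2 / A, w / 3 - 2 / A * (w / 3 * B), fun p => ?_⟩
  have hone : ∀ q : R3, ‖q‖ = 1 → f q = 2 / A *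
      (∫ x in Metric.closedBall (0 : R3) 1, zonal q x * (‖x‖ ^ 2 * f x)) +
      (w / 3 - 2 / A * (w / 3 * B)) := by
    intro q hq
    obtain ⟨e, rfl⟩ := R3.exists_isometry hq
    have h := (hf.comp e).setIntegral_zonal_pole (fun _ => h0 _)
    rw [← R3.setIntegral_closedBall_comp e]
    simp only [zonal_map, LinearIsometryEquiv.norm_map]
    rw [h, ← hA, ← hB]
    field_simp
    ring
  by_cases hp : p = 0
  · simp [hp, zonal]
  · have hpn : ‖p‖ ≠ 0 := norm_ne_zero_iff.2 hp
    have h := hone (‖p‖⁻¹ • p) (by simp [norm_smul, hp])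
    rw [hf.smul _ (inv_ne_zero hpn)] at h
    have hz : ∀ x, zonal (‖p‖⁻¹ • p) x * (‖x‖ ^ 2 * f x) =
        (‖p‖ ^ 2)⁻¹ * (zonal p x * (‖x‖ ^ 2 * f x)) := by
      intro x
      simp only [zonal, inner_smul_left, norm_smul, norm_inv, norm_norm, mul_pow]
      simp
      field_simp
    simp only [hz] at h
    rw [MeasureTheory.integral_const_mul] at h
    rw [h]
    field_simp

/-- A nonnegative frame function on three-space is a quadratic form. -/
theorem normSq_mul_combination (hf : IsRealFrame f w) (h0 : ∀ x, 0 ≤ f x) (a b : R3) (r s : ℝ) :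
    ‖r • a + s • b‖ ^ 2 * f (r • a + s • b) =
      r ^ 2 * (‖a‖ ^ 2 * f a) + s ^ 2 * (‖b‖ ^ 2 * f b) +
        r * s * (‖a + b‖ ^ 2 * f (a + b) - ‖a‖ ^ 2 * f a - ‖b‖ ^ 2 * f b) := by
  obtain ⟨α, β, h⟩ := hf.exists_eq_setIntegral_zonal h0
  have hintegrable : ∀ p, MeasureTheory.IntegrableOn (fun x => zonal p x * (‖x‖ ^ 2 * f x))
      (Metric.closedBall (0 : R3) 1) MeasureTheory.volume := fun p =>
    ((continuous_zonal p).mul (hf.continuous_normSq_mul h0)).continuousOn.integrableOn_compact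
      (isCompact_closedBall _ _)
  have hn : ‖r • a + s • b‖ ^ 2 = r ^ 2 * ‖a‖ ^ 2 + s ^ 2 * ‖b‖ ^ 2 +
      r * s * (‖a + b‖ ^ 2 - ‖a‖ ^ 2 - ‖b‖ ^ 2) := by
    rw [norm_add_sq_real, norm_add_sq_real, norm_smul, norm_smul, inner_smul_left,
      inner_smul_right, mul_pow, mul_pow, Real.norm_eq_abs, Real.norm_eq_abs, sq_abs, sq_abs]
    simp; ring
  have hz : ∀ x, zonal (r • a + s • b) x * (‖x‖ ^ 2 * f x) =
      (r ^ 2 - r * s) * (zonal a x * (‖x‖ ^ 2 * f x)) +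
      (s ^ 2 - r * s) * (zonal b x * (‖x‖ ^ 2 * f x)) +
      r * s * (zonal (a + b) x * (‖x‖ ^ 2 * f x)) := by
    intro x
    simp only [zonal, hn, inner_add_left, inner_smul_left]
    simp; ring
  rw [h (r • a + s • b), h a, h b, h (a + b)]
  simp only [hz]
  rw [MeasureTheory.integral_add, MeasureTheory.integral_add, MeasureTheory.integral_const_mul,
    MeasureTheory.integral_const_mul, MeasureTheory.integral_const_mul, hn]
  · ring
  · exact (hintegrable a).const_mul _
  · exact (hintegrable b).const_mul _
  · exact ((hintegrable a).const_mul _).add ((hintegrable b).const_mul _)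
  · exact (hintegrable (a + b)).const_mul _

end IsRealFrame

section Complex

variable {H : Type*} [NormedAddCommGroup H] [InnerProductSpace ℂ H]

/-- The extension of a function on the unit sphere that is homogeneous of degree two. -/
noncomputable def sqHomExt (f : H → ℝ) (x : H) : ℝ := ‖x‖ ^ 2 * f ((‖x‖⁻¹ : ℂ) • x)

/-- `f` sums to `w` over every orthonormal basis. -/
def IsFrameFunction (f : H → ℝ) (w : ℝ) : Prop :=
  ∀ (ι : Type) (_ : Fintype ι) (b : OrthonormalBasis ι ℂ H), ∑ i, f (b i) = w

lemma Orthonormal.exists_orthonormalBasis_eq [FiniteDimensional ℂ H] {ι : Type*} [Fintype ι]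
    {v : ι → H} (hv : Orthonormal ℂ v) (hcard : Module.finrank ℂ H = Fintype.card ι) :
    ∃ b : OrthonormalBasis ι ℂ H, ⇑b = v := by
  obtain ⟨b, hb⟩ := Orthonormal.exists_orthonormalBasis_extension_of_card_eq (v := v)
    (s := Set.univ) hcard (hv.comp _ Subtype.val_injective)
  exact ⟨b, funext fun i => hb i trivial⟩

namespace IsFrameFunction

variable {f : H → ℝ} {w : ℝ}

lemma sum_eq_sum_of_mem_span [FiniteDimensional ℂ H] (hf : IsFrameFunction f w) {κ : Type}
    [Fintype κ] {a b : κ → H} (ha : Orthonormal ℂ a) (hb : Orthonormal ℂ b)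
    (hab : ∀ i, b i ∈ Submodule.span ℂ (Set.range a)) : ∑ i, f (b i) = ∑ i, f (a i) := by
  obtain ⟨m, hm⟩ := Nat.exists_eq_add_of_le ha.linearIndependent.fintype_card_le_finrank
  have hcard : Module.finrank ℂ H = Fintype.card (κ ⊕ Fin m) := by simp [hm]
  obtain ⟨e, he⟩ := Orthonormal.exists_orthonormalBasis_extension_of_card_eq
    (v := Sum.elim a 0) (s := Set.range Sum.inl) hcard (by
      have := ha.comp (fun x : Set.range (Sum.inl : κ → κ ⊕ Fin m) => x.2.choose) (by
        intro x y hxy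
        ext
        rw [← x.2.choose_spec, ← y.2.choose_spec]
        exact congrArg _ hxy)
      convert this using 1
      ext x
      conv_lhs => rw [Set.domRestrict_apply, ← x.2.choose_spec]
      simp)
  have hea : ∀ i, e (Sum.inl i) = a i := fun i => he _ ⟨i, rfl⟩
  have hperp : ∀ i j, ⟪b i, e (Sum.inr j)⟫_ℂ = 0 := by
    intro i j
    have : Submodule.span ℂ (Set.range a) ≤ (ℂ ∙ e (Sum.inr j))ᗮ := by
      rw [Submodule.span_le]
      rintro _ ⟨k, rfl⟩
      rw [SetLike.mem_coe, Submodule.mem_orthogonal_singleton_iff_inner_left, ← hea]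
      exact e.orthonormal.2 (by simp)
    exact Submodule.mem_orthogonal_singleton_iff_inner_left.1 (this (hab i))
  have horth : Orthonormal ℂ (Sum.elim b fun j => e (Sum.inr j)) := by
    constructor
    · rintro (i | j)
      · exact hb.1 i
      · exact e.orthonormal.1 _
    · rintro (i | i) (j | j) hij
      · exact hb.2 (by simpa using hij)
      · exact hperp i j
      · exact inner_eq_zero_symm.1 (hperp j i)
      · exact e.orthonormal.2 hij
  obtain ⟨e', he'⟩ := horth.exists_orthonormalBasis_eq hcard
  have h1 := hf _ inferInstance e
  have h2 := hf _ inferInstance e'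
  rw [he'] at h2
  simp only [Fintype.sum_sum_type, hea, Sum.elim_inl, Sum.elim_inr] at h1 h2
  linarith

lemma apply_smul [FiniteDimensional ℂ H] (hf : IsFrameFunction f w) {z : ℂ} (hz : ‖z‖ = 1)
    {x : H} (hx : ‖x‖ = 1) : f (z • x) = f x := by
  have key : ∀ y : H, ‖y‖ = 1 → Orthonormal ℂ (fun _ : Unit => y) := fun y hy =>
    ⟨fun _ => hy, fun i j hij => (hij (Subsingleton.elim _ _)).elim⟩
  simpa using hf.sum_eq_sum_of_mem_span (key x hx) (key (z • x) (by simp [norm_smul, hz, hx]))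
    (fun _ => Submodule.smul_mem _ _ (Submodule.subset_span ⟨(), rfl⟩))

lemma sqHomExt_smul [FiniteDimensional ℂ H] (hf : IsFrameFunction f w) (z : ℂ) (x : H) :
    sqHomExt f (z • x) = ‖z‖ ^ 2 * sqHomExt f x := by
  rcases eq_or_ne z 0 with rfl | hz
  · simp [sqHomExt]
  rcases eq_or_ne x 0 with rfl | hx
  · simp [sqHomExt]
  have hz' : (‖z‖ : ℂ) ≠ 0 := by simpa using hz
  have hx' : (‖x‖ : ℂ) ≠ 0 := by simpa using hx
  have : ((‖z • x‖⁻¹ : ℂ)) • z • x = (z * (‖z‖ : ℂ)⁻¹) • ((‖x‖⁻¹ : ℂ) • x) := by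
    rw [smul_smul, smul_smul, norm_smul]
    push_cast
    congr 1
    field_simp
  rw [sqHomExt, sqHomExt, this, hf.apply_smul, norm_smul]
  · ring
  · simp [hz]
  · simp [norm_smul, hx]

lemma isRealFrame [FiniteDimensional ℂ H] (hf : IsFrameFunction f w) {a : Fin 3 → H}
    (ha : Orthonormal ℂ a) :
    IsRealFrame (fun x => f ((‖∑ i, (x i : ℂ) • a i‖⁻¹ : ℂ) • ∑ i, (x i : ℂ) • a i))
      (∑ i, f (a i)) := by
  have hinner : ∀ x y : R3, ⟪∑ i, (x i : ℂ) • a i, ∑ i, (y i : ℂ) • a i⟫_ℂ = (⟪x, y⟫_ℝ : ℂ) := by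
    intro x y
    rw [ha.inner_sum, R3.inner_eq]
    simp [Fin.sum_univ_three]
  have hnorm : ∀ x : R3, ‖∑ i, (x i : ℂ) • a i‖ = ‖x‖ := by
    intro x
    have h := hinner x x
    rw [inner_self_eq_norm_sq_to_K, real_inner_self_eq_norm_sq] at h
    refine (sq_eq_sq₀ (norm_nonneg _) (norm_nonneg _)).1 (Complex.ofReal_injective ?_)
    rw [← h]
    push_cast
    rfl
  constructor
  · intro c hc x
    rcases eq_or_ne x 0 with rfl | hx
    · simp
    have hx' : ‖x‖ ≠ 0 := by simpa using hx
    have h1 : ∑ i, (((c • x) i : ℝ) : ℂ) • a i = (c : ℂ) • ∑ i, (x i : ℂ) • a i := by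
      simp only [Finset.smul_sum, smul_smul, PiLp.smul_apply, smul_eq_mul, Complex.ofReal_mul]
    have h2 : sqHomExt f ((c : ℂ) • ∑ i, (x i : ℂ) • a i) = _ := hf.sqHomExt_smul _ _
    rw [sqHomExt, sqHomExt, norm_smul, hnorm] at h2
    simp only [h1, norm_smul, hnorm]
    have h3 : (‖(c : ℂ)‖ * ‖x‖) ^ 2 ≠ 0 := by simp [hc, hx]
    apply mul_left_cancel₀ h3
    rw [h2]
    ring
  · intro u v x hu hv hx huv hux hvx
    have hb : Orthonormal ℂ
        (fun k => (((‖(![u, v, x] : Fin 3 → R3) k‖ : ℂ))⁻¹ •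
          ∑ i, (((![u, v, x] : Fin 3 → R3) k) i : ℂ) • a i)) := by
      have hne : ∀ k, (![u, v, x] : Fin 3 → R3) k ≠ 0 := by
        intro k; fin_cases k <;> simpa
      have hor : ∀ k l, k ≠ l →
          ⟪(![u, v, x] : Fin 3 → R3) k, (![u, v, x] : Fin 3 → R3) l⟫_ℝ = 0 := by
        intro k l hkl
        fin_cases k <;> fin_cases l <;>
          first
          | exact absurd rfl hkl
          | assumption
          | (rw [real_inner_comm]; assumption)
      refine ⟨fun k => ?_, fun k l hkl => ?_⟩
      · rw [norm_smul, hnorm]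
        simp [hne k]
      · beta_reduce
        rw [inner_smul_left, inner_smul_right, hinner, hor k l hkl]
        simp
    have := hf.sum_eq_sum_of_mem_span ha hb (fun k => Submodule.smul_mem _ _
      (Submodule.sum_mem _ fun i _ => Submodule.smul_mem _ _ (Submodule.subset_span ⟨i, rfl⟩)))
    rw [← this]
    simp only [hnorm]
    rw [Fin.sum_univ_three (fun k => f _)]
    rfl

end IsFrameFunction

variable [FiniteDimensional ℂ H]

lemma exists_orthonormal_fin_three (hH : 3 ≤ Module.finrank ℂ H) {a b : H} (hab : ⟪a, b⟫_ℂ = 0) :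
    ∃ e : Fin 3 → H, Orthonormal ℂ e ∧ a = (‖a‖ : ℂ) • e 0 ∧ b = (‖b‖ : ℂ) • e 1 := by
  obtain ⟨m, hm⟩ := Nat.exists_eq_add_of_le hH
  have hba : ⟪b, a⟫_ℂ = 0 := inner_eq_zero_symm.1 hab
  set v : Fin 3 ⊕ Fin m → H := Sum.elim ![(‖a‖⁻¹ : ℂ) • a, (‖b‖⁻¹ : ℂ) • b, 0] 0 with hv
  obtain ⟨e, he⟩ := Orthonormal.exists_orthonormalBasis_extension_of_card_eq
    (ι := Fin 3 ⊕ Fin m) (𝕜 := ℂ) (v := v) (s := {i | v i ≠ 0}) (by simp [hm]) (by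
      constructor
      · rintro ⟨(i | i), hi⟩
        · fin_cases i
          · have ha : a ≠ 0 := by rintro rfl; simp [v] at hi
            simp [v, norm_smul, ha]
          · have hb : b ≠ 0 := by rintro rfl; simp [v] at hi
            simp [v, norm_smul, hb]
          · simp [v] at hi
        · simp [v] at hi
      · rintro ⟨(i | i), hi⟩ ⟨(j | j), hj⟩ hij
        · fin_cases i <;> fin_cases j <;>
            first
            | exact absurd rfl hij
            | simp [v, inner_smul_left, inner_smul_right, hab, hba]
        · simp [v]
        · simp [v]
        · simp [v])
  refine ⟨fun i => e (Sum.inl i), e.orthonormal.comp _ Sum.inl_injective, ?_, ?_⟩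
  · rcases eq_or_ne a 0 with ha | ha
    · simp [ha]
    · have h := he (Sum.inl 0) (by simp [v, ha])
      simp [h, v, smul_smul, ha]
  · rcases eq_or_ne b 0 with hb | hb
    · simp [hb]
    · have h := he (Sum.inl 1) (by simp [v, hb])
      simp [h, v, smul_smul, hb]

namespace IsFrameFunction

variable {f : H → ℝ} {w : ℝ}

lemma sqHomExt_real_combination (hf : IsFrameFunction f w) (h0 : ∀ x, 0 ≤ f x)
    (hH : 3 ≤ Module.finrank ℂ H) {a b : H} (hab : ⟪a, b⟫_ℂ = 0) (r s : ℝ) :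
    sqHomExt f ((r : ℂ) • a + (s : ℂ) • b) = r ^ 2 * sqHomExt f a + s ^ 2 * sqHomExt f b +
      r * s * (sqHomExt f (a + b) - sqHomExt f a - sqHomExt f b) := by
  obtain ⟨e, he, ha, hb⟩ := exists_orthonormal_fin_three hH hab
  have hframe := hf.isRealFrame he
  have hnorm : ∀ x : R3, ‖∑ i, (x i : ℂ) • e i‖ ^ 2 = ‖x‖ ^ 2 := by
    intro x
    have h := he.inner_sum (fun i => (x i : ℂ)) (fun i => (x i : ℂ)) Finset.univ
    rw [inner_self_eq_norm_sq_to_K] at h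
    apply Complex.ofReal_injective
    rw [R3.normSq_eq]
    convert h using 1
    · simp
    · simp [Fin.sum_univ_three, sq]
  have key := hframe.normSq_mul_combination (fun x => h0 _) (!₂[‖a‖, 0, 0]) (!₂[0, ‖b‖, 0]) r s
  simp only [← hnorm] at key
  have h1 : ∑ i, (((!₂[‖a‖, 0, 0] : R3) i : ℝ) : ℂ) • e i = a := by
    simpa [Fin.sum_univ_three] using ha.symm
  have h2 : ∑ i, (((!₂[0, ‖b‖, 0] : R3) i : ℝ) : ℂ) • e i = b := by
    simpa [Fin.sum_univ_three] using hb.symm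
  have h3 : ∑ i, (((!₂[‖a‖, 0, 0] + !₂[0, ‖b‖, 0] : R3) i : ℝ) : ℂ) • e i = a + b := by
    simp only [PiLp.add_apply, Complex.ofReal_add, add_smul, Finset.sum_add_distrib, h1, h2]
  have h4 : ∑ i, (((r • !₂[‖a‖, 0, 0] + s • !₂[0, ‖b‖, 0] : R3) i : ℝ) : ℂ) • e i =
      (r : ℂ) • a + (s : ℂ) • b := by
    simp only [PiLp.add_apply, PiLp.smul_apply, smul_eq_mul, Complex.ofReal_add,
      Complex.ofReal_mul, add_smul, mul_smul, Finset.sum_add_distrib, ← Finset.smul_sum, h1, h2]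
  simp only [h1, h2, h3, h4] at key
  exact key

lemma exists_sqHomExt_conj_combination (hf : IsFrameFunction f w) (h0 : ∀ x, 0 ≤ f x)
    (hH : 3 ≤ Module.finrank ℂ H) {a b : H} (hab : ⟪a, b⟫_ℂ = 0) (hn : ‖a‖ = ‖b‖) :
    ∃ γ : ℂ, ∀ ζ : ℂ, sqHomExt f (ζ • a + starRingEnd ℂ ζ • b) =
      ‖ζ‖ ^ 2 * (sqHomExt f a + sqHomExt f b) + (γ * starRingEnd ℂ ζ ^ 2).re := by
  have hba : ⟪b, a⟫_ℂ = 0 := inner_eq_zero_symm.1 hab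
  have horth : ⟪a + b, Complex.I • (a - b)⟫_ℂ = 0 := by
    simp [hab, hba, hn]
  have hsub : sqHomExt f (Complex.I • (a - b)) = sqHomExt f a + sqHomExt f b -
      (sqHomExt f (a + b) - sqHomExt f a - sqHomExt f b) := by
    have h := hf.sqHomExt_real_combination h0 hH hab 1 (-1)
    rw [hf.sqHomExt_smul]
    have e : ((1 : ℝ) : ℂ) • a + ((-1 : ℝ) : ℂ) • b = a - b := by
      push_cast
      module
    rw [e] at h
    rw [h, Complex.norm_I]
    ring
  refine ⟨⟨sqHomExt f (a + b) - sqHomExt f a - sqHomExt f b,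
    (sqHomExt f ((a + b) + Complex.I • (a - b)) - sqHomExt f (a + b) -
      sqHomExt f (Complex.I • (a - b))) / 2⟩, fun ζ => ?_⟩
  have h := hf.sqHomExt_real_combination h0 hH horth ζ.re ζ.im
  have e : (ζ.re : ℂ) • (a + b) + (ζ.im : ℂ) • Complex.I • (a - b) =
      ζ • a + starRingEnd ℂ ζ • b := by
    have h1 : ζ • a + starRingEnd ℂ ζ • b = ((ζ.re : ℂ) + ζ.im * Complex.I) • a +
        ((ζ.re : ℂ) - ζ.im * Complex.I) • b := by
      congr 2
      · exact (Complex.re_add_im ζ).symm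
      · apply Complex.ext <;> simp
    rw [h1]
    module
  rw [e, hsub] at h
  rw [h, ← Complex.normSq_eq_norm_sq, Complex.normSq_apply, hsub]
  simp only [sq, Complex.mul_re, Complex.mul_im, Complex.conj_re, Complex.conj_im]
  ring

lemma exists_sqHomExt_orthogonal_combination (hf : IsFrameFunction f w) (h0 : ∀ x, 0 ≤ f x)
    (hH : 3 ≤ Module.finrank ℂ H) {a b : H} (hab : ⟪a, b⟫_ℂ = 0) (hn : ‖a‖ = ‖b‖) :
    ∃ γ : ℂ, ∀ z v : ℂ, sqHomExt f (z • a + v • b) =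
      ‖z‖ ^ 2 * sqHomExt f a + ‖v‖ ^ 2 * sqHomExt f b + (γ * (starRingEnd ℂ z * v)).re := by
  obtain ⟨γ, hγ⟩ := hf.exists_sqHomExt_conj_combination h0 hH hab hn
  refine ⟨γ, fun z v => ?_⟩
  have phase : ∀ z : ℂ, ∃ u : ℂ, ‖u‖ = 1 ∧ z = ‖z‖ * u := fun z =>
    ⟨Complex.exp (z.arg * Complex.I), Complex.norm_exp_ofReal_mul_I _,
      (Complex.norm_mul_exp_arg_mul_I z).symm⟩
  obtain ⟨u, hu, hz⟩ := phase z
  obtain ⟨u', hu', hv⟩ := phase v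
  obtain ⟨ζ, hζ⟩ := IsAlgClosed.exists_pow_nat_eq (u * starRingEnd ℂ u') (n := 2) two_pos
  have hζn : ‖ζ‖ = 1 := by
    have : ‖ζ‖ ^ 2 = 1 := by rw [← norm_pow, hζ, norm_mul, RCLike.norm_conj, hu, hu', one_mul]
    exact (pow_eq_one_iff_of_nonneg (norm_nonneg _) two_ne_zero).1 this
  have hunit : ∀ x : ℂ, ‖x‖ = 1 → starRingEnd ℂ x * x = 1 := by
    intro x hx
    rw [mul_comm, Complex.mul_conj, Complex.normSq_eq_norm_sq, hx]
    simp
  have hconj : starRingEnd ℂ ζ ^ 2 = starRingEnd ℂ u * u' := by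
    rw [← map_pow, hζ, map_mul, Complex.conj_conj]
  have e : z • a + v • b = (u * starRingEnd ℂ ζ) •
      ((‖z‖ : ℂ) • ζ • a + (‖v‖ : ℂ) • starRingEnd ℂ ζ • b) := by
    have h1 : z = u * starRingEnd ℂ ζ * (‖z‖ * ζ) := by
      linear_combination hz - ‖z‖ * u * hunit ζ hζn
    have h2 : v = u * starRingEnd ℂ ζ * (‖v‖ * starRingEnd ℂ ζ) := by
      linear_combination hv - ‖v‖ * u * hconj - ‖v‖ * u' * hunit u hu
    rw [smul_add, smul_smul, smul_smul, smul_smul, smul_smul, mul_assoc, mul_assoc]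
    conv_lhs => rw [h1, h2]
    simp only [mul_assoc]
  have horth : ⟪ζ • a, starRingEnd ℂ ζ • b⟫_ℂ = 0 := by
    simp [hab]
  rw [e, hf.sqHomExt_smul, hf.sqHomExt_real_combination h0 hH horth, hγ, hf.sqHomExt_smul,
    hf.sqHomExt_smul, norm_mul, RCLike.norm_conj, hu, hζn, hconj]
  have h3 : starRingEnd ℂ z * v = (‖z‖ * ‖v‖ : ℝ) * (starRingEnd ℂ u * u') := by
    conv_lhs => rw [hz, hv]
    simp only [map_mul, Complex.conj_ofReal]
    push_cast
    ring
  have h4 : (γ * (starRingEnd ℂ z * v)).re = ‖z‖ * ‖v‖ * (γ * (starRingEnd ℂ u * u')).re := by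
    rw [h3, ← Complex.re_ofReal_mul]
    congr 1
    ring
  rw [h4]
  ring

lemma exists_sqHomExt_add_smul (hf : IsFrameFunction f w) (h0 : ∀ x, 0 ≤ f x)
    (hH : 3 ≤ Module.finrank ℂ H) (x y : H) :
    ∃ k : ℂ, ∀ z : ℂ, sqHomExt f (x + z • y) =
      sqHomExt f x + ‖z‖ ^ 2 * sqHomExt f y + (k * z).re := by
  obtain ⟨c, hc⟩ : ∃ c : ℂ, ⟪x, y - c • x⟫_ℂ = 0 := by
    rcases eq_or_ne x 0 with rfl | hx
    · exact ⟨0, by simp⟩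
    · refine ⟨⟪x, y⟫_ℂ / ⟪x, x⟫_ℂ, ?_⟩
      rw [inner_sub_right, inner_smul_right, div_mul_cancel₀ _ (inner_self_ne_zero.2 hx), sub_self]
  obtain ⟨e, he, hxe, hye⟩ := exists_orthonormal_fin_three hH hc
  obtain ⟨p, hp⟩ : ∃ p : ℂ, x = p • e 0 := ⟨_, hxe⟩
  obtain ⟨q', hq'⟩ : ∃ q' : ℂ, y - c • x = q' • e 1 := ⟨_, hye⟩
  obtain ⟨q, hq⟩ : ∃ q : ℂ, y = q • e 0 + q' • e 1 := by
    refine ⟨c * p, ?_⟩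
    rw [← hq', mul_smul, ← hp]
    abel
  obtain ⟨γ, hγ⟩ := hf.exists_sqHomExt_orthogonal_combination h0 hH
    (he.2 (show (0 : Fin 3) ≠ 1 by decide)) ((he.1 0).trans (he.1 1).symm)
  refine ⟨2 * (starRingEnd ℂ p * q) * sqHomExt f (e 0) + γ * (starRingEnd ℂ p * q'), fun z => ?_⟩
  have e1 : x + z • y = (p + z * q) • e 0 + (z * q') • e 1 := by
    rw [hp, hq]
    module
  rw [e1, hγ, hq, hγ, hp, hf.sqHomExt_smul]
  simp only [← Complex.normSq_eq_norm_sq, Complex.normSq_apply, Complex.mul_re, Complex.mul_im,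
    Complex.add_re, Complex.add_im, Complex.conj_re, Complex.conj_im, map_add, map_mul,
    Complex.ofReal_re, Complex.ofReal_im, Complex.re_ofNat, Complex.im_ofNat]
  ring

end IsFrameFunction

/-- A function that restricts to a Hermitian form on every pair of vectors is a Hermitian form. -/
lemma exists_linearMap_of_forall_add_smul {F : H → ℝ}
    (hF : ∀ x y : H, ∃ k : ℂ, ∀ z : ℂ, F (x + z • y) = F x + ‖z‖ ^ 2 * F y + (k * z).re)
    (hsmul : ∀ (z : ℂ) (x : H), F (z • x) = ‖z‖ ^ 2 * F x) :
    ∃ T : H →ₗ[ℂ] H, ∀ x, (F x : ℂ) = ⟪T x, x⟫_ℂ := by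
  choose S hS using hF
  have hpar : ∀ x y, F (x + y) + F (x - y) = 2 * F x + 2 * F y := by
    intro x y
    have h1 := hS x y 1
    have h2 := hS x y (-1)
    simp only [one_smul, neg_smul, ← sub_eq_add_neg, norm_neg, norm_one, mul_neg, mul_one,
      Complex.neg_re] at h1 h2
    rw [h1, h2]
    ring
  have htriple : ∀ x y z, F (x + (y + z)) =
      F (x + y) + F (x + z) + F (y + z) - F x - F y - F z := by
    intro x y z
    have h1 := hpar (x + y) z
    have h2 := hpar (x + z) y
    have h3 := hpar x (y - z)
    have h4 := hpar y z
    rw [show x + y + z = x + (y + z) by abel] at h1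
    rw [show x + z + y = x + (y + z) by abel] at h2
    rw [show x + (y - z) = x + y - z by abel, show x - (y - z) = x + z - y by abel] at h3
    linarith
  have huniq : ∀ x y (k : ℂ), (∀ z : ℂ, F (x + z • y) = F x + ‖z‖ ^ 2 * F y + (k * z).re) →
      S x y = k := by
    intro x y k hk
    have h1 := (hS x y 1).symm.trans (hk 1)
    have h2 := (hS x y Complex.I).symm.trans (hk Complex.I)
    simp only [mul_one, Complex.mul_I_re] at h1 h2
    apply Complex.ext <;> linarith
  have hadd : ∀ x y z, S x (y + z) = S x y + S x z := by
    intro x y z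
    apply huniq
    intro c
    rw [smul_add, htriple, hS x y, hS x z, ← smul_add, hsmul, hsmul, hsmul, add_mul, Complex.add_re]
    ring
  have hsm : ∀ x (c : ℂ) y, S x (c • y) = c * S x y := by
    intro x c y
    apply huniq
    intro z
    rw [smul_smul, hS x y, hsmul, norm_mul, show c * S x y * z = S x y * (z * c) by ring]
    ring
  have hconj : ∀ x y, S y x = starRingEnd ℂ (S x y) := by
    intro x y
    apply huniq
    intro z
    rcases eq_or_ne z 0 with rfl | hz
    · simp
    have e : y + z • x = z • (x + z⁻¹ • y) := by
      rw [smul_add, smul_smul, mul_inv_cancel₀ hz, one_smul, add_comm]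
    have h1 : (starRingEnd ℂ (S x y) * z).re = ‖z‖ ^ 2 * (S x y * z⁻¹).re := by
      rw [← Complex.re_ofReal_mul, ← Complex.conj_re, map_mul, Complex.conj_conj]
      congr 1
      push_cast
      rw [← Complex.mul_conj']
      field_simp
    have hz' : ‖z‖ ≠ 0 := by simpa using hz
    rw [e, hsmul, hS, h1, norm_inv]
    field_simp
    ring
  have hself : ∀ x, (F x : ℂ) = 2⁻¹ * S x x := by
    intro x
    have : S x x = ((2 * F x : ℝ) : ℂ) := by
      apply huniq
      intro z
      rw [show x + z • x = (1 + z) • x by module, hsmul, Complex.re_ofReal_mul,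
        ← Complex.normSq_eq_norm_sq, ← Complex.normSq_eq_norm_sq, Complex.normSq_apply,
        Complex.normSq_apply]
      simp only [Complex.add_re, Complex.add_im, Complex.one_re, Complex.one_im]
      ring
    rw [this]
    push_cast
    ring
  let L : H → (H →L[ℂ] ℂ) := fun x => LinearMap.toContinuousLinearMap
    { toFun := S x, map_add' := hadd x, map_smul' := hsm x }
  have hL : ∀ x y, ⟪(InnerProductSpace.toDual ℂ H).symm (L x), y⟫_ℂ = S x y := fun x y =>
    InnerProductSpace.toDual_symm_apply
  refine ⟨(2⁻¹ : ℂ) •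
    { toFun := fun x => (InnerProductSpace.toDual ℂ H).symm (L x)
      map_add' := fun x y => ext_inner_right ℂ fun v => ?_
      map_smul' := fun c x => ext_inner_right ℂ fun v => ?_ }, fun x => ?_⟩
  · rw [LinearMap.smul_apply, inner_smul_left, LinearMap.coe_mk, AddHom.coe_mk, hL, hself,
      map_inv₀, map_ofNat]
  · rw [inner_add_left, hL, hL, hL, hconj v, hadd, map_add, ← hconj, ← hconj]
  · rw [inner_smul_left, hL, RingHom.id_apply, hL, hconj v, hsm, map_mul, ← hconj]

/-- Gleason's theorem in finite dimension at least three. -/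
theorem IsFrameFunction.exists_linearMap {f : H → ℝ} {w : ℝ} (hf : IsFrameFunction f w)
    (h0 : ∀ x, 0 ≤ f x) (hH : 3 ≤ Module.finrank ℂ H) :
    ∃ T : H →ₗ[ℂ] H, ∀ x, (sqHomExt f x : ℂ) = ⟪T x, x⟫_ℂ :=
  exists_linearMap_of_forall_add_smul (hf.exists_sqHomExt_add_smul h0 hH) hf.sqHomExt_smul

/-- A Hermitian form is determined, by a universal formula, by its values at finitely many
points. -/
lemma exists_forall_inner_map_self_eq_sum (H : Type*) [NormedAddCommGroup H]
    [InnerProductSpace ℂ H] [FiniteDimensional ℂ H] :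
    ∃ (κ : Type) (_ : Fintype κ) (u a b : κ → H), ∀ (T : H →ₗ[ℂ] H) (x : H),
      ⟪T x, x⟫_ℂ = ∑ k, ⟪T (u k), u k⟫_ℂ * (⟪a k, x⟫_ℂ * ⟪x, b k⟫_ℂ) := by
  let e := stdOrthonormalBasis ℂ H
  let c : Fin 4 → ℂ := ![1, -1, Complex.I, -Complex.I]
  let d : Fin 4 → ℂ := ![1 / 4, -1 / 4, Complex.I / 4, -Complex.I / 4]
  refine ⟨(Fin (Module.finrank ℂ H) × Fin (Module.finrank ℂ H)) × Fin 4, inferInstance,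
    fun k => e k.1.1 + c k.2 • e k.1.2, fun k => d k.2 • e k.1.2, fun k => e k.1.1,
    fun T x => ?_⟩
  have h1 : ⟪T x, x⟫_ℂ = ∑ i, ∑ j, ⟪T (e i), e j⟫_ℂ * (⟪e j, x⟫_ℂ * ⟪x, e i⟫_ℂ) := by
    have hx := e.sum_repr x
    conv_lhs => rw [← hx]
    simp only [map_sum, map_smul, sum_inner, inner_sum, inner_smul_left, inner_smul_right,
      e.repr_apply_apply, inner_conj_symm, Finset.mul_sum]
    rw [Finset.sum_comm]
    refine Finset.sum_congr rfl fun i _ => Finset.sum_congr rfl fun j _ => ?_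
    ring
  rw [h1, Fintype.sum_prod_type, Fintype.sum_prod_type]
  refine Finset.sum_congr rfl fun i _ => Finset.sum_congr rfl fun j _ => ?_
  have h4 : starRingEnd ℂ (4 : ℂ) = 4 := map_ofNat _ 4
  simp only [Fin.sum_univ_four, c, d, map_add, map_smul, inner_add_left, inner_add_right,
    inner_smul_left, inner_smul_right, Matrix.cons_val, map_div₀, map_neg, map_one, h4,
    Complex.conj_I]
  ring_nf
  simp only [Complex.I_sq]
  ring

end Complex

section Tensor

variable {n : ℕ} {H : Fin n → Type*} [∀ i, NormedAddCommGroup (H i)]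
  [∀ i, InnerProductSpace ℂ (H i)]

/-- A function that is a Hermitian form in each variable is a sum of products of elementary
Hermitian forms in the variables from `S`. -/
lemma exists_forall_eq_sum_piecewise [∀ i, FiniteDimensional ℂ (H i)] {F : (∀ i, H i) → ℂ}
    (hF : ∀ (i : Fin n) (v : ∀ j, H j), ∃ T : H i →ₗ[ℂ] H i,
      ∀ x, F (Function.update v i x) = ⟪T x, x⟫_ℂ) (S : Finset (Fin n)) :
    ∃ (κ : Type) (_ : Fintype κ) (p a b : κ → ∀ i, H i), ∀ v, F v =
      ∑ k, F (S.piecewise (p k) v) * ∏ i ∈ S, (⟪a k i, v i⟫_ℂ * ⟪v i, b k i⟫_ℂ) := by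
  induction S using Finset.induction_on with
  | empty => exact ⟨Unit, inferInstance, 0, 0, 0, by simp⟩
  | insert i S hi ih =>
    obtain ⟨κ, _, p, a, b, h⟩ := ih
    obtain ⟨κ', _, u, a', b', h'⟩ := exists_forall_inner_map_self_eq_sum (H i)
    have hsingle : ∀ v, F v = ∑ k, F (Function.update v i (u k)) *
        (⟪a' k, v i⟫_ℂ * ⟪v i, b' k⟫_ℂ) := by
      intro v
      obtain ⟨T, hT⟩ := hF i v
      simp only [hT, ← h']
      rw [← hT, Function.update_eq_self]
    refine ⟨κ × κ', inferInstance, fun k => Function.update (p k.1) i (u k.2),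
      fun k => Function.update (a k.1) i (a' k.2), fun k => Function.update (b k.1) i (b' k.2),
      fun v => ?_⟩
    rw [h v, Fintype.sum_prod_type]
    refine Finset.sum_congr rfl fun k _ => ?_
    rw [hsingle, Finset.sum_mul]
    refine Finset.sum_congr rfl fun k' _ => ?_
    have h1 : S.piecewise (Function.update (p k) i (u k')) v = S.piecewise (p k) v := by
      refine Finset.piecewise_congr _ (fun j hj => ?_) (fun _ _ => rfl)
      have hji : j ≠ i := fun hji => hi (hji ▸ hj)
      rw [Function.update_of_ne hji]
    have h2 : ∏ j ∈ S, (⟪Function.update (a k) i (a' k') j, v j⟫_ℂ *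
        ⟪v j, Function.update (b k) i (b' k') j⟫_ℂ) =
        ∏ j ∈ S, (⟪a k j, v j⟫_ℂ * ⟪v j, b k j⟫_ℂ) := by
      refine Finset.prod_congr rfl fun j hj => ?_
      have hji : j ≠ i := fun hji => hi (hji ▸ hj)
      rw [Function.update_of_ne hji, Function.update_of_ne hji]
    beta_reduce
    rw [Finset.piecewise_insert, h1, Function.update_self, Finset.prod_insert hi, h2,
      Function.update_self, Function.update_self, Finset.piecewise_eq_of_notMem _ _ _ hi]
    ring

namespace IsHilbertTensorMap

variable {E : Type*} [NormedAddCommGroup E] [InnerProductSpace ℂ E] {t : (∀ i, H i) → E}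

lemma norm_eq_one (ht : IsHilbertTensorMap t) {ν : ∀ i, H i} (hν : ∀ i, ‖ν i‖ = 1) :
    ‖t ν‖ = 1 := by
  have h := ht.1 ν ν
  simp only [inner_self_eq_norm_sq_to_K, hν] at h
  refine (pow_eq_one_iff_of_nonneg (norm_nonneg _) two_ne_zero).1 (Complex.ofReal_injective ?_)
  simpa using h

lemma orthonormal (ht : IsHilbertTensorMap t) {ι : Fin n → Type*} {e : ∀ j, ι j → H j}
    (he : ∀ j, Orthonormal ℂ (e j)) :
    Orthonormal ℂ (fun I : ∀ j, ι j => t fun j => e j (I j)) := by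
  refine ⟨fun I => ht.norm_eq_one fun j => (he j).1 _, fun I J hIJ => ?_⟩
  obtain ⟨j, hj⟩ := Function.ne_iff.1 hIJ
  beta_reduce
  rw [ht.1]
  exact Finset.prod_eq_zero (Finset.mem_univ j) ((he j).2 hj)

lemma finrank_eq [∀ i, FiniteDimensional ℂ (H i)] [FiniteDimensional ℂ E]
    (ht : IsHilbertTensorMap t) :
    Module.finrank ℂ E = Fintype.card (∀ j, Fin (Module.finrank ℂ (H j))) := by
  let e := fun j => stdOrthonormalBasis ℂ (H j)
  let m : MultilinearMap ℂ H E :=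
    { toFun := t
      map_update_add' := by
        intro _ v i a b
        convert ht.2.1 v i a b
      map_update_smul' := by
        intro _ v i z a
        convert ht.2.2.1 v i z a }
  have hon := ht.orthonormal fun j => (e j).orthonormal
  have hspan : ⊤ ≤ Submodule.span ℂ
      (Set.range fun I : ∀ j, Fin (Module.finrank ℂ (H j)) => t fun j => e j (I j)) := by
    have hclosed := ht.2.2.2
    rw [IsClosed.submodule_topologicalClosure_eq (Submodule.closed_of_finiteDimensional _)]
      at hclosed
    rw [← hclosed, Submodule.span_le]
    rintro _ ⟨v, rfl⟩
    have hv : v = fun j => ∑ k, (e j).repr (v j) k • e j k :=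
      funext fun j => ((e j).sum_repr _).symm
    change m v ∈ _
    rw [hv, m.map_sum]
    refine Submodule.sum_mem _ fun I _ => ?_
    rw [m.map_smul_univ]
    exact Submodule.smul_mem _ _ (Submodule.subset_span ⟨I, rfl⟩)
  exact Module.finrank_eq_card_basis (OrthonormalBasis.mk hon hspan).toBasis

variable [∀ i, FiniteDimensional ℂ (H i)] [FiniteDimensional ℂ E]

lemma exists_isFrameFunction_update (ht : IsHilbertTensorMap t)
    (hdim : ∀ i, 0 < Module.finrank ℂ (H i)) {f : E → ℝ} {w : ℝ}
    (hf : ∀ (ι : Type) (_ : Fintype ι) (b : OrthonormalBasis ι ℂ E),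
      (∀ i, ∃ ν : ∀ j, H j, (∀ j, ‖ν j‖ = 1) ∧ b i = t ν) → ∑ i, f (b i) = w)
    {ν : ∀ j, H j} (hν : ∀ j, ‖ν j‖ = 1) (i : Fin n) :
    ∃ w', IsFrameFunction (fun x : H i => f (t (Function.update ν i x))) w' := by
  classical
  let z : ∀ j, Fin (Module.finrank ℂ (H j)) := fun j => ⟨0, hdim j⟩
  have hbasis : ∀ j, ∃ e : OrthonormalBasis (Fin (Module.finrank ℂ (H j))) ℂ (H j),
      e (z j) = ν j := by
    intro j
    obtain ⟨e, he⟩ := Orthonormal.exists_orthonormalBasis_extension_of_card_eq (𝕜 := ℂ)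
      (ι := Fin (Module.finrank ℂ (H j))) (v := fun _ => ν j) (s := {z j}) (by simp)
      ⟨fun _ => hν j, fun k l hkl => (hkl (Subsingleton.elim _ _)).elim⟩
    exact ⟨e, he _ rfl⟩
  choose e he using hbasis
  let special : (∀ j, Fin (Module.finrank ℂ (H j))) → Prop := fun I => ∀ k, k ≠ i → I k = z k
  let c : OrthonormalBasis (Fin (Module.finrank ℂ (H i))) ℂ (H i) →
      (∀ j, Fin (Module.finrank ℂ (H j))) → ∀ j, H j := fun b I j =>
    (if special I then Function.update e i b else e) j (I j)
  have hc : ∀ b I, special I → c b I = Function.update ν i (b (I i)) := by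
    intro b I hI
    funext j
    simp only [c, if_pos hI]
    rcases eq_or_ne j i with rfl | hj
    · simp
    · rw [Function.update_of_ne hj, Function.update_of_ne hj, hI j hj, he]
  have hc' : ∀ b I, ¬ special I → c b I = fun j => e j (I j) := by
    intro b I hI
    funext j
    simp only [c, if_neg hI]
  have horth_mixed : ∀ b I J, special I → ¬ special J → ⟪t (c b I), t (c b J)⟫_ℂ = 0 := by
    intro b I J hI hJ
    obtain ⟨k, hk, hJk⟩ : ∃ k, k ≠ i ∧ J k ≠ z k := by simpa [special] using hJ
    rw [ht.1]
    refine Finset.prod_eq_zero (Finset.mem_univ k) ?_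
    rw [hc b I hI, hc' b J hJ, Function.update_of_ne hk, ← he]
    exact (e k).orthonormal.2 hJk.symm
  have horth : ∀ b, Orthonormal ℂ fun I => t (c b I) := by
    intro b
    refine ⟨fun I => ht.norm_eq_one fun j => OrthonormalBasis.norm_eq_one _ _, fun I J hIJ => ?_⟩
    by_cases hI : special I <;> by_cases hJ : special J
    · have := (ht.orthonormal fun j => (Function.update e i b j).orthonormal).2 hIJ
      simpa only [c, if_pos hI, if_pos hJ] using this
    · exact horth_mixed b I J hI hJ
    · exact inner_eq_zero_symm.1 (horth_mixed b J I hJ hI)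
    · have := (ht.orthonormal fun j => (e j).orthonormal).2 hIJ
      simpa only [c, if_neg hI, if_neg hJ] using this
  have hsum : ∀ b : OrthonormalBasis (Fin (Module.finrank ℂ (H i))) ℂ (H i),
      ∑ k, f (t (Function.update ν i (b k))) +
      ∑ I with ¬ special I, f (t fun j => e j (I j)) = w := by
    intro b
    obtain ⟨B, hB⟩ := (horth b).exists_orthonormalBasis_eq ht.finrank_eq
    have h := hf _ inferInstance B fun I =>
      ⟨c b I, fun j => OrthonormalBasis.norm_eq_one _ _, by rw [hB]⟩
    rw [hB, ← Finset.sum_filter_add_sum_filter_not _ special] at h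
    beta_reduce at h
    rw [← h]
    refine congrArg₂ (· + ·) ?_ ?_
    · refine Finset.sum_nbij' (fun k => Function.update z i k) (fun I => I i) ?_ ?_ ?_ ?_ ?_
      · intro k _
        simp only [Finset.mem_filter, Finset.mem_univ, true_and]
        intro j hj
        rw [Function.update_of_ne hj]
      · simp
      · simp
      · intro I hI
        simp only [Finset.mem_filter, Finset.mem_univ, true_and] at hI
        funext j
        rcases eq_or_ne j i with rfl | hj
        · simp
        · rw [Function.update_of_ne hj, hI j hj]
      · intro k _
        rw [hc, Function.update_self]
        intro j hj
        rw [Function.update_of_ne hj]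
    · refine Finset.sum_congr rfl fun I hI => ?_
      rw [hc' b I (by simpa using hI)]
  refine ⟨w - ∑ I with ¬ special I, f (t fun j => e j (I j)), fun ι _ b => ?_⟩
  have hcard : Fintype.card ι = Module.finrank ℂ (H i) :=
    (Module.finrank_eq_card_basis b.toBasis).symm
  rw [eq_sub_iff_add_eq, ← hsum (b.reindex (Fintype.equivFinOfCardEq hcard))]
  congr 1
  refine Fintype.sum_equiv (Fintype.equivFinOfCardEq hcard) _ _ fun k => ?_
  simp

/-- The extension of a function of unit simple tensors that is homogeneous of degree two in each
variable. -/
noncomputable def sqHomExt (t : (∀ i, H i) → E) (f : E → ℝ) (v : ∀ i, H i) : ℝ :=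
  (∏ j, ‖v j‖ ^ 2) * f (t fun j => (‖v j‖⁻¹ : ℂ) • v j)

lemma exists_linearMap_update (ht : IsHilbertTensorMap t)
    (hdim : ∀ i, 3 ≤ Module.finrank ℂ (H i)) {f : E → ℝ} {w : ℝ} (h0 : ∀ x, 0 ≤ f x)
    (hf : ∀ (ι : Type) (_ : Fintype ι) (b : OrthonormalBasis ι ℂ E),
      (∀ i, ∃ ν : ∀ j, H j, (∀ j, ‖ν j‖ = 1) ∧ b i = t ν) → ∑ i, f (b i) = w)
    (i : Fin n) (v : ∀ j, H j) :
    ∃ T : H i →ₗ[ℂ] H i, ∀ x, (sqHomExt t f (Function.update v i x) : ℂ) = ⟪T x, x⟫_ℂ := by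
  by_cases hv : ∃ j, j ≠ i ∧ v j = 0
  · obtain ⟨j, hj, hvj⟩ := hv
    refine ⟨0, fun x => ?_⟩
    have : ∏ k, ‖Function.update v i x k‖ ^ 2 = 0 :=
      Finset.prod_eq_zero (Finset.mem_univ j) (by simp [Function.update_of_ne hj, hvj])
    simp [sqHomExt, this, -Complex.ofReal_mul, -Complex.ofReal_prod]
  push Not at hv
  have : Nontrivial (H i) := Module.nontrivial_of_finrank_pos (R := ℂ) (by have := hdim i; omega)
  obtain ⟨y, hy⟩ := exists_norm_eq (H i) zero_le_one
  let ν : ∀ j, H j := Function.update (fun j => (‖v j‖⁻¹ : ℂ) • v j) i y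
  have hν : ∀ j, ‖ν j‖ = 1 := by
    intro j
    rcases eq_or_ne j i with rfl | hj
    · simp [ν, hy]
    · simp [ν, Function.update_of_ne hj, norm_smul, hv j hj]
  obtain ⟨w', hw'⟩ := ht.exists_isFrameFunction_update (fun i => by have := hdim i; omega) hf hν i
  obtain ⟨T, hT⟩ := hw'.exists_linearMap (fun _ => h0 _) (hdim i)
  refine ⟨((∏ j ∈ Finset.univ.erase i, ‖v j‖ ^ 2 : ℝ) : ℂ) • T, fun x => ?_⟩
  rw [LinearMap.smul_apply, inner_smul_left, ← hT, Complex.conj_ofReal, sqHomExt, _root_.sqHomExt]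
  have h1 : (fun j => (‖Function.update v i x j‖⁻¹ : ℂ) • Function.update v i x j) =
      Function.update ν i ((‖x‖⁻¹ : ℂ) • x) := by
    funext j
    rcases eq_or_ne j i with rfl | hj
    · simp
    · simp [ν, Function.update_of_ne hj]
  have h2 : ∏ j, ‖Function.update v i x j‖ ^ 2 =
      ‖x‖ ^ 2 * ∏ j ∈ Finset.univ.erase i, ‖v j‖ ^ 2 := by
    rw [← Finset.mul_prod_erase _ _ (Finset.mem_univ i), Function.update_self]
    congr 1
    refine Finset.prod_congr rfl fun j hj => ?_
    rw [Function.update_of_ne (Finset.ne_of_mem_erase hj)]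
  rw [h1, h2]
  push_cast
  ring

end IsHilbertTensorMap

end Tensor

end Gleason

/-- Wallach's unentangled Gleason theorem: every unentangled frame function on
finite dimensional Hilbert spaces of dimension at least 3 is represented by a
self-adjoint operator `T` on the tensor product, via
`f (ν₁ ⊗ ⋯ ⊗ νₙ) = Tr((p₁ ⊗ ⋯ ⊗ pₙ) T) = ⟪T (ν₁ ⊗ ⋯ ⊗ νₙ), ν₁ ⊗ ⋯ ⊗ νₙ⟫`. -/
theorem wallach_unentangled_gleason
    {n : ℕ} {H : Fin n → Type*}
    [∀ i, NormedAddCommGroup (H i)] [∀ i, InnerProductSpace ℂ (H i)]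
    [∀ i, FiniteDimensional ℂ (H i)]
    (hdim : ∀ i, 3 ≤ Module.finrank ℂ (H i))
    {E : Type*} [NormedAddCommGroup E] [InnerProductSpace ℂ E]
    [FiniteDimensional ℂ E]
    (t : (∀ i, H i) → E) (ht : IsHilbertTensorMap t)
    (f : E → ℝ) (w : ℝ)
    -- `f` is an unentangled frame function of weight `w`
    (hf_nonneg : ∀ x, 0 ≤ f x)
    (hf : ∀ (ι : Type) (_ : Fintype ι) (b : OrthonormalBasis ι ℂ E),
      (∀ i, ∃ ν : ∀ j, H j, (∀ j, ‖ν j‖ = 1) ∧ b i = t ν) →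
      ∑ i, f (b i) = w) :
    ∃ T : E →L[ℂ] E, IsSelfAdjoint T ∧
      ∀ ν : ∀ j, H j, (∀ j, ‖ν j‖ = 1) →
        (f (t ν) : ℂ) = ⟪T (t ν), t ν⟫_ℂ := by
  obtain ⟨κ, _, p, a, b, h⟩ := exists_forall_eq_sum_piecewise
    (F := fun v => (IsHilbertTensorMap.sqHomExt t f v : ℂ))
    (ht.exists_linearMap_update hdim hf_nonneg hf) Finset.univ
  let T : E →L[ℂ] E := ∑ k,
    (IsHilbertTensorMap.sqHomExt t f (p k) : ℂ) • InnerProductSpace.rankOne ℂ (t (a k)) (t (b k))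
  have hT : ∀ ν : ∀ j, H j, (∀ j, ‖ν j‖ = 1) → ⟪T (t ν), t ν⟫_ℂ = (f (t ν) : ℂ) := by
    intro ν hν
    have hνf : IsHilbertTensorMap.sqHomExt t f ν = f (t ν) := by
      simp [IsHilbertTensorMap.sqHomExt, hν]
    have hsum := h ν
    simp only [hνf, Finset.piecewise_univ, Finset.prod_mul_distrib, ← ht.1] at hsum
    simp only [T, sum_apply, smul_apply, sum_inner,
      inner_smul_left, InnerProductSpace.rankOne_apply, Complex.conj_ofReal, inner_conj_symm]
    rw [hsum]
    refine Finset.sum_congr rfl fun k _ => ?_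
    ring
  have hstar : IsSelfAdjoint ((2⁻¹ : ℂ) • (T + star T)) := by
    rw [IsSelfAdjoint, star_smul, star_add, star_star, add_comm (star T), star_inv₀]
    simp
  refine ⟨(2⁻¹ : ℂ) • (T + star T), hstar, fun ν hν => ?_⟩
  rw [smul_apply, add_apply, inner_smul_left, inner_add_left, ContinuousLinearMap.star_eq_adjoint,
    ContinuousLinearMap.adjoint_inner_left, ← inner_conj_symm (t ν) (T (t ν)), hT ν hν,
    Complex.conj_ofReal, map_inv₀, map_ofNat]
  ring
end
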